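/- arXiv:1609.08172 — 3 statements merged into one kernel-verified Lean document; each statement's English description precedes it below -/
import Mathlib

section
/- Let G be a finite subgroup of U(d) that forms a unitary t-design, i.e. (1/|G|)·Σ_{U∈G} U^{⊗t} ⊗ (U^{⊗t})^* = ∫ U^{⊗t} ⊗ (U^{⊗t})^* dμ(U) with μ the Haar probability measure on U(d). Then for every unit vector ψ ∈ ℂ^d, (1/|G|)·Σ_{U∈G} (U|ψ⟩⟨ψ|U^†)^{⊗t} = P_[t]/C(d+t−1, t); that is, every orbit of unit vectors of G forms a complex projective t-design. -/
open scoped BigOperators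

noncomputable section

/-- `t`-fold tensor (Kronecker) power of a matrix, acting on `(ℂ^α)^{⊗t}`. -/
def tpow {α : Type*} [Fintype α] (M : Matrix α α ℂ) (t : ℕ) :
    Matrix (Fin t → α) (Fin t → α) ℂ :=
  Matrix.of fun x y => ∏ i, M (x i) (y i)

/-- The rank-one operator `|ψ⟩⟨ψ|`. -/
def rankOne {α : Type*} (ψ : α → ℂ) : Matrix α α ℂ :=
  Matrix.of fun i j => ψ i * (starRingEnd ℂ) (ψ j)

/-- The operator `U_σ` permuting the `t` tensor factors of `(ℂ^α)^{⊗t}`. -/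
def permOp (α : Type*) [DecidableEq α] {t : ℕ} (σ : Equiv.Perm (Fin t)) :
    Matrix (Fin t → α) (Fin t → α) ℂ :=
  Matrix.of fun x y => if (fun k => x (σ k)) = y then 1 else 0

/-- The projector `P_[t]` onto the symmetric subspace `Sym_t(ℂ^α)`. -/
def symProj (α : Type*) [DecidableEq α] (t : ℕ) :
    Matrix (Fin t → α) (Fin t → α) ℂ :=
  (t.factorial : ℂ)⁻¹ • ∑ σ : Equiv.Perm (Fin t), permOp α σ

open MeasureTheory

instance matrixMeasurableSpace (m n : Type*) [MeasurableSpace (m → n → ℂ)] :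
    MeasurableSpace (Matrix m n ℂ) :=
  inferInstanceAs (MeasurableSpace (m → n → ℂ))

theorem exists_perm_comp_eq {α ι : Type*} [Fintype ι] [DecidableEq α] {x y : ι → α}
    (h : ∀ j, Fintype.card {i // x i = j} = Fintype.card {i // y i = j}) :
    ∃ σ : Equiv.Perm ι, y ∘ σ = x :=
  ⟨Equiv.ofFiberEquiv fun j => Fintype.equivOfCardEq (h j),
    funext fun i => Equiv.ofFiberEquiv_map _ i⟩

theorem sum_single_apply_eq_card {α ι : Type*} [Fintype ι] [DecidableEq α] (x : ι → α) (j : α) :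
    (∑ i, Finsupp.single (x i) 1 : α →₀ ℕ) j = Fintype.card {i // x i = j} := by
  simp [Finsupp.finsetSum_apply, Finsupp.single_apply, Fintype.card_subtype]

/-- A permutation-invariant coefficient family is determined by the homogeneous polynomial it
defines. -/
theorem eq_zero_of_forall_sum_mul_prod_eq_zero {α ι : Type*} [Fintype α] [DecidableEq α]
    [Fintype ι] [DecidableEq ι] (g : (ι → α) → ℂ)
    (hg : ∀ (σ : Equiv.Perm ι) x, g (x ∘ σ) = g x)
    (h : ∀ z : α → ℂ, ∑ x, g x * ∏ i, z (x i) = 0) (x : ι → α) : g x = 0 := by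
  have hp : (∑ x, MvPolynomial.monomial (∑ i, Finsupp.single (x i) 1) (g x) :
      MvPolynomial α ℂ) = 0 := by
    apply MvPolynomial.funext
    intro z
    rw [map_zero, ← h z, map_sum]
    refine Finset.sum_congr rfl fun x _ => ?_
    rw [← mul_one (g x), ← MvPolynomial.C_mul_monomial, MvPolynomial.monomial_sum_one]
    simp [MvPolynomial.eval_monomial]
  have hc := congrArg (MvPolynomial.coeff (∑ i, Finsupp.single (x i) 1)) hp
  rw [MvPolynomial.coeff_sum] at hc
  simp only [MvPolynomial.coeff_monomial, MvPolynomial.coeff_zero] at hc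
  rw [Finset.sum_congr rfl (g := fun y =>
    if (∑ i, Finsupp.single (y i) 1 : α →₀ ℕ) = ∑ i, Finsupp.single (x i) 1 then g x else 0)] at hc
  · rw [← Finset.sum_filter, Finset.sum_const, smul_eq_zero] at hc
    refine hc.resolve_left fun h0 => ?_
    rw [Finset.card_eq_zero] at h0
    exact Finset.notMem_empty x (h0 ▸ by simp)
  · intro y _
    split_ifs with hxy
    · obtain ⟨σ, hσ⟩ := exists_perm_comp_eq (x := y) (y := x) fun j => by
        rw [← sum_single_apply_eq_card, ← sum_single_apply_eq_card, hxy]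
      rw [← hσ, hg]
    · rfl

theorem infinite_range_ofReal : (Set.range ((↑) : ℝ → ℂ)).Infinite :=
  Set.infinite_range_of_injective Complex.ofReal_injective

/-- Polarization: a polynomial in `conj φ` and `φ` that vanishes for all `φ` vanishes when
`conj φ` and `φ` are replaced by independent variables. -/
theorem sum_mul_prod_mul_prod_eq_zero {α ι : Type*} [Fintype α] [DecidableEq α]
    [Fintype ι] [DecidableEq ι] (B : (ι → α) → (ι → α) → ℂ)
    (h : ∀ φ : α → ℂ,
      ∑ x, ∑ y, B x y * (∏ i, (starRingEnd ℂ) (φ (x i))) * ∏ i, φ (y i) = 0)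
    (w z : α → ℂ) : ∑ x, ∑ y, B x y * (∏ i, w (x i)) * ∏ i, z (y i) = 0 := by
  let Q : MvPolynomial (α ⊕ α) ℂ := ∑ x, ∑ y, MvPolynomial.C (B x y) *
    (∏ i, (MvPolynomial.X (Sum.inl (x i)) -
      MvPolynomial.C Complex.I * MvPolynomial.X (Sum.inr (x i)))) *
    ∏ i, (MvPolynomial.X (Sum.inl (y i)) +
      MvPolynomial.C Complex.I * MvPolynomial.X (Sum.inr (y i)))
  have hev : ∀ v : α ⊕ α → ℂ, MvPolynomial.eval v Q = ∑ x, ∑ y, B x y *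
      (∏ i, (v (Sum.inl (x i)) - Complex.I * v (Sum.inr (x i)))) *
      ∏ i, (v (Sum.inl (y i)) + Complex.I * v (Sum.inr (y i))) := by
    intro v
    simp [Q]
  have hQ : Q = 0 := by
    refine MvPolynomial.funext_set (fun _ => Set.range ((↑) : ℝ → ℂ))
      (fun _ => infinite_range_ofReal) fun v hv => ?_
    choose r hr using fun i => hv i trivial
    rw [map_zero, hev, ← h fun j => v (Sum.inl j) + Complex.I * v (Sum.inr j)]
    simp [← hr, sub_eq_add_neg]
  have := hev (Sum.elim (fun j => (z j + w j) / 2) fun j => (z j - w j) / (2 * Complex.I))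
  rw [hQ, map_zero] at this
  rw [this]
  have h1 : ∀ a b : ℂ, (a + b) / 2 - Complex.I * ((a - b) / (2 * Complex.I)) = b := by
    intro a b
    field_simp [Complex.I_ne_zero]
    ring
  have h2 : ∀ a b : ℂ, (a + b) / 2 + Complex.I * ((a - b) / (2 * Complex.I)) = a := by
    intro a b
    field_simp [Complex.I_ne_zero]
    ring
  simp [h1, h2]

theorem eq_zero_of_forall_sum_conj_prod_eq_zero {α ι : Type*} [Fintype α] [DecidableEq α]
    [Fintype ι] [DecidableEq ι] (B : (ι → α) → (ι → α) → ℂ)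
    (hl : ∀ (σ : Equiv.Perm ι) x y, B (x ∘ σ) y = B x y)
    (hr : ∀ (σ : Equiv.Perm ι) x y, B x (y ∘ σ) = B x y)
    (h : ∀ φ : α → ℂ,
      ∑ x, ∑ y, B x y * (∏ i, (starRingEnd ℂ) (φ (x i))) * ∏ i, φ (y i) = 0)
    (x y : ι → α) : B x y = 0 := by
  refine eq_zero_of_forall_sum_mul_prod_eq_zero (B x) (fun σ => hr σ x) (fun z => ?_) y
  refine eq_zero_of_forall_sum_mul_prod_eq_zero (fun x => ∑ y, B x y * ∏ i, z (y i))
    (fun σ x => by simp only [hl]) (fun w => ?_) x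
  rw [← sum_mul_prod_mul_prod_eq_zero B h w z]
  refine Finset.sum_congr rfl fun x _ => ?_
  rw [Finset.sum_mul]
  exact Finset.sum_congr rfl fun y _ => by ring

theorem symProj_apply {α : Type*} [DecidableEq α] {t : ℕ} (x y : Fin t → α) :
    symProj α t x y = (t.factorial : ℂ)⁻¹ *
      ∑ σ : Equiv.Perm (Fin t), if x ∘ σ = y then 1 else 0 := by
  simp [symProj, permOp, Matrix.sum_apply, Function.comp_def]

theorem symProj_comp_left {α : Type*} [DecidableEq α] {t : ℕ} (τ : Equiv.Perm (Fin t))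
    (x y : Fin t → α) : symProj α t (x ∘ τ) y = symProj α t x y := by
  rw [symProj_apply, symProj_apply]
  congr 1
  exact Fintype.sum_equiv (Equiv.mulLeft τ) _ _ fun σ => if_congr Iff.rfl rfl rfl

theorem symProj_comp_right {α : Type*} [DecidableEq α] {t : ℕ} (τ : Equiv.Perm (Fin t))
    (x y : Fin t → α) : symProj α t x (y ∘ τ) = symProj α t x y := by
  rw [symProj_apply, symProj_apply]
  congr 1
  refine Fintype.sum_equiv (Equiv.mulRight τ⁻¹) _ _ fun σ => ?_
  have : x ∘ σ = y ∘ τ ↔ x ∘ ⇑(σ * τ⁻¹) = y := by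
    rw [Equiv.Perm.coe_mul, ← Function.comp_assoc]
    exact (Equiv.comp_symm_eq τ y (x ∘ σ)).symm
  exact if_congr this rfl rfl

theorem sum_symProj_mul_prod {α : Type*} [Fintype α] [DecidableEq α] {t : ℕ} (w z : α → ℂ) :
    ∑ x, ∑ y, symProj α t x y * (∏ i, w (x i)) * ∏ i, z (y i) = (∑ j, w j * z j) ^ t := by
  have hσ : ∀ (σ : Equiv.Perm (Fin t)) (x : Fin t → α),
      ∏ i, z ((x ∘ σ) i) = ∏ i, z (x i) := fun σ x => Equiv.prod_comp σ fun i => z (x i)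
  have hf : (t.factorial : ℂ) ≠ 0 := by exact_mod_cast t.factorial_ne_zero
  rw [Fintype.sum_pow]
  refine Finset.sum_congr rfl fun x _ => ?_
  have : ∀ y, symProj α t x y * (∏ i, w (x i)) * ∏ i, z (y i) =
      (t.factorial : ℂ)⁻¹ * (∏ i, w (x i)) *
        ∑ σ : Equiv.Perm (Fin t), if x ∘ σ = y then ∏ i, z (y i) else 0 := by
    intro y
    rw [symProj_apply, mul_right_comm, mul_assoc _ _ (∏ i, z (y i)), Finset.sum_mul]
    simp only [ite_mul, one_mul, zero_mul]
    ring
  simp_rw [this]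
  rw [← Finset.mul_sum, Finset.sum_comm]
  simp only [Finset.sum_ite_eq, Finset.mem_univ, if_true, hσ, Finset.sum_const, Finset.card_univ,
    Fintype.card_perm, Fintype.card_fin, nsmul_eq_mul, Finset.prod_mul_distrib]
  field_simp

/-- The rank of the symmetric subspace, computed as the trace of its projector. -/
theorem trace_symProj (d t : ℕ) :
    ∑ x, symProj (Fin d) t x x = ((d + t - 1).choose t : ℂ) := by
  classical
  let f : (Fin t → Fin d) → Sym (Fin d) t := fun x =>
    ⟨Finset.univ.val.map x, by simp⟩
  have hcount : ∀ x j, (f x).1.count j = Fintype.card {i // x i = j} := by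
    intro x j
    simp only [f]
    rw [Multiset.count_map, Fintype.card_subtype]
    simp [Finset.card_def, eq_comm]
  have hperm : ∀ x y, f y = f x ↔ ∃ σ : Equiv.Perm (Fin t), x ∘ σ = y := by
    intro x y
    constructor
    · intro h
      exact exists_perm_comp_eq fun j => by rw [← hcount, ← hcount, h]
    · rintro ⟨σ, rfl⟩
      refine Subtype.ext (Multiset.ext.2 fun j => ?_)
      rw [hcount, hcount]
      exact Fintype.card_congr (σ.subtypeEquiv fun i => Iff.rfl)
  have hsurj : Function.Surjective f := by
    rintro ⟨s, hs⟩
    induction s using Quotient.inductionOn with | _ l =>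
    have hl : l.length = t := by simpa using hs
    subst hl
    refine ⟨l.get, Subtype.ext ?_⟩
    simp [f]
  have hfib : ∀ s : Sym (Fin d) t, ∑ x with f x = s, symProj (Fin d) t x x = 1 := by
    intro s
    obtain ⟨x₀, rfl⟩ := hsurj s
    have hone : ∑ y with f y = f x₀, symProj (Fin d) t x₀ y = 1 := by
      simp_rw [symProj_apply]
      rw [← Finset.mul_sum, Finset.sum_comm]
      have : ∀ σ : Equiv.Perm (Fin t), f (x₀ ∘ σ) = f x₀ := fun σ => (hperm _ _).2 ⟨σ, rfl⟩
      have hf : (t.factorial : ℂ) ≠ 0 := by exact_mod_cast t.factorial_ne_zero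
      simp [this, Fintype.card_perm, hf]
    rw [← hone]
    refine Finset.sum_congr rfl fun y hy => ?_
    obtain ⟨σ, rfl⟩ := (hperm _ _).1 (Finset.mem_filter.1 hy).2
    rw [symProj_comp_left]
  rw [← Finset.sum_fiberwise Finset.univ f]
  simp [hfib, Sym.card_sym_eq_choose]

/-- The quantity `|⟨φ, U ψ⟩|^{2t}`, as a complex number. -/
def overlapPow {α : Type*} [Fintype α] (t : ℕ) (φ ψ : α → ℂ) (U : Matrix α α ℂ) : ℂ :=
  (star φ ⬝ᵥ U.mulVec ψ) ^ t * (starRingEnd ℂ) ((star φ ⬝ᵥ U.mulVec ψ) ^ t)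

theorem overlapPow_eq_sum {α : Type*} [Fintype α] (t : ℕ) (φ ψ : α → ℂ) (U : Matrix α α ℂ) :
    overlapPow t φ ψ U = ∑ p : Fin t → α × α, ∑ q : Fin t → α × α,
      ((∏ i, (starRingEnd ℂ) (φ (p i).1) * ψ (p i).2) *
        (starRingEnd ℂ) (∏ i, (starRingEnd ℂ) (φ (q i).1) * ψ (q i).2)) *
      ((∏ i, U (p i).1 (p i).2) * (starRingEnd ℂ) (∏ i, U (q i).1 (q i).2)) := by
  have h : (star φ ⬝ᵥ U.mulVec ψ) ^ t = ∑ p : Fin t → α × α,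
      (∏ i, (starRingEnd ℂ) (φ (p i).1) * ψ (p i).2) * ∏ i, U (p i).1 (p i).2 := by
    have : star φ ⬝ᵥ U.mulVec ψ =
        ∑ p : α × α, (starRingEnd ℂ) (φ p.1) * ψ p.2 * U p.1 p.2 := by
      rw [Fintype.sum_prod_type]
      simp only [dotProduct, Matrix.mulVec, Finset.mul_sum, Pi.star_apply, RCLike.star_def]
      exact Finset.sum_congr rfl fun i _ => Finset.sum_congr rfl fun j _ => by ring
    rw [this, Fintype.sum_pow]
    simp only [Finset.prod_mul_distrib]
  rw [overlapPow, h, map_sum, Finset.sum_mul_sum]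
  refine Finset.sum_congr rfl fun p _ => Finset.sum_congr rfl fun q _ => ?_
  rw [map_mul]
  ring

theorem overlapPow_conjTranspose_mul {α : Type*} [Fintype α] (t : ℕ) (φ ψ : α → ℂ)
    (V U : Matrix α α ℂ) :
    overlapPow t φ ψ (V.conjTranspose * U) = overlapPow t (V.mulVec φ) ψ U := by
  rw [overlapPow, overlapPow, Matrix.star_mulVec, ← Matrix.dotProduct_mulVec,
    Matrix.mulVec_mulVec]

theorem overlapPow_real_smul {α : Type*} [Fintype α] (t : ℕ) (r : ℝ) (φ ψ : α → ℂ)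
    (U : Matrix α α ℂ) :
    overlapPow t ((r : ℂ) • φ) ψ U = ((r : ℂ) ^ 2) ^ t * overlapPow t φ ψ U := by
  simp only [overlapPow, star_smul, smul_dotProduct, smul_eq_mul, mul_pow, map_mul, map_pow,
    RCLike.star_def, Complex.conj_ofReal]
  ring

theorem sum_tpow_rankOne_mul_prod {α : Type*} [Fintype α] (t : ℕ) (φ ψ : α → ℂ)
    (U : Matrix α α ℂ) :
    ∑ x, ∑ y, tpow (rankOne (U.mulVec ψ)) t x y * (∏ i, (starRingEnd ℂ) (φ (x i))) *
      ∏ i, φ (y i) = overlapPow t φ ψ U := by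
  simp only [overlapPow, dotProduct, Fintype.sum_pow, map_sum, Finset.sum_mul_sum, map_prod,
    map_mul, tpow, rankOne, Matrix.of_apply, Finset.prod_mul_distrib, Pi.star_apply,
    RCLike.star_def, Complex.conj_conj]
  exact Finset.sum_congr rfl fun p _ => Finset.sum_congr rfl fun q _ => by ring

theorem trace_tpow_rankOne {α : Type*} [Fintype α] (t : ℕ) (v : α → ℂ)
    (hv : ∑ i, (starRingEnd ℂ) (v i) * v i = 1) : ∑ x, tpow (rankOne v) t x x = 1 := by
  have : ∑ i, v i * (starRingEnd ℂ) (v i) = 1 := by simpa only [mul_comm] using hv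
  simp only [tpow, rankOne, Matrix.of_apply]
  rw [← Fintype.sum_pow (fun i => v i * (starRingEnd ℂ) (v i)), this, one_pow]

theorem sum_conj_mulVec_mul_mulVec {α : Type*} [Fintype α] [DecidableEq α] (ψ : α → ℂ)
    {U : Matrix α α ℂ} (hU : U ∈ Matrix.unitaryGroup α ℂ) :
    ∑ i, (starRingEnd ℂ) (U.mulVec ψ i) * U.mulVec ψ i = ∑ i, (starRingEnd ℂ) (ψ i) * ψ i := by
  have h : star (U.mulVec ψ) ⬝ᵥ U.mulVec ψ = star ψ ⬝ᵥ ψ := by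
    rw [Matrix.star_mulVec, ← Matrix.dotProduct_mulVec, Matrix.mulVec_mulVec,
      ← Matrix.star_eq_conjTranspose, Matrix.mem_unitaryGroup_iff'.1 hU, Matrix.one_mulVec]
  exact h

/-- The unitary group acts transitively on rays of vectors of a given norm. -/
theorem exists_unitary_mulVec_single {α : Type*} [Fintype α] [DecidableEq α] (i₀ : α)
    (φ : α → ℂ) : ∃ V ∈ Matrix.unitaryGroup α ℂ, ∃ r : ℝ,
      φ = V.mulVec ((r : ℂ) • Pi.single i₀ 1) ∧
      ((r : ℂ) ^ 2) = ∑ i, (starRingEnd ℂ) (φ i) * φ i := by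
  let v : EuclideanSpace ℂ α := WithLp.toLp 2 φ
  have hr : ((‖v‖ : ℂ) ^ 2) = ∑ i, (starRingEnd ℂ) (φ i) * φ i := by
    rw [← Complex.ofReal_pow, EuclideanSpace.norm_sq_eq, Complex.ofReal_sum]
    exact Finset.sum_congr rfl fun i _ => by
      rw [mul_comm, Complex.mul_conj, Complex.normSq_eq_norm_sq]
  by_cases hv : v = 0
  · refine ⟨1, one_mem _, ‖v‖, ?_, hr⟩
    have : φ = 0 := by simpa [v] using hv
    simp [hv, this]
  · have hn : (‖v‖ : ℂ) ≠ 0 := by simpa using hv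
    obtain ⟨b, hb⟩ := Orthonormal.exists_orthonormalBasis_extension_of_card_eq (𝕜 := ℂ)
      (E := EuclideanSpace ℂ α) (ι := α) (by simp) (v := fun _ => (‖v‖ : ℂ)⁻¹ • v) (s := {i₀}) (by
        refine ⟨fun i => ?_, fun i j hij => (hij (Subsingleton.elim i j)).elim⟩
        simp [norm_smul, hv])
    refine ⟨(EuclideanSpace.basisFun α ℂ).toBasis.toMatrix b,
      (EuclideanSpace.basisFun α ℂ).toMatrix_orthonormalBasis_mem_unitary b, ‖v‖, ?_, hr⟩
    ext i
    have hi : φ i = v i := rfl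
    simp [Module.Basis.toMatrix_apply, hb i₀ rfl, Matrix.mulVec_smul, hi, hn]

theorem measurable_matrix_apply {m n : Type*} (i : m) (j : n) :
    Measurable fun U : Matrix m n ℂ => U i j :=
  (measurable_pi_apply j).comp (measurable_pi_apply (X := fun _ : m => n → ℂ) i)

theorem measurable_matrix_mul_left {m : Type*} [Fintype m] (V : Matrix m m ℂ) :
    Measurable fun U : Matrix m m ℂ => V * U := by
  refine measurable_pi_lambda (X := fun _ : m => m → ℂ) _ fun i => measurable_pi_lambda _ fun j => ?_
  simp only [Matrix.mul_apply]
  exact Finset.measurable_sum _ fun k _ => (measurable_matrix_apply k j).const_mul (V i k)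

theorem measurable_matrix_prod_apply {m n ι : Type*} [Fintype ι] (p : ι → m × n) :
    Measurable fun U : Matrix m n ℂ => ∏ i, U (p i).1 (p i).2 :=
  Finset.measurable_prod _ fun i _ => measurable_matrix_apply (p i).1 (p i).2

theorem measurable_monomial {m n ι : Type*} [Fintype ι] (p q : ι → m × n) :
    Measurable fun U : Matrix m n ℂ =>
      (∏ i, U (p i).1 (p i).2) * (starRingEnd ℂ) (∏ i, U (q i).1 (q i).2) :=
  (measurable_matrix_prod_apply p).mul
    (Complex.continuous_conj.measurable.comp (measurable_matrix_prod_apply q))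

theorem integrable_monomial {α ι : Type*} [Fintype α] [DecidableEq α] [Fintype ι]
    (μ : Measure (Matrix α α ℂ)) [IsProbabilityMeasure μ]
    (hsupp : ∀ᵐ U ∂μ, U ∈ Matrix.unitaryGroup α ℂ) (p q : ι → α × α) :
    Integrable (fun U : Matrix α α ℂ =>
      (∏ i, U (p i).1 (p i).2) * (starRingEnd ℂ) (∏ i, U (q i).1 (q i).2)) μ := by
  refine Integrable.of_bound (measurable_monomial p q).aestronglyMeasurable 1 ?_
  filter_upwards [hsupp] with U hU
  have h : ∀ p : ι → α × α, ‖∏ i, U (p i).1 (p i).2‖ ≤ 1 := fun p => by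
    rw [norm_prod]
    exact Finset.prod_le_one (fun _ _ => norm_nonneg _) fun i _ =>
      entry_norm_bound_of_unitary hU _ _
  rw [norm_mul, RCLike.norm_conj]
  exact mul_le_one₀ (h p) (norm_nonneg _) (h q)

theorem measurable_overlapPow {α : Type*} [Fintype α] (t : ℕ) (φ ψ : α → ℂ) :
    Measurable (overlapPow t φ ψ) := by
  rw [funext (overlapPow_eq_sum t φ ψ)]
  exact Finset.measurable_sum _ fun p _ => Finset.measurable_sum _ fun q _ =>
    (measurable_monomial p q).const_mul _

theorem integral_overlapPow_mulVec {α : Type*} [Fintype α] [DecidableEq α]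
    (μ : Measure (Matrix α α ℂ))
    (hleft : ∀ V ∈ Matrix.unitaryGroup α ℂ, Measure.map (fun U => V * U) μ = μ)
    (t : ℕ) (φ ψ : α → ℂ) {V : Matrix α α ℂ} (hV : V ∈ Matrix.unitaryGroup α ℂ) :
    ∫ U, overlapPow t (V.mulVec φ) ψ U ∂μ = ∫ U, overlapPow t φ ψ U ∂μ := by
  have hV' : V.conjTranspose ∈ Matrix.unitaryGroup α ℂ := Unitary.star_mem hV
  conv_rhs => rw [← hleft _ hV']
  rw [integral_map (measurable_matrix_mul_left _).aemeasurable
    (measurable_overlapPow t φ ψ).aestronglyMeasurable]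
  simp only [overlapPow_conjTranspose_mul]

theorem integral_overlapPow {α : Type*} [Fintype α] [DecidableEq α]
    (μ : Measure (Matrix α α ℂ))
    (hleft : ∀ V ∈ Matrix.unitaryGroup α ℂ, Measure.map (fun U => V * U) μ = μ)
    (t : ℕ) (i₀ : α) (φ ψ : α → ℂ) :
    ∫ U, overlapPow t φ ψ U ∂μ = (∫ U, overlapPow t (Pi.single i₀ 1) ψ U ∂μ) *
      (∑ i, (starRingEnd ℂ) (φ i) * φ i) ^ t := by
  obtain ⟨V, hV, r, hφ, hr⟩ := exists_unitary_mulVec_single i₀ φ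
  rw [← hr, hφ, integral_overlapPow_mulVec μ hleft t _ ψ hV]
  simp only [overlapPow_real_smul]
  rw [integral_const_mul, mul_comm]

theorem tpow_comp_left {α : Type*} [Fintype α] {t : ℕ} (v : α → ℂ) (σ : Equiv.Perm (Fin t))
    (x y : Fin t → α) : tpow (rankOne v) t (x ∘ σ) y = tpow (rankOne v) t x y := by
  simp only [tpow, rankOne, Matrix.of_apply, Finset.prod_mul_distrib]
  rw [← Equiv.prod_comp σ fun i => v (x i)]
  rfl

theorem tpow_comp_right {α : Type*} [Fintype α] {t : ℕ} (v : α → ℂ) (σ : Equiv.Perm (Fin t))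
    (x y : Fin t → α) : tpow (rankOne v) t x (y ∘ σ) = tpow (rankOne v) t x y := by
  simp only [tpow, rankOne, Matrix.of_apply, Finset.prod_mul_distrib]
  rw [← Equiv.prod_comp σ fun i => (starRingEnd ℂ) (v (y i))]
  rfl

/-- If a finite subgroup `G` of `U(d)` forms a unitary `t`-design
(with respect to the Haar probability measure `μ` on `U(d)`), then every orbit of unit
vectors of `G` forms a complex projective `t`-design:
`(1/|G|)·Σ_{U∈G} (U|ψ⟩⟨ψ|U^†)^{⊗t} = P_[t]/C(d+t−1, t)` for every unit vector `ψ`. -/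
theorem stmt3 (d t : ℕ) (hd : 1 ≤ d) (ht : 1 ≤ t)
    (μ : Measure (Matrix (Fin d) (Fin d) ℂ)) [IsProbabilityMeasure μ]
    (hsupp : ∀ᵐ U ∂μ, U ∈ Matrix.unitaryGroup (Fin d) ℂ)
    (hleft : ∀ V ∈ Matrix.unitaryGroup (Fin d) ℂ,
      Measure.map (fun U => V * U) μ = μ)
    (hright : ∀ V ∈ Matrix.unitaryGroup (Fin d) ℂ,
      Measure.map (fun U => U * V) μ = μ)
    (G : Subgroup (Matrix.unitaryGroup (Fin d) ℂ)) [Fintype G]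
    (hdesign : ∀ x y x' y' : Fin t → Fin d,
      (Fintype.card G : ℂ)⁻¹ * ∑ U : G,
          ((∏ i, ((U : Matrix.unitaryGroup (Fin d) ℂ) : Matrix (Fin d) (Fin d) ℂ) (x i) (y i)) *
            (starRingEnd ℂ)
              (∏ i, ((U : Matrix.unitaryGroup (Fin d) ℂ) : Matrix (Fin d) (Fin d) ℂ) (x' i) (y' i)))
        = ∫ U, ((∏ i, U (x i) (y i)) *
            (starRingEnd ℂ) (∏ i, U (x' i) (y' i))) ∂μ)
    (ψ : Fin d → ℂ) (hψ : ∑ i, (starRingEnd ℂ) (ψ i) * ψ i = 1) :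
    (Fintype.card G : ℂ)⁻¹ • ∑ U : G,
        tpow (rankOne (Matrix.mulVec
          ((U : Matrix.unitaryGroup (Fin d) ℂ) : Matrix (Fin d) (Fin d) ℂ) ψ)) t
      = (((d + t - 1).choose t : ℂ))⁻¹ • symProj (Fin d) t := by
  have hK : ∀ φ : Fin d → ℂ, (Fintype.card G : ℂ)⁻¹ * ∑ U : G, overlapPow t φ ψ
      ((U : Matrix.unitaryGroup (Fin d) ℂ) : Matrix (Fin d) (Fin d) ℂ) =
      ∫ U, overlapPow t φ ψ U ∂μ := by
    intro φ
    have hint := integrable_monomial (ι := Fin t) μ hsupp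
    simp only [overlapPow_eq_sum]
    rw [integral_finsetSum Finset.univ fun p _ => integrable_finsetSum Finset.univ fun q _ =>
      (hint p q).const_mul _, Finset.sum_comm, Finset.mul_sum]
    refine Finset.sum_congr rfl fun p _ => ?_
    rw [integral_finsetSum Finset.univ fun q _ => (hint p q).const_mul _, Finset.sum_comm,
      Finset.mul_sum]
    refine Finset.sum_congr rfl fun q _ => ?_
    rw [integral_const_mul, ← hdesign (fun i => (p i).1) (fun i => (p i).2)
      (fun i => (q i).1) (fun i => (q i).2), ← Finset.mul_sum]
    ring
  let c : ℂ := ∫ U, overlapPow t (Pi.single (⟨0, hd⟩ : Fin d) 1) ψ U ∂μ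
  let A : Matrix (Fin t → Fin d) (Fin t → Fin d) ℂ := (Fintype.card G : ℂ)⁻¹ • ∑ U : G,
    tpow (rankOne (Matrix.mulVec
      ((U : Matrix.unitaryGroup (Fin d) ℂ) : Matrix (Fin d) (Fin d) ℂ) ψ)) t
  have hAapply : ∀ x y, A x y = (Fintype.card G : ℂ)⁻¹ * ∑ U : G,
      tpow (rankOne (Matrix.mulVec
        ((U : Matrix.unitaryGroup (Fin d) ℂ) : Matrix (Fin d) (Fin d) ℂ) ψ)) t x y := by
    intro x y
    simp [A, Matrix.sum_apply]
  have hform : ∀ φ : Fin d → ℂ, ∑ x, ∑ y,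
      A x y * (∏ i, (starRingEnd ℂ) (φ (x i))) * ∏ i, φ (y i) =
        c * (∑ i, (starRingEnd ℂ) (φ i) * φ i) ^ t := by
    intro φ
    rw [← integral_overlapPow μ hleft t ⟨0, hd⟩ φ ψ, ← hK]
    simp only [← sum_tpow_rankOne_mul_prod, hAapply]
    conv_rhs => rw [Finset.sum_comm, Finset.mul_sum]
    refine Finset.sum_congr rfl fun x _ => ?_
    conv_rhs => rw [Finset.sum_comm, Finset.mul_sum]
    refine Finset.sum_congr rfl fun y _ => ?_
    rw [mul_assoc, mul_assoc, Finset.sum_mul]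
    simp only [mul_assoc]
  have hA : ∀ x y, A x y = c * symProj (Fin d) t x y := by
    intro x y
    refine sub_eq_zero.1 (eq_zero_of_forall_sum_conj_prod_eq_zero
      (fun x y => A x y - c * symProj (Fin d) t x y) ?_ ?_ ?_ x y)
    · intro σ x y
      simp only [hAapply, tpow_comp_left, symProj_comp_left]
    · intro σ x y
      simp only [hAapply, tpow_comp_right, symProj_comp_right]
    · intro φ
      simp only [sub_mul, Finset.sum_sub_distrib]
      rw [hform, ← sum_symProj_mul_prod]
      simp only [Finset.mul_sum, mul_assoc, sub_self]
  have htrace : ∑ x, A x x = 1 := by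
    have h1 : ∀ U : G, ∑ x, tpow (rankOne (Matrix.mulVec
        ((U : Matrix.unitaryGroup (Fin d) ℂ) : Matrix (Fin d) (Fin d) ℂ) ψ)) t x x = 1 :=
      fun U => trace_tpow_rankOne t _ (by rw [sum_conj_mulVec_mul_mulVec ψ U.1.2, hψ])
    simp only [hAapply]
    rw [← Finset.mul_sum, Finset.sum_comm]
    simp [h1]
  have hc : c = (((d + t - 1).choose t : ℂ))⁻¹ := by
    simp only [hA] at htrace
    rw [← Finset.mul_sum, trace_symProj] at htrace
    exact eq_inv_of_mul_eq_one_left htrace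
  ext x y
  rw [← hc]
  exact hA x y

end
end

section
/- Let n ≥ 1 and d = 2^n. The commutant of the diagonal action of the Clifford group on (ℂ^d)^{⊗4}, namely the set of all linear operators B on (ℂ^d)^{⊗4} satisfying B·U^{⊗4} = U^{⊗4}·B for every U in the n-qubit Clifford group C_n, equals the (unital) subalgebra of operators on (ℂ^d)^{⊗4} generated by the permutation operators {U_σ : σ ∈ S_4} together with the stabilizer projector P_{n,4}. -/
open scoped BigOperators

noncomputable section

/-- Single-qubit Pauli matrices labelled by `𝔽₂²`:
`σ_{(0,0)} = I`, `σ_{(0,1)} = X`, `σ_{(1,0)} = Z`, `σ_{(1,1)} = Y`. -/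
def pauli (a : ZMod 2 × ZMod 2) : Matrix (ZMod 2) (ZMod 2) ℂ :=
  Matrix.of fun x y =>
    if a = (0, 0) then (if x = y then 1 else 0)
    else if a = (0, 1) then (if x = y + 1 then 1 else 0)
    else if a = (1, 0) then (if x = y then (if x = 0 then 1 else -1) else 0)
    else (if x = y + 1 then (if x = 0 then -Complex.I else Complex.I) else 0)

/-- The Pauli operator `W_a`, `a ∈ 𝔽₂^{2n}`, on qubits labelled by a finite type `Q`. -/
def PauliW {Q : Type*} [Fintype Q] (a : Q → ZMod 2 × ZMod 2) :
    Matrix (Q → ZMod 2) (Q → ZMod 2) ℂ :=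
  Matrix.of fun x y => ∏ i, pauli (a i) (x i) (y i)

/-- The stabilizer projector `P_{n,k} = 2^{-2n}·Σ_{a∈𝔽₂^{2n}} W_a^{⊗k}`. -/
def stabProj (n k : ℕ) :
    Matrix (Fin k → (Fin n → ZMod 2)) (Fin k → (Fin n → ZMod 2)) ℂ :=
  ((2 : ℂ) ^ (2 * n))⁻¹ • ∑ a : Fin n → ZMod 2 × ZMod 2, tpow (PauliW a) k

/-- A single-qubit gate `G` applied to qubit `i` of `n` qubits (identity elsewhere). -/
def embedGate (n : ℕ) (G : Matrix (ZMod 2) (ZMod 2) ℂ) (i : Fin n) :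
    Matrix (Fin n → ZMod 2) (Fin n → ZMod 2) ℂ :=
  Matrix.of fun x y =>
    G (x i) (y i) * ∏ k ∈ Finset.univ.erase i, (if x k = y k then (1 : ℂ) else 0)

/-- The Hadamard gate `((1+i)/2)·[[1,1],[1,−1]]`. -/
def hGate : Matrix (ZMod 2) (ZMod 2) ℂ :=
  Matrix.of fun x y => (1 + Complex.I) / 2 * (if x = 1 ∧ y = 1 then -1 else 1)

/-- The phase gate `diag(1, −i)`. -/
def sGate : Matrix (ZMod 2) (ZMod 2) ℂ :=
  Matrix.of fun x y => if x = y then (if x = 0 then 1 else -Complex.I) else 0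

/-- The CNOT gate with control qubit `i` and target qubit `j`. -/
def cnotGate (n : ℕ) (i j : Fin n) :
    Matrix (Fin n → ZMod 2) (Fin n → ZMod 2) ℂ :=
  Matrix.of fun x y =>
    if x i = y i ∧ x j = y i + y j ∧ ∀ k, k ≠ i → k ≠ j → x k = y k then 1 else 0

/-- Generators of the `n`-qubit Clifford group: Hadamard and phase gates on each qubit,
CNOT gates on each ordered pair of distinct qubits. -/
def cliffordGens (n : ℕ) : Set (Matrix (Fin n → ZMod 2) (Fin n → ZMod 2) ℂ) :=
  (⋃ i : Fin n, {embedGate n hGate i}) ∪ (⋃ i : Fin n, {embedGate n sGate i}) ∪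
    ⋃ (i : Fin n) (j : Fin n) (_ : i ≠ j), {cnotGate n i j}

/-- The `n`-qubit Clifford group: the subgroup of the unitary group `U(2^n)` generated by
the Hadamard and phase gates on each qubit together with the CNOT gates. -/
def CliffordGroup (n : ℕ) : Subgroup (Matrix.unitaryGroup (Fin n → ZMod 2) ℂ) :=
  Subgroup.closure
    {U : Matrix.unitaryGroup (Fin n → ZMod 2) ℂ |
      (U : Matrix (Fin n → ZMod 2) (Fin n → ZMod 2) ℂ) ∈ cliffordGens n}

theorem LinearMap.exists_equiv_comp_of_range_eq {K E W : Type*} [Field K] [AddCommGroup E]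
    [Module K E] [FiniteDimensional K E] [AddCommGroup W] [Module K W] (φ ψ : E →ₗ[K] W)
    (h : LinearMap.range φ = LinearMap.range ψ) : ∃ e : E ≃ₗ[K] E, ∀ x, φ x = ψ (e x) := by
  obtain ⟨C, hC⟩ := Submodule.exists_isCompl (LinearMap.ker φ)
  obtain ⟨D, hD⟩ := Submodule.exists_isCompl (LinearMap.ker ψ)
  have hker : Module.finrank K (LinearMap.ker φ) = Module.finrank K (LinearMap.ker ψ) := by
    have h1 := φ.finrank_range_add_finrank_ker
    have h2 := ψ.finrank_range_add_finrank_ker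
    rw [h] at h1
    omega
  let e₁ := LinearEquiv.ofFinrankEq _ _ hker
  let e₂ : C ≃ₗ[K] D := (φ.kerComplementEquivRange hC.symm).trans
    ((LinearEquiv.ofEq _ _ h).trans (ψ.kerComplementEquivRange hD.symm).symm)
  refine ⟨(Submodule.prodEquivOfIsCompl _ _ hC).symm.trans
    ((e₁.prodCongr e₂).trans (Submodule.prodEquivOfIsCompl _ _ hD)), fun x => ?_⟩
  obtain ⟨⟨a, b⟩, rfl⟩ := (Submodule.prodEquivOfIsCompl _ _ hC).surjective x
  have hb : ψ (e₂ b) = φ b :=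
    congrArg Subtype.val ((ψ.kerComplementEquivRange hD.symm).apply_symm_apply
      (LinearEquiv.ofEq _ _ h (φ.kerComplementEquivRange hC.symm b)))
  simp [hb]

namespace CliffordCommutant

open Finset Function

/-- Bit vectors indexing the row and column entries of an operator on four copies of one qubit. -/
abbrev RowVec := (Fin 4 → ZMod 2) × (Fin 4 → ZMod 2)

theorem zmod_two_eq_one {c : ZMod 2} (hc : c ≠ 0) : c = 1 := by
  revert c; decide

/-- The additive map `𝔽₂ → ℤ/4` sending `1` to `2`. -/
def dbl : ZMod 2 →+ ZMod 4 where
  toFun a := 2 * (a.val : ZMod 4)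
  map_zero' := by decide
  map_add' := by decide

theorem dbl_eq_zero : ∀ a : ZMod 2, dbl a = 0 ↔ a = 0 := by decide

/-- The Hamming weight modulo `4`. -/
def weight (x : Fin 4 → ZMod 2) : ZMod 4 := ∑ k, ((x k).val : ZMod 4)

theorem weight_add (x y : Fin 4 → ZMod 2) :
    weight (x + y) = weight x + weight y + dbl (x ⬝ᵥ y) := by
  have h : ∀ a b : ZMod 2, ((a + b).val : ZMod 4) = a.val + b.val + dbl (a * b) := by decide
  simp only [weight, dotProduct, map_sum, ← sum_add_distrib, Pi.add_apply, h]

/-- The difference of the Hamming weights modulo `4`. -/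
def qform (v : RowVec) : ZMod 4 := weight v.1 - weight v.2

/-- The standard bilinear form on `𝔽₂⁸`. -/
def bform (u v : RowVec) : ZMod 2 := u.1 ⬝ᵥ v.1 + u.2 ⬝ᵥ v.2

theorem bform_comm (u v : RowVec) : bform u v = bform v u := by
  simp only [bform, dotProduct_comm]

theorem bform_add_left (u v w : RowVec) : bform (u + v) w = bform u w + bform v w := by
  simp only [bform, Prod.fst_add, Prod.snd_add, add_dotProduct]; ring

theorem bform_add_right (u v w : RowVec) : bform u (v + w) = bform u v + bform u w := by
  simp only [bform, Prod.fst_add, Prod.snd_add, dotProduct_add]; ring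

@[simp] theorem bform_zero_left (v : RowVec) : bform 0 v = 0 := by simp [bform]

theorem bform_smul_left (c : ZMod 2) (u v : RowVec) : bform (c • u) v = c * bform u v := by
  simp [bform, mul_add]

theorem qform_add (u v : RowVec) : qform (u + v) = qform u + qform v + dbl (bform u v) := by
  have h : ∀ a : ZMod 2, -dbl a = dbl a := by decide
  simp only [qform, bform, Prod.fst_add, Prod.snd_add, weight_add, map_add]
  linear_combination h (u.2 ⬝ᵥ v.2)

theorem add_self_eq_zero (v : RowVec) : v + v = 0 := by
  have h : ∀ a : ZMod 2, a + a = 0 := by decide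
  ext k <;> exact h _

theorem qform_zero : qform 0 = 0 := by simp [qform]

theorem qform_one : qform 1 = 0 := by simp [qform]

theorem bform_self {v : RowVec} (hv : qform v = 0) : bform v v = 0 := by
  have h := qform_add v v
  rw [add_self_eq_zero, hv, qform_zero] at h
  rw [← dbl_eq_zero, h]
  simp

theorem bform_one_left {v : RowVec} (hv : qform v = 0) : bform 1 v = 0 := by
  have h : ∀ a : ZMod 2, a * a = a := by decide
  rw [← bform_self hv]
  simp [bform, dotProduct, h]

theorem bform_eq_zero_of_qform {u v : RowVec} (hu : qform u = 0) (hv : qform v = 0)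
    (h : qform (u + v) = 0) : bform u v = 0 := by
  rw [qform_add, hu, hv] at h
  rw [← dbl_eq_zero, ← h]
  simp

/-- The nontrivial additive character of `𝔽₂`. -/
def sgn (a : ZMod 2) : ℂ := if a = 0 then 1 else -1

@[simp] theorem sgn_zero : sgn 0 = 1 := by simp [sgn]

theorem sgn_of_ne {a : ZMod 2} (h : a ≠ 0) : sgn a = -1 := by simp [sgn, h]

theorem sgn_add (a b : ZMod 2) : sgn (a + b) = sgn a * sgn b := by
  by_cases ha : a = 0
  · simp [ha]
  by_cases hb : b = 0
  · simp [hb]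
  rw [zmod_two_eq_one ha, zmod_two_eq_one hb, show (1 : ZMod 2) + 1 = 0 by decide]
  simp [sgn]

theorem sgn_sum {ι : Type*} (s : Finset ι) (f : ι → ZMod 2) :
    sgn (∑ k ∈ s, f k) = ∏ k ∈ s, sgn (f k) := by
  classical
  induction s using Finset.induction_on with
  | empty => simp
  | insert a s ha ih => rw [sum_insert ha, prod_insert ha, sgn_add, ih]

open Classical in
theorem sum_sgn_bform (K : Submodule (ZMod 2) RowVec) (s : RowVec) :
    ∑ r : K, sgn (bform r s) = if ∀ r ∈ K, bform r s = 0 then (Nat.card K : ℂ) else 0 := by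
  split_ifs with h
  · rw [sum_congr rfl fun r _ => by rw [h r r.2, sgn_zero]]
    simp
  · push Not at h
    obtain ⟨r₀, hr₀, h₀⟩ := h
    have h1 := Equiv.sum_comp (Equiv.addRight (⟨r₀, hr₀⟩ : K)) fun r : K => sgn (bform r s)
    simp only [Equiv.coe_addRight, Submodule.coe_add, bform_add_left, sgn_add, sgn_of_ne h₀,
      mul_neg, mul_one, sum_neg_distrib] at h1
    linear_combination (-1 / 2 : ℂ) * h1

/-- A subspace on which the quadratic form vanishes. -/
def Isotropic (K : Submodule (ZMod 2) RowVec) : Prop := ∀ v ∈ K, qform v = 0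

theorem Isotropic.bform {K : Submodule (ZMod 2) RowVec} (hK : Isotropic K) {u v : RowVec}
    (hu : u ∈ K) (hv : v ∈ K) : bform u v = 0 :=
  bform_eq_zero_of_qform (hK u hu) (hK v hv) (hK _ (K.add_mem hu hv))

theorem isotropic_span {G : Set RowVec} (hq : ∀ v ∈ G, qform v = 0)
    (hb : ∀ u ∈ G, ∀ v ∈ G, bform u v = 0) : Isotropic (Submodule.span (ZMod 2) G) := by
  have h1 : ∀ v ∈ G, ∀ u ∈ Submodule.span (ZMod 2) G, bform u v = 0 := fun v hv u hu => by
    induction hu using Submodule.span_induction with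
    | mem x hx => exact hb x hx v hv
    | zero => simp
    | add x y _ _ hx hy => rw [bform_add_left, hx, hy, add_zero]
    | smul c x _ hx => rw [bform_smul_left, hx, mul_zero]
  have h2 : ∀ u ∈ Submodule.span (ZMod 2) G, ∀ v ∈ Submodule.span (ZMod 2) G,
      bform v u = 0 := fun u hu v hv => by
    induction hv using Submodule.span_induction with
    | mem x hx => rw [bform_comm]; exact h1 x hx u hu
    | zero => simp
    | add x y _ _ hx hy => rw [bform_add_left, hx, hy, add_zero]
    | smul c x _ hx => rw [bform_smul_left, hx, mul_zero]
  intro v hv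
  induction hv using Submodule.span_induction with
  | mem x hx => exact hq x hx
  | zero => exact qform_zero
  | add x y hx hy hx' hy' => rw [qform_add, hx', hy', h2 y hy x hx]; simp
  | smul c x _ hx =>
    by_cases hc : c = 0
    · rw [hc, zero_smul, qform_zero]
    · rw [zmod_two_eq_one hc, one_smul, hx]

/-- The symmetries of the coefficient function of an operator commuting with the phase,
CNOT and Hadamard gates. -/
structure IsInvariant {n : ℕ} (f : (Fin n → RowVec) → ℂ) : Prop where
  qform_eq_zero : ∀ M i, f M ≠ 0 → qform (M i) = 0
  add_row : ∀ M i j, i ≠ j → f (update M j (M j + M i)) = f M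
  fourier : ∀ M i r, ∑ s, sgn (bform r s) * f (update M i s) = 16 * f (update M i r)

namespace IsInvariant

variable {n : ℕ} {f : (Fin n → RowVec) → ℂ}

theorem add_one (hf : IsInvariant f) (M : Fin n → RowVec) (i : Fin n) :
    f (update M i (M i + 1)) = f M := by
  have h : (16 : ℂ) * f (update M i (M i + 1)) = 16 * f (update M i (M i)) := by
    rw [← hf.fourier, ← hf.fourier]
    refine sum_congr rfl fun s _ => ?_
    by_cases hs : f (update M i s) = 0
    · simp [hs]
    · have := hf.qform_eq_zero _ i hs
      rw [update_self] at this
      rw [bform_add_left, bform_one_left this, add_zero]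
  simpa using h

theorem add_ones (hf : IsInvariant f) (M N : Fin n → RowVec)
    (h : ∀ i, N i = M i ∨ N i = M i + 1) : f N = f M := by
  classical
  have key : ∀ s : Finset (Fin n), f (s.piecewise N M) = f M := fun s => by
    induction s using Finset.induction_on with
    | empty => simp
    | insert a s ha ih =>
      rw [piecewise_insert, ← ih]
      have hM : s.piecewise N M a = M a := piecewise_eq_of_notMem _ _ _ ha
      rcases h a with h | h
      · rw [h, ← hM, update_eq_self]
      · rw [h, ← hM, hf.add_one]
  simpa using key univ

theorem linear_comp (hf : IsInvariant f) (A : Matrix (Fin n) (Fin n) (ZMod 2)) (hA : A.det ≠ 0) :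
    ∀ M, f (fun i => ∑ j, A i j • M j) = f M := by
  refine Matrix.diagonal_transvection_induction_of_det_ne_zero
    (fun A => ∀ M, f (fun i => ∑ j, A i j • M j) = f M) A hA ?_ ?_ ?_
  · intro D hD M
    have hD' : ∀ i, D i = 1 := fun i => zmod_two_eq_one fun h => hD (by
      rw [Matrix.det_diagonal]; exact prod_eq_zero (mem_univ i) h)
    simp [Matrix.diagonal_apply, hD', ite_smul]
  · rintro ⟨i, j, hij, c⟩ M
    by_cases hc : c = 0
    · simp [Matrix.TransvectionStruct.toMatrix, Matrix.transvection, hc, Matrix.one_apply, ite_smul]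
    · rw [← hf.add_row M j i hij.symm]
      congr 1
      ext1 k
      simp only [Matrix.TransvectionStruct.toMatrix, Matrix.transvection, Matrix.add_apply,
        Matrix.one_apply, Matrix.single_apply, add_smul, sum_add_distrib, ite_smul, one_smul,
        zero_smul, sum_ite_eq, mem_univ, if_true, zmod_two_eq_one hc]
      by_cases hk : k = i
      · subst hk
        simp
      · simp [hk, Ne.symm hk]
  · intro A B _ _ hA hB M
    rw [← hB M, ← hA fun i => ∑ j, B i j • M j]
    congr 1
    ext1 i
    simp only [Matrix.mul_apply, sum_smul, smul_sum, mul_smul]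
    rw [sum_comm]

theorem equiv_comp (hf : IsInvariant f) (e : (Fin n → ZMod 2) ≃ₗ[ZMod 2] (Fin n → ZMod 2))
    (M : Fin n → RowVec) : f (fun i => ∑ j, e (Pi.single i 1) j • M j) = f M := by
  have h : IsUnit (LinearMap.toMatrix' (e : (Fin n → ZMod 2) →ₗ[ZMod 2] _)).det := by
    rw [LinearMap.det_toMatrix']
    exact e.isUnit_det'
  have := hf.linear_comp (LinearMap.toMatrix' (e : (Fin n → ZMod 2) →ₗ[ZMod 2] _)).transpose
    (by rw [Matrix.det_transpose]; exact h.ne_zero) M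
  simpa [LinearMap.toMatrix'_apply] using this

theorem equiv_comp_pi (hf : IsInvariant f)
    (e : (Fin n → ZMod 2) ≃ₗ[ZMod 2] (Fin n → ZMod 2)) (M : Fin n → RowVec) :
    f (fun i => Fintype.linearCombination (ZMod 2) M (e (Pi.single i 1))) = f M := by
  simpa only [Fintype.linearCombination_apply] using hf.equiv_comp e M

theorem eq_of_span_eq (hf : IsInvariant f) {M N : Fin n → RowVec}
    (h : Submodule.span (ZMod 2) (insert 1 (Set.range M))
      = Submodule.span (ZMod 2) (insert 1 (Set.range N))) : f M = f N := by
  let S := Submodule.span (ZMod 2) {(1 : RowVec)}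
  have hrange : ∀ L : Fin n → RowVec,
      LinearMap.range (S.mkQ ∘ₗ Fintype.linearCombination (ZMod 2) L)
        = (Submodule.span (ZMod 2) (insert 1 (Set.range L))).map S.mkQ := fun L => by
    rw [LinearMap.range_comp, Fintype.range_linearCombination, Submodule.span_insert,
      Submodule.map_sup, Submodule.mkQ_map_self, bot_sup_eq]
  obtain ⟨e, he⟩ := LinearMap.exists_equiv_comp_of_range_eq
    (S.mkQ ∘ₗ Fintype.linearCombination (ZMod 2) M)
    (S.mkQ ∘ₗ Fintype.linearCombination (ZMod 2) N) (by rw [hrange, hrange, h])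
  rw [← hf.equiv_comp_pi e N]
  refine hf.add_ones _ _ fun i => ?_
  have hi := he (Pi.single i 1)
  simp only [LinearMap.comp_apply, Submodule.mkQ_apply, Fintype.linearCombination_apply_single,
    one_smul] at hi
  obtain ⟨c, hc⟩ := Submodule.mem_span_singleton.mp ((Submodule.Quotient.eq S).mp hi)
  rw [eq_sub_iff_add_eq'] at hc
  by_cases hc0 : c = 0
  · left; rw [← hc, hc0, zero_smul, add_zero]
  · right; rw [← hc, zmod_two_eq_one hc0, one_smul]

open scoped Classical in
/-- The sum of `f` over a translate of the matrices with all rows in `K`. -/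
def shiftedSum (f : (Fin n → RowVec) → ℂ) (K : Submodule (ZMod 2) RowVec) (a : Fin n → ZMod 2)
    (s : RowVec) : ℂ :=
  ∑ M : Fin n → K, f fun i => M i + a i • s

open scoped Classical in
theorem shiftedSum_of_mem {K : Submodule (ZMod 2) RowVec} (a : Fin n → ZMod 2) {s : RowVec}
    (hs : s ∈ K) : shiftedSum f K a s = shiftedSum f K 0 0 := by
  have := Equiv.sum_comp (Equiv.addRight fun i => a i • (⟨s, hs⟩ : K))
    fun M : Fin n → K => f fun i => M i
  simpa [shiftedSum] using this

open scoped Classical in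
theorem shiftedSum_zero_left {K : Submodule (ZMod 2) RowVec} (s : RowVec) :
    shiftedSum f K 0 s = shiftedSum f K 0 0 := by
  simp [shiftedSum]

open scoped Classical in
theorem shiftedSum_comp_equiv (hf : IsInvariant f) (K : Submodule (ZMod 2) RowVec)
    (e : (Fin n → ZMod 2) ≃ₗ[ZMod 2] (Fin n → ZMod 2)) (a b : Fin n → ZMod 2)
    (h : ∀ i, ∑ j, e (Pi.single i 1) j * a j = b i) (s : RowVec) :
    shiftedSum f K b s = shiftedSum f K a s := by
  let T : (Fin n → K) → (Fin n → K) := fun M i => ∑ j, e (Pi.single i 1) j • M j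
  let A := LinearMap.toMatrix' e.toLinearMap
  let B := LinearMap.toMatrix' e.symm.toLinearMap
  have hBA : A * B = 1 := by
    rw [← LinearMap.toMatrix'_comp]; simp
  have hT : Injective T := by
    refine LeftInverse.injective (g := fun M i => ∑ j, e.symm (Pi.single i 1) j • M j) fun M => ?_
    ext1 i
    have hentry : ∀ k, ∑ j, e.symm (Pi.single i 1) j * e (Pi.single j 1) k
        = (1 : Matrix (Fin n) (Fin n) (ZMod 2)) k i := fun k => by
      rw [← hBA, Matrix.mul_apply]
      exact sum_congr rfl fun j _ => by simp [A, B, LinearMap.toMatrix'_apply, mul_comm]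
    simp only [T, smul_sum, smul_smul]
    rw [sum_comm]
    simp only [← sum_smul, hentry, Matrix.one_apply, ite_smul, one_smul, zero_smul, sum_ite_eq',
      mem_univ, if_true]
  rw [shiftedSum, ← Equiv.sum_comp (Equiv.ofBijective T (Finite.injective_iff_bijective.mp hT))]
  refine sum_congr rfl fun M _ => ?_
  rw [← hf.equiv_comp e fun i => (M i : RowVec) + a i • s]
  congr 1
  ext1 i
  simp only [Equiv.ofBijective_apply, T, smul_add, sum_add_distrib, smul_smul, ← sum_smul, h]
  simp

theorem shiftedSum_eq_of_ne_zero (hf : IsInvariant f) (K : Submodule (ZMod 2) RowVec)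
    {a b : Fin n → ZMod 2} (ha : a ≠ 0) (hb : b ≠ 0) (s : RowVec) :
    shiftedSum f K b s = shiftedSum f K a s := by
  have hr : ∀ c : Fin n → ZMod 2, c ≠ 0 →
      LinearMap.range (Fintype.linearCombination (ZMod 2) c) = ⊤ := fun c hc => by
    rw [LinearMap.range_eq_top]
    obtain ⟨i, hi⟩ := ne_iff.mp hc
    intro x
    refine ⟨Pi.single i x, ?_⟩
    rw [Fintype.linearCombination_apply_single, zmod_two_eq_one hi, smul_eq_mul, mul_one]
  obtain ⟨e, he⟩ := LinearMap.exists_equiv_comp_of_range_eq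
    (Fintype.linearCombination (ZMod 2) b) (Fintype.linearCombination (ZMod 2) a)
    ((hr b hb).trans (hr a ha).symm)
  refine hf.shiftedSum_comp_equiv K e a b (fun i => ?_) s
  have := he (Pi.single i 1)
  rw [Fintype.linearCombination_apply_single, one_smul, Fintype.linearCombination_apply] at this
  exact this.symm

open scoped Classical in
theorem sum_shiftedSum {K : Submodule (ZMod 2) RowVec} {s : RowVec} (hs : s ∉ K) :
    ∑ a, shiftedSum f K a s = shiftedSum f (K ⊔ Submodule.span (ZMod 2) {s}) 0 0 := by
  let K' := K ⊔ Submodule.span (ZMod 2) {s}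
  have hsK' : s ∈ K' := Submodule.mem_sup_right (Submodule.mem_span_singleton_self s)
  let g : K × ZMod 2 → K' := fun p =>
    ⟨p.1 + p.2 • s, K'.add_mem (Submodule.mem_sup_left p.1.2) (K'.smul_mem _ hsK')⟩
  have hg : Bijective g := by
    constructor
    · rintro ⟨r, c⟩ ⟨r', c'⟩ h
      have h' : (r : RowVec) + c • s = r' + c' • s := congrArg Subtype.val h
      have hc : c = c' := by
        by_contra hne
        refine hs ?_
        have h1 : c - c' = 1 := zmod_two_eq_one (sub_ne_zero.mpr hne)
        have h2 : s = r' - r := by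
          rw [← one_smul (ZMod 2) s, ← h1, sub_smul, sub_eq_sub_iff_add_eq_add, add_comm, h',
            add_comm]
        rw [h2]
        exact K.sub_mem r'.2 r.2
      subst hc
      simpa using h'
    · rintro ⟨x, hx⟩
      obtain ⟨y, hy, z, hz, rfl⟩ := Submodule.mem_sup.mp hx
      obtain ⟨c, rfl⟩ := Submodule.mem_span_singleton.mp hz
      exact ⟨(⟨y, hy⟩, c), rfl⟩
  let E : (Fin n → ZMod 2) × (Fin n → K) ≃ (Fin n → K') :=
    ((Equiv.prodComm _ _).trans (Equiv.arrowProdEquivProdArrow (Fin n) (fun _ => K)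
      (fun _ => ZMod 2)).symm).trans (Equiv.arrowCongr (Equiv.refl _) (Equiv.ofBijective g hg))
  simp only [shiftedSum]
  rw [← Fintype.sum_prod_type', ← Equiv.sum_comp E]
  simp [E, g]

open scoped Classical in
theorem poisson (hf : IsInvariant f) {K : Submodule (ZMod 2) RowVec} (hK : Isotropic K)
    (i : Fin n) : 16 * shiftedSum f K 0 0
      = ∑ s with ∀ r ∈ K, bform r s = 0, shiftedSum f K (Pi.single i 1) s := by
  have hupd : ∀ (M : Fin n → RowVec) (s : RowVec),
      update M i (s + M i) = fun j => M j + (Pi.single i 1 : Fin n → ZMod 2) j • s := fun M s => by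
    ext1 j
    by_cases hj : j = i
    · subst hj; simp [add_comm]
    · simp [hj]
  let G : RowVec → ℂ := fun s => ∑ M : Fin n → K, sgn (bform (M i) s) *
    f fun j => M j + (Pi.single i 1 : Fin n → ZMod 2) j • s
  have h16 : 16 * shiftedSum f K 0 0 = ∑ s, G s := by
    simp only [G]
    rw [sum_comm, shiftedSum, mul_sum]
    refine sum_congr rfl fun M _ => ?_
    have h := hf.fourier (fun j => (M j : RowVec)) i (M i)
    rw [← Equiv.sum_comp (Equiv.addRight (M i : RowVec)), update_eq_self i fun j => (M j : RowVec)] at h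
    simp only [Pi.zero_apply, zero_smul, add_zero]
    rw [← h]
    refine sum_congr rfl fun s _ => ?_
    rw [Equiv.coe_addRight, bform_add_right, bform_self (hK _ (M i).2), add_zero, hupd]
  have hG : ∀ (r : K) (s : RowVec), G (s + r) = sgn (bform r s) * G s := fun r s => by
    simp only [G]
    rw [← Equiv.sum_comp (Equiv.addRight (Pi.single i r : Fin n → K)), mul_sum]
    refine sum_congr rfl fun M _ => ?_
    have h1 : ∀ j, ((M j + (Pi.single i r : Fin n → K) j : K) : RowVec)
        + (Pi.single i 1 : Fin n → ZMod 2) j • (s + (r : RowVec))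
          = M j + (Pi.single i 1 : Fin n → ZMod 2) j • s := fun j => by
      by_cases hj : j = i
      · subst hj
        simp only [Pi.single_eq_same, Submodule.coe_add, one_smul]
        rw [add_comm s, add_assoc, ← add_assoc (r : RowVec), add_self_eq_zero, zero_add]
      · simp [hj]
    have h2 : sgn (bform ((M i + (Pi.single i r : Fin n → K) i : K) : RowVec) (s + r))
        = sgn (bform r s) * sgn (bform (M i) s) := by
      rw [Pi.single_eq_same, Submodule.coe_add, bform_add_left, bform_add_right, bform_add_right,
        hK.bform (M i).2 r.2, hK.bform r.2 r.2, add_zero, add_zero, add_comm, sgn_add]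
    exact (congrArg₂ (· * ·) h2 (congrArg f (funext h1))).trans (mul_assoc _ _ _)
  have hsum : ∀ r : K, ∑ s, G s = ∑ s, sgn (bform r s) * G s := fun r => by
    rw [← Equiv.sum_comp (Equiv.addRight (r : RowVec))]
    exact sum_congr rfl fun s _ => hG r s
  have hcard : (Nat.card K : ℂ) ≠ 0 := Nat.cast_ne_zero.mpr Nat.card_pos.ne'
  have htot : (Nat.card K : ℂ) * ∑ s, G s
      = Nat.card K * ∑ s with ∀ r ∈ K, bform r s = 0, G s := by
    calc (Nat.card K : ℂ) * ∑ s, G s = ∑ _r : K, ∑ s, G s := by simp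
      _ = ∑ r : K, ∑ s, sgn (bform r s) * G s := sum_congr rfl fun r _ => hsum r
      _ = ∑ s, (∑ r : K, sgn (bform r s)) * G s := by
        rw [sum_comm]; simp only [sum_mul]
      _ = _ := by
        simp only [sum_sgn_bform, ite_mul, zero_mul]
        rw [← sum_filter, mul_sum]
  rw [h16, mul_left_cancel₀ hcard htot]
  refine sum_congr rfl fun s hs => sum_congr rfl fun M _ => ?_
  rw [(mem_filter.mp hs).2 _ (M i).2, sgn_zero, one_mul]

open scoped Classical in
theorem shiftedSum_eq_zero_of_card_lt (hf : IsInvariant f) (i : Fin n)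
    {K : Submodule (ZMod 2) RowVec} (hK : Isotropic K) (hcard : Nat.card K < 16)
    (hlt : ∀ K', K < K' → Isotropic K' → shiftedSum f K' 0 0 = 0) : shiftedSum f K 0 0 = 0 := by
  have h1 : (Pi.single i 1 : Fin n → ZMod 2) ≠ 0 := by simp
  have hcoef : ∀ s : RowVec, ∃ c : ℝ, c ≤ (if s ∈ K then 1 else 0) ∧
      ((∀ r ∈ K, bform r s = 0) →
        shiftedSum f K (Pi.single i 1) s = c * shiftedSum f K 0 0) := fun s => by
    by_cases hs : s ∈ K
    · exact ⟨1, by simp [hs], fun _ => by simp [shiftedSum_of_mem _ hs]⟩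
    simp only [if_neg hs]
    by_cases hq : qform s = 0
    · refine ⟨-((2 : ℝ) ^ n - 1)⁻¹, ?_, fun hp => ?_⟩
      · have : (1 : ℝ) ≤ 2 ^ n := one_le_pow₀ (by norm_num)
        simpa using this
      · have hiso : Isotropic (K ⊔ Submodule.span (ZMod 2) {s}) := by
          rw [← Submodule.span_eq K, ← Submodule.span_union]
          refine isotropic_span ?_ ?_
          · rintro v (hv | rfl)
            exacts [hK v hv, hq]
          · rintro u (hu | rfl) v (hv | rfl)
            exacts [hK.bform hu hv, hp u hu, (bform_comm _ _).trans (hp v hv), bform_self hq]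
        have hK' := hlt _ (left_lt_sup.mpr fun h => hs
          (h (Submodule.mem_span_singleton_self s))) hiso
        rw [← sum_shiftedSum hs, ← add_sum_erase _ _ (mem_univ 0), shiftedSum_zero_left,
          sum_congr rfl fun a ha => hf.shiftedSum_eq_of_ne_zero K h1 (ne_of_mem_erase ha) s,
          sum_const, card_erase_of_mem (mem_univ _), card_univ, Fintype.card_fun, ZMod.card,
          Fintype.card_fin, nsmul_eq_mul, Nat.cast_sub Nat.one_le_two_pow] at hK'
        have hne : (2 : ℂ) ^ n - 1 ≠ 0 := by
          have : NeZero n := ⟨fun h => (h ▸ i).elim0⟩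
          have : (2 : ℝ) ^ n - 1 ≠ 0 :=
            (sub_pos.mpr (one_lt_pow₀ (by norm_num) (NeZero.ne n))).ne'
          exact_mod_cast this
        push_cast at hK' ⊢
        field_simp
        linear_combination hK'
    · refine ⟨0, le_rfl, fun hp => ?_⟩
      rw [Complex.ofReal_zero, zero_mul]
      refine sum_eq_zero fun M _ => by_contra fun h => hq ?_
      have := hf.qform_eq_zero _ i h
      rwa [Pi.single_eq_same, one_smul, qform_add, hK _ (M i).2, hp _ (M i).2, map_zero,
        zero_add, add_zero] at this
  choose c hc hcs using hcoef
  have hp := hf.poisson hK i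
  rw [sum_congr rfl fun s hs => hcs s (mem_filter.mp hs).2, ← sum_mul] at hp
  have hle : ∑ s with ∀ r ∈ K, bform r s = 0, c s < 16 := by
    calc ∑ s with ∀ r ∈ K, bform r s = 0, c s
        ≤ ∑ s with ∀ r ∈ K, bform r s = 0, (if s ∈ K then (1 : ℝ) else 0) :=
          sum_le_sum fun s _ => hc s
      _ ≤ ∑ s, (if s ∈ K then (1 : ℝ) else 0) :=
          sum_le_sum_of_subset_of_nonneg (filter_subset _ _) fun s _ _ => by split_ifs <;> simp
      _ = Nat.card K := by
          rw [sum_boole, Nat.card_eq_fintype_card, Fintype.card_subtype]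
      _ < 16 := by exact_mod_cast hcard
  have hne : (16 : ℂ) - ∑ s with ∀ r ∈ K, bform r s = 0, (c s : ℂ) ≠ 0 := by
    have := (sub_pos.mpr hle).ne'
    exact_mod_cast this
  exact (mul_eq_zero.mp (by linear_combination hp :
    ((16 : ℂ) - ∑ s with ∀ r ∈ K, bform r s = 0, (c s : ℂ)) * shiftedSum f K 0 0 = 0)).resolve_left
      hne

theorem shiftedSum_eq_zero (hf : IsInvariant f) (i : Fin n)
    (hmax : ∀ K : Submodule (ZMod 2) RowVec, 1 ∈ K → Isotropic K → 16 ≤ Nat.card K →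
      shiftedSum f K 0 0 = 0)
    (K : Submodule (ZMod 2) RowVec) (h1 : 1 ∈ K) (hK : Isotropic K) : shiftedSum f K 0 0 = 0 := by
  induction K using WellFoundedGT.induction with
  | ind K ih =>
    rcases lt_or_ge (Nat.card K) 16 with h | h
    · exact hf.shiftedSum_eq_zero_of_card_lt i hK h fun K' hlt hK' => ih K' hlt (hlt.le h1) hK'
    · exact hmax K h1 hK h

theorem isotropic_span_rows (hf : IsInvariant f) {M : Fin n → RowVec} (hM : f M ≠ 0) :
    Isotropic (Submodule.span (ZMod 2) (insert 1 (Set.range M))) := by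
  have hq := fun i => hf.qform_eq_zero M i hM
  refine isotropic_span ?_ ?_
  · rintro v (rfl | ⟨i, rfl⟩)
    exacts [qform_one, hq i]
  · rintro u (rfl | ⟨i, rfl⟩) v (rfl | ⟨j, rfl⟩)
    · exact bform_self qform_one
    · exact bform_one_left (hq j)
    · exact (bform_comm _ _).trans (bform_one_left (hq i))
    · by_cases hij : j = i
      · rw [hij]; exact bform_self (hq i)
      · refine bform_eq_zero_of_qform (hq i) (hq j) ?_
        rw [← hf.add_row M j i hij] at hM
        simpa using hf.qform_eq_zero _ i hM

open scoped Classical in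
theorem eq_zero (hf : IsInvariant f) (i : Fin n)
    (hmax : ∀ K : Submodule (ZMod 2) RowVec, 1 ∈ K → Isotropic K → 16 ≤ Nat.card K →
      shiftedSum f K 0 0 = 0) (M : Fin n → RowVec) : f M = 0 := by
  generalize hKM : Submodule.span (ZMod 2) (insert 1 (Set.range M)) = K
  induction K using WellFoundedLT.induction generalizing M with
  | ind K ih =>
    by_contra hM
    have hiso := hKM ▸ hf.isotropic_span_rows hM
    have h1 : 1 ∈ K := hKM ▸ Submodule.subset_span (Set.mem_insert _ _)
    have h0 := hf.shiftedSum_eq_zero i hmax K h1 hiso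
    have hterm : ∀ N : Fin n → K, (f fun j => N j)
        = if Submodule.span (ZMod 2) (insert 1 (Set.range fun j => (N j : RowVec))) = K
          then f M else 0 := fun N => by
      split_ifs with h
      · exact hf.eq_of_span_eq (h.trans hKM.symm)
      · refine ih _ (lt_of_le_of_ne (Submodule.span_le.mpr ?_) h) _ rfl
        rintro v (rfl | ⟨j, rfl⟩)
        exacts [h1, (N j).2]
    simp only [shiftedSum, Pi.zero_apply, zero_smul, add_zero] at h0
    rw [sum_congr rfl fun N _ => hterm N, ← sum_filter, sum_const, nsmul_eq_mul, mul_eq_zero,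
      or_iff_left hM, Nat.cast_eq_zero, card_eq_zero] at h0
    have hmem : ∀ j, M j ∈ K := fun j =>
      hKM ▸ Submodule.subset_span (Set.mem_insert_of_mem _ ⟨j, rfl⟩)
    exact notMem_empty (fun j => (⟨M j, hmem j⟩ : K)) (h0 ▸ mem_filter.mpr ⟨mem_univ _, hKM⟩)

end IsInvariant

theorem weight_eq_zero_iff : ∀ y : Fin 4 → ZMod 2, weight y = 0 ↔ y = 0 ∨ y = 1 := by decide

theorem eq_single_of_weight_eq_one :
    ∀ y : Fin 4 → ZMod 2, weight y = 1 → ∃ j, y = Pi.single j 1 := by decide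

theorem weight_single : ∀ k : Fin 4, weight (Pi.single k 1) = 1 := by decide

theorem weight_single_add_single : ∀ k l : Fin 4,
    weight (Pi.single k 1 + Pi.single l 1) = 0 → k = l := by decide

theorem exists_perm_of_weight_eq_two : ∀ y z : Fin 4 → ZMod 2,
    weight y = 2 → weight z = 2 → weight (y + z) = 2 → ∃ σ : Equiv.Perm (Fin 4),
      ((![1, 1, 0, 0] : Fin 4 → ZMod 2) ∘ σ = y ∨ (![1, 1, 0, 0] : Fin 4 → ZMod 2) ∘ σ = y + 1) ∧
      ((![1, 0, 1, 0] : Fin 4 → ZMod 2) ∘ σ = z ∨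
        (![1, 0, 1, 0] : Fin 4 → ZMod 2) ∘ σ = z + 1) := by
  decide +kernel

theorem even_eq_combination : ∀ x : Fin 4 → ZMod 2, ∑ k, x k = 0 → ∃ a b c : ZMod 2,
    x = a • (![1, 1, 0, 0] : Fin 4 → ZMod 2) + b • (![1, 0, 1, 0] : Fin 4 → ZMod 2) + c • 1 := by
  decide +kernel

theorem card_even : Fintype.card {x : Fin 4 → ZMod 2 // ∑ k, x k = 0} = 8 := by decide

/-- The defect subspace whose indicator is proportional to the stabilizer projector. -/
def stabSpace : Submodule (ZMod 2) RowVec where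
  carrier := {v | ∑ k, v.1 k = 0 ∧ ∃ c : ZMod 2, v.2 = v.1 + c • 1}
  zero_mem' := by simpa using ⟨0, by simp⟩
  add_mem' := by
    rintro u v ⟨hu, c, hc⟩ ⟨hv, d, hd⟩
    refine ⟨by simp [sum_add_distrib, hu, hv], c + d, ?_⟩
    rw [Prod.snd_add, Prod.fst_add, hc, hd, add_smul]
    abel
  smul_mem' := by
    rintro a v ⟨hv, c, hc⟩
    refine ⟨by simp [← mul_sum, hv], a * c, ?_⟩
    rw [Prod.smul_snd, Prod.smul_fst, hc, smul_add, smul_smul]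

theorem mem_stabSpace {v : RowVec} :
    v ∈ stabSpace ↔ ∑ k, v.1 k = 0 ∧ ∃ c : ZMod 2, v.2 = v.1 + c • 1 := Iff.rfl

theorem card_stabSpace : Nat.card stabSpace = 16 := by
  have h : Bijective fun p : {x : Fin 4 → ZMod 2 // ∑ k, x k = 0} × ZMod 2 =>
      (⟨(p.1, p.1 + p.2 • 1), p.1.2, p.2, rfl⟩ : stabSpace) := by
    constructor
    · rintro ⟨⟨x, hx⟩, c⟩ ⟨⟨y, hy⟩, d⟩ h
      obtain ⟨rfl, h2⟩ := Prod.mk.inj (congrArg Subtype.val h)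
      have := congrFun h2 0
      simpa using this
    · rintro ⟨⟨x, y⟩, hx, c, hc⟩
      obtain rfl : y = x + c • 1 := hc
      exact ⟨(⟨x, hx⟩, c), rfl⟩
  rw [← Nat.card_congr (Equiv.ofBijective _ h), Nat.card_eq_fintype_card, Fintype.card_prod,
    card_even, ZMod.card]

theorem isotropic_stabSpace : Isotropic stabSpace := by
  rintro ⟨x, y⟩ ⟨hx, c, hc⟩
  obtain rfl : y = x + c • 1 := hc
  by_cases hc : c = 0
  · simp [hc, qform]
  · rw [zmod_two_eq_one hc, one_smul]
    simp only [qform, weight_add, dotProduct_one] at hx ⊢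
    rw [hx, (weight_eq_zero_iff 1).mpr (Or.inr rfl)]
    simp

theorem bform_single_left (k l : Fin 4) (v : RowVec) :
    bform (Pi.single k 1, Pi.single l 1) v = v.1 k + v.2 l := by
  simp [bform]

theorem eq_of_add_eq_zero {a b : ZMod 2} (h : a + b = 0) : a = b := by
  revert a b; decide

theorem mem_stabSpace_of_orthogonal {v : RowVec} (h : ∀ u ∈ stabSpace, bform u v = 0) :
    v ∈ stabSpace := by
  refine ⟨by simpa [bform, one_dotProduct] using h (1, 0) ⟨by decide, 1, by decide⟩, v.1 0 + v.2 0, ?_⟩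
  ext k
  have := h (Pi.single 0 1 + Pi.single k 1, Pi.single 0 1 + Pi.single k 1)
    ⟨by simp [sum_add_distrib]; decide, 0, by simp⟩
  rw [← Prod.mk_add_mk, bform_add_left, bform_single_left, bform_single_left] at this
  have h2 : ∀ a b c d : ZMod 2, a + b + (c + d) = 0 → d = c + (a + b) := by decide
  simpa using h2 _ _ _ _ this

theorem exists_graph_le {K : Submodule (ZMod 2) RowVec} (hK : Isotropic K)
    (hcard : 16 ≤ Nat.card K) (h : ((0, 1) : RowVec) ∉ K) :
    ∃ σ : Equiv.Perm (Fin 4), ∀ x : Fin 4 → ZMod 2, ((x, x ∘ σ) : RowVec) ∈ K := by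
  have hinj : Injective fun v : K => v.1.1 := fun u v huv => by
    have huv1 : u.1.1 = v.1.1 := huv
    have h1 := K.sub_mem u.2 v.2
    have h2 : (u : RowVec) - (v : RowVec) = (0, u.1.2 - v.1.2) :=
      Prod.ext (sub_eq_zero.mpr huv1) rfl
    rw [h2] at h1
    have hw := hK _ h1
    have h3 : u.1.2 - v.1.2 = 0 := by
      refine ((weight_eq_zero_iff _).mp ?_).resolve_right fun h4 => h (h4 ▸ h1)
      simpa [qform, weight] using hw
    exact Subtype.ext (Prod.ext huv1 (sub_eq_zero.mp h3))
  have hsurj := (hinj.bijective_of_nat_card_le (by simpa using hcard)).surjective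
  have hrow : ∀ k : Fin 4, ∃ j : Fin 4, ((Pi.single k 1, Pi.single j 1) : RowVec) ∈ K := fun k => by
    obtain ⟨⟨⟨x, y⟩, hxy⟩, rfl : x = _⟩ := hsurj (Pi.single k 1)
    have hk := weight_single k
    have hq : weight (Pi.single k 1) - weight y = 0 := hK _ hxy
    obtain ⟨j, rfl⟩ := eq_single_of_weight_eq_one y (by rw [← hk]; exact (sub_eq_zero.mp hq).symm)
    exact ⟨j, hxy⟩
  choose τ hτ using hrow
  have hτinj : Injective τ := fun k l hkl => by
    refine weight_single_add_single k l ?_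
    have := hK _ (K.sub_mem (hτ k) (hτ l))
    have h2 : ∀ a b : Fin 4 → ZMod 2, a - b = a + b := fun a b => by
      have : ∀ a b : ZMod 2, a - b = a + b := by decide
      exact funext fun k => this _ _
    simpa [qform, hkl, weight, h2] using this
  let e : Equiv.Perm (Fin 4) := Equiv.ofBijective τ (Finite.injective_iff_bijective.mp hτinj)
  refine ⟨e.symm, fun x => ?_⟩
  have hx : ((x, x ∘ e.symm) : RowVec)
      = ∑ k, x k • ((Pi.single k 1, Pi.single (τ k) 1) : RowVec) := by
    refine Prod.ext ?_ ?_
    · rw [Prod.fst_sum]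
      ext j
      simp [Pi.single_apply]
    · rw [Prod.snd_sum]
      ext j
      obtain ⟨i, rfl⟩ := e.surjective j
      simp [Pi.single_apply, e, hτinj.eq_iff]
  rw [hx]
  exact K.sum_mem fun k _ => K.smul_mem _ (hτ k)

theorem exists_stab_le {K : Submodule (ZMod 2) RowVec} (h1 : 1 ∈ K) (hK : Isotropic K)
    (hcard : 16 ≤ Nat.card K) (h : ((0, 1) : RowVec) ∈ K) :
    ∃ σ : Equiv.Perm (Fin 4), ∀ x : Fin 4 → ZMod 2, ∑ k, x k = 0 → ∀ c : ZMod 2,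
      ((x, x ∘ σ + c • 1) : RowVec) ∈ K := by
  have h10 : ((1, 0) : RowVec) ∈ K := by
    have := K.sub_mem h1 h
    rwa [show (1 : RowVec) - (0, 1) = (1, 0) by ext <;> simp] at this
  have heven : ∀ v ∈ K, ∑ k, v.1 k = 0 := fun v hv => by
    simpa [CliffordCommutant.bform, one_dotProduct] using hK.bform h10 hv
  let g : K → {x : Fin 4 → ZMod 2 // ∑ k, x k = 0} × ZMod 2 :=
    fun v => (⟨v.1.1, heven v v.2⟩, v.1.2 0)
  have hinj : Injective g := fun u v huv => by
    have huv1 : u.1.1 = v.1.1 := congrArg (fun p => p.1.1) huv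
    have huv2 : u.1.2 0 = v.1.2 0 := congrArg Prod.snd huv
    have h1 := K.sub_mem u.2 v.2
    have h2 : (u : RowVec) - (v : RowVec) = (0, u.1.2 - v.1.2) :=
      Prod.ext (sub_eq_zero.mpr huv1) rfl
    rw [h2] at h1
    have hw := hK _ h1
    have h3 : u.1.2 - v.1.2 = 0 := by
      refine ((weight_eq_zero_iff _).mp ?_).resolve_right fun h4 => ?_
      · simpa [qform, weight] using hw
      · have := congrFun h4 0
        simp [huv2] at this
    exact Subtype.ext (Prod.ext huv1 (sub_eq_zero.mp h3))
  have hsurj : ∀ x : Fin 4 → ZMod 2, ∑ k, x k = 0 → ∃ y, ((x, y) : RowVec) ∈ K := fun x hx => by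
    have hle : Nat.card ({x : Fin 4 → ZMod 2 // ∑ k, x k = 0} × ZMod 2) ≤ Nat.card K := by
      rw [Nat.card_eq_fintype_card, Fintype.card_prod, card_even, ZMod.card]
      exact hcard
    obtain ⟨v, hv⟩ := (hinj.bijective_of_nat_card_le hle).surjective (⟨x, hx⟩, 0)
    have hv1 : v.1.1 = x := congrArg (fun p => p.1.1) hv
    exact ⟨v.1.2, hv1 ▸ v.2⟩
  obtain ⟨y, hy⟩ := hsurj ![1, 1, 0, 0] (by decide)
  obtain ⟨z, hz⟩ := hsurj ![1, 0, 1, 0] (by decide)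
  have hw : ∀ {u v : Fin 4 → ZMod 2}, ((u, v) : RowVec) ∈ K → weight v = weight u :=
    fun huv => (sub_eq_zero.mp (hK _ huv)).symm
  obtain ⟨σ, hσy, hσz⟩ := exists_perm_of_weight_eq_two y z
    ((hw hy).trans (by decide)) ((hw hz).trans (by decide))
    ((hw (u := ![1, 1, 0, 0] + ![1, 0, 1, 0]) (v := y + z) (K.add_mem hy hz)).trans (by decide))
  have hshift : ∀ {u v w : Fin 4 → ZMod 2}, ((u, v) : RowVec) ∈ K → (w = v ∨ w = v + 1) →
      ((u, w) : RowVec) ∈ K := by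
    rintro u v w huv (rfl | rfl)
    · exact huv
    · simpa using K.add_mem huv h
  refine ⟨σ, fun x hx c => ?_⟩
  obtain ⟨a, b, d, rfl⟩ := even_eq_combination x hx
  have hp := hshift hy hσy
  have hq := hshift hz hσz
  generalize (![1, 1, 0, 0] : Fin 4 → ZMod 2) = p at hp
  generalize (![1, 0, 1, 0] : Fin 4 → ZMod 2) = q at hq
  convert K.add_mem (K.add_mem (K.add_mem (K.smul_mem a hp) (K.smul_mem b hq))
    (K.smul_mem d h1)) (K.smul_mem c h) using 1
  ext k <;> simp

theorem mem_iff_of_graph_le {K : Submodule (ZMod 2) RowVec} (hK : Isotropic K)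
    {σ : Equiv.Perm (Fin 4)} (hσ : ∀ x : Fin 4 → ZMod 2, ((x, x ∘ σ) : RowVec) ∈ K) (v : RowVec) :
    v ∈ K ↔ v.1 ∘ σ = v.2 := by
  refine ⟨fun hv => funext fun k => ?_, fun hv => ?_⟩
  · have := hK.bform (hσ (Pi.single (σ k) 1)) hv
    rw [show (Pi.single (σ k) 1 : Fin 4 → ZMod 2) ∘ σ = Pi.single k 1 by
      ext j; simp [Pi.single_apply], bform_single_left] at this
    exact eq_of_add_eq_zero this
  · have := hσ v.1
    rwa [hv] at this

theorem mem_iff_of_stab_le {K : Submodule (ZMod 2) RowVec} (hK : Isotropic K)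
    {σ : Equiv.Perm (Fin 4)} (hσ : ∀ x : Fin 4 → ZMod 2, ∑ k, x k = 0 → ∀ c : ZMod 2,
      ((x, x ∘ σ + c • 1) : RowVec) ∈ K) (v : RowVec) :
    v ∈ K ↔ (v.1, v.2 ∘ σ.symm) ∈ stabSpace := by
  have hcomp : ∀ y z : Fin 4 → ZMod 2, y ∘ σ.symm = z ↔ y = z ∘ σ := fun y z => by
    rw [Equiv.comp_symm_eq]
  simp only [mem_stabSpace, hcomp]
  constructor
  · refine fun hv => mem_stabSpace_of_orthogonal (v := (v.1, v.2 ∘ σ.symm)) ?_ |>.imp_right ?_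
    · rintro ⟨x, y⟩ ⟨hx, c, hc⟩
      obtain rfl : y = x + c • 1 := hc
      have := hK.bform (hσ x hx c) hv
      rw [← this]
      simp only [CliffordCommutant.bform]
      congr 1
      exact dotProduct_comp_equiv_symm _ _ σ
    · exact fun ⟨c, hc⟩ => ⟨c, (hcomp _ _).mp hc⟩
  · rintro ⟨hv, c, hc⟩
    have := hσ v.1 hv c
    rwa [show v.1 ∘ σ + c • 1 = v.2 from hc.symm] at this

variable {n : ℕ}

theorem sum_mul_prod_erase_eq {ι α : Type*} [Fintype ι] [DecidableEq ι] [Fintype α] [DecidableEq α]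
    (F : (ι → α) → ℂ) (Y : ι → α) (i : ι) :
    ∑ Z, F Z * ∏ j ∈ univ.erase i, (if Z j = Y j then (1 : ℂ) else 0)
      = ∑ s, F (update Y i s) := by
  symm
  refine Fintype.sum_of_injective (update Y i) (update_injective Y i) _ _ (fun Z hZ => ?_)
    fun s => ?_
  · have : ∃ j ∈ univ.erase i, Z j ≠ Y j := by
      by_contra! h
      refine hZ ⟨Z i, funext fun j => ?_⟩
      by_cases hj : j = i
      · subst hj; simp
      · simp [hj, h j (by simpa using hj)]
    obtain ⟨j, hj, hne⟩ := this
    rw [prod_eq_zero hj (if_neg hne), mul_zero]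
  · rw [prod_eq_one fun j hj => if_pos (update_of_ne (ne_of_mem_erase hj) _ _), mul_one]

theorem embedGate_mul (G G' : Matrix (ZMod 2) (ZMod 2) ℂ) (i : Fin n) :
    embedGate n G i * embedGate n G' i = embedGate n (G * G') i := by
  ext x y
  simp only [Matrix.mul_apply, embedGate, Matrix.of_apply, ← mul_assoc]
  rw [sum_mul_prod_erase_eq, sum_mul]
  refine sum_congr rfl fun s _ => ?_
  rw [update_self, mul_right_comm]
  congr 1
  refine prod_congr rfl fun k hk => ?_
  rw [update_of_ne (ne_of_mem_erase hk)]

theorem embedGate_one (i : Fin n) : embedGate n 1 i = 1 := by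
  ext x y
  have := mul_prod_erase univ (fun k => if x k = y k then (1 : ℂ) else 0) (mem_univ i)
  simp only [embedGate, Matrix.of_apply, Matrix.one_apply, this]
  simp only [prod_ite_zero, prod_const_one, mem_univ, true_imp_iff, funext_iff]

theorem conjTranspose_embedGate (G : Matrix (ZMod 2) (ZMod 2) ℂ) (i : Fin n) :
    (embedGate n G i).conjTranspose = embedGate n G.conjTranspose i := by
  ext x y
  simp only [embedGate, Matrix.of_apply, Matrix.conjTranspose_apply, star_mul', star_prod,
    apply_ite (star : ℂ → ℂ), star_one, star_zero, eq_comm]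

theorem embedGate_mem_unitaryGroup {G : Matrix (ZMod 2) (ZMod 2) ℂ}
    (hG : G ∈ Matrix.unitaryGroup (ZMod 2) ℂ) (i : Fin n) :
    embedGate n G i ∈ Matrix.unitaryGroup (Fin n → ZMod 2) ℂ := by
  rw [Matrix.mem_unitaryGroup_iff, Matrix.star_eq_conjTranspose] at hG ⊢
  rw [conjTranspose_embedGate, embedGate_mul, hG, embedGate_one]

theorem hGate_mem_unitaryGroup : hGate ∈ Matrix.unitaryGroup (ZMod 2) ℂ := by
  rw [Matrix.mem_unitaryGroup_iff, Matrix.star_eq_conjTranspose]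
  ext x y
  revert x y
  have huniv : (univ : Finset (ZMod 2)) = {0, 1} := by decide
  suffices ∀ x ∈ (univ : Finset (ZMod 2)), ∀ y ∈ (univ : Finset (ZMod 2)),
      (hGate * hGate.conjTranspose) x y = (1 : Matrix (ZMod 2) (ZMod 2) ℂ) x y from
    fun x y => this x (mem_univ x) y (mem_univ y)
  simp only [Matrix.mul_apply, huniv]
  simp [hGate, Complex.conj_I, Complex.conj_ofNat]
  ring_nf
  simp
  norm_num

theorem sGate_mem_unitaryGroup : sGate ∈ Matrix.unitaryGroup (ZMod 2) ℂ := by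
  rw [Matrix.mem_unitaryGroup_iff, Matrix.star_eq_conjTranspose]
  have h : sGate = Matrix.diagonal fun x => if x = 0 then 1 else -Complex.I := by
    ext x y
    simp only [sGate, Matrix.of_apply, Matrix.diagonal_apply]
  rw [h, Matrix.diagonal_conjTranspose, Matrix.diagonal_mul_diagonal, ← Matrix.diagonal_one]
  congr 1
  ext x
  simp only [Pi.star_apply]
  split_ifs <;> simp

/-- The map on rows implemented by a CNOT gate. -/
def cnotRow {A : Type*} [Add A] (i j : Fin n) (X : Fin n → A) : Fin n → A :=
  update X j (X j + X i)

theorem cnotGate_apply {i j : Fin n} (hij : i ≠ j) (x y : Fin n → ZMod 2) :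
    cnotGate n i j x y = if x = cnotRow i j y then 1 else 0 := by
  simp only [cnotGate, Matrix.of_apply]
  congr 1
  refine propext ⟨fun ⟨h1, h2, h3⟩ => funext fun k => ?_, ?_⟩
  · by_cases hk : k = j
    · subst hk; simp [cnotRow, h2, add_comm]
    · by_cases hki : k = i
      · subst hki; simp [cnotRow, hk, h1]
      · simp [cnotRow, hk, h3 k hki hk]
  · rintro rfl
    refine ⟨by simp [cnotRow, hij], by simp [cnotRow, add_comm], fun k _ hk => by
      simp [cnotRow, hk]⟩

theorem cnotRow_cnotRow {A : Type*} [AddCommMonoid A] (hA : ∀ a : A, a + a = 0) {i j : Fin n}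
    (hij : i ≠ j) (X : Fin n → A) : cnotRow i j (cnotRow i j X) = X := by
  simp [cnotRow, hij, add_assoc, hA]

theorem zmod_two_add_self : ∀ a : ZMod 2, a + a = 0 := by decide

theorem cnotGate_mem_unitaryGroup {i j : Fin n} (hij : i ≠ j) :
    cnotGate n i j ∈ Matrix.unitaryGroup (Fin n → ZMod 2) ℂ := by
  have hinv := cnotRow_cnotRow zmod_two_add_self hij
  rw [Matrix.mem_unitaryGroup_iff, Matrix.star_eq_conjTranspose]
  ext x y
  simp only [Matrix.mul_apply, Matrix.conjTranspose_apply, cnotGate_apply hij, Matrix.one_apply]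
  rw [sum_eq_single (cnotRow i j x)]
  · simp [hinv, eq_comm]
  · intro z _ hz
    rw [if_neg, zero_mul]
    rintro rfl
    exact hz (hinv z).symm
  · simp

theorem mem_unitaryGroup_of_mem_cliffordGens {G : Matrix (Fin n → ZMod 2) (Fin n → ZMod 2) ℂ}
    (hG : G ∈ cliffordGens n) : G ∈ Matrix.unitaryGroup (Fin n → ZMod 2) ℂ := by
  simp only [cliffordGens, Set.mem_union, Set.mem_iUnion, Set.mem_singleton_iff] at hG
  obtain (⟨i, rfl⟩ | ⟨i, rfl⟩) | ⟨i, j, hij, rfl⟩ := hG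
  · exact embedGate_mem_unitaryGroup hGate_mem_unitaryGroup i
  · exact embedGate_mem_unitaryGroup sGate_mem_unitaryGroup i
  · exact cnotGate_mem_unitaryGroup hij

theorem tpow_mul {α : Type*} [Fintype α] (M N : Matrix α α ℂ) (t : ℕ) :
    tpow (M * N) t = tpow M t * tpow N t := by
  classical
  ext x y
  simp only [tpow, Matrix.of_apply, Matrix.mul_apply, ← prod_mul_distrib]
  rw [prod_univ_sum, Fintype.piFinset_univ]

theorem tpow_one {α : Type*} [Fintype α] [DecidableEq α] (t : ℕ) :
    tpow (1 : Matrix α α ℂ) t = 1 := by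
  ext x y
  simp only [tpow, Matrix.of_apply, Matrix.one_apply, prod_ite_zero, prod_const_one, mem_univ,
    true_imp_iff, funext_iff]

theorem commute_permOp {α : Type*} [Fintype α] [DecidableEq α] {t : ℕ} (σ : Equiv.Perm (Fin t))
    (M : Matrix α α ℂ) : Commute (permOp α σ) (tpow M t) := by
  ext x y
  simp only [Matrix.mul_apply, permOp, Matrix.of_apply, ite_mul, one_mul, zero_mul, mul_ite,
    mul_one, mul_zero, sum_ite_eq, mem_univ, if_true]
  have h : ∀ z : Fin t → α, (fun k => z (σ k)) = y ↔ z = y ∘ σ.symm := fun z => by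
    rw [Equiv.eq_comp_symm]; rfl
  simp only [h, sum_ite_eq', mem_univ, if_true, tpow, Matrix.of_apply]
  rw [← Equiv.prod_comp σ fun k => M (x k) ((y ∘ σ.symm) k)]
  simp

theorem forall_mem_cliffordGroup_iff
    (B : Matrix (Fin 4 → (Fin n → ZMod 2)) (Fin 4 → (Fin n → ZMod 2)) ℂ) :
    (∀ U ∈ CliffordGroup n, Commute B (tpow (U : Matrix (Fin n → ZMod 2) (Fin n → ZMod 2) ℂ) 4))
      ↔ ∀ G ∈ cliffordGens n, Commute B (tpow G 4) := by
  refine ⟨fun h G hG => h ⟨G, mem_unitaryGroup_of_mem_cliffordGens hG⟩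
    (Subgroup.subset_closure hG), fun h U hU => ?_⟩
  induction hU using Subgroup.closure_induction with
  | mem U hU => exact h _ hU
  | one => simp [tpow_one]
  | mul U V _ _ hU hV => simpa [tpow_mul] using hU.mul_right hV
  | inv U _ hU =>
    have h1 : tpow (U : Matrix (Fin n → ZMod 2) (Fin n → ZMod 2) ℂ) 4
        * tpow ((U⁻¹ : Matrix.unitaryGroup (Fin n → ZMod 2) ℂ) :
          Matrix (Fin n → ZMod 2) (Fin n → ZMod 2) ℂ) 4 = 1 := by
      rw [← tpow_mul, ← Submonoid.coe_mul, mul_inv_cancel, Submonoid.coe_one, tpow_one]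
    exact hU.units_inv_right (u := ⟨_, _, h1, mul_eq_one_comm.mp h1⟩)

/-- Operators on four copies of `n` qubits. -/
abbrev Op (n : ℕ) := Matrix (Fin 4 → (Fin n → ZMod 2)) (Fin 4 → (Fin n → ZMod 2)) ℂ

/-- The entries of an operator, indexed qubit by qubit. -/
def coeff : Op n →ₗ[ℂ] ((Fin n → RowVec) → ℂ) where
  toFun B M := B (fun k i => (M i).1 k) (fun k i => (M i).2 k)
  map_add' _ _ := rfl
  map_smul' _ _ := rfl

theorem coeff_apply (B : Op n) (M : Fin n → RowVec) :
    coeff B M = B (fun k i => (M i).1 k) (fun k i => (M i).2 k) := rfl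

theorem coeff_injective : Injective (coeff (n := n)) := fun B B' h => by
  ext x y
  exact congrFun h fun i => (fun k => x k i, fun k => y k i)

theorem coeff_mul (B C : Op n) (M : Fin n → RowVec) :
    coeff (B * C) M
      = ∑ Z : Fin n → Fin 4 → ZMod 2, coeff B (fun i => ((M i).1, Z i))
        * coeff C (fun i => (Z i, (M i).2)) := by
  rw [coeff_apply, Matrix.mul_apply]
  exact (Equiv.sum_comp (Equiv.piComm fun (_ : Fin n) (_ : Fin 4) => ZMod 2) _).symm

theorem coeff_tpow_embedGate (G : Matrix (ZMod 2) (ZMod 2) ℂ) (i : Fin n) (M : Fin n → RowVec) :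
    coeff (tpow (embedGate n G i) 4) M = (∏ k, G ((M i).1 k) ((M i).2 k))
      * ∏ j ∈ univ.erase i, (if (M j).1 = (M j).2 then (1 : ℂ) else 0) := by
  simp only [coeff_apply, tpow, embedGate, Matrix.of_apply, prod_mul_distrib]
  rw [prod_comm]
  simp only [prod_ite_zero, prod_const_one, mem_univ, true_imp_iff, funext_iff]

theorem update_pair_snd (M : Fin n → RowVec) (i : Fin n) (s : Fin 4 → ZMod 2) :
    (fun j => ((M j).1, update (fun j => (M j).2) i s j)) = update M i ((M i).1, s) := by
  ext j : 1
  by_cases hj : j = i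
  · subst hj; simp
  · simp [hj]

theorem update_pair_fst (M : Fin n → RowVec) (i : Fin n) (s : Fin 4 → ZMod 2) :
    (fun j => (update (fun j => (M j).1) i s j, (M j).2)) = update M i (s, (M i).2) := by
  ext j : 1
  by_cases hj : j = i
  · subst hj; simp
  · simp [hj]

theorem coeff_mul_tpow_embedGate (B : Op n) (G : Matrix (ZMod 2) (ZMod 2) ℂ) (i : Fin n)
    (M : Fin n → RowVec) :
    coeff (B * tpow (embedGate n G i) 4) M
      = ∑ s, coeff B (update M i ((M i).1, s)) * ∏ k, G (s k) ((M i).2 k) := by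
  simp only [coeff_mul, coeff_tpow_embedGate, ← mul_assoc]
  rw [sum_mul_prod_erase_eq
    (fun Z => coeff B (fun i => ((M i).1, Z i)) * ∏ k, G (Z i k) ((M i).2 k)) (fun j => (M j).2)]
  simp only [update_self, update_pair_snd]

theorem coeff_tpow_embedGate_mul (B : Op n) (G : Matrix (ZMod 2) (ZMod 2) ℂ) (i : Fin n)
    (M : Fin n → RowVec) :
    coeff (tpow (embedGate n G i) 4 * B) M
      = ∑ s, (∏ k, G ((M i).1 k) (s k)) * coeff B (update M i (s, (M i).2)) := by
  simp only [coeff_mul, coeff_tpow_embedGate, mul_right_comm _ (∏ j ∈ univ.erase i, _)]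
  simp only [eq_comm (a := (M _).1)]
  rw [sum_mul_prod_erase_eq
    (fun Z : Fin n → Fin 4 → ZMod 2 =>
      (∏ k, G ((M i).1 k) (Z i k)) * coeff B (fun i => (Z i, (M i).2))) (fun j => (M j).1)]
  simp only [update_self, update_pair_fst]

theorem commute_iff_coeff (B C : Op n) :
    Commute B C ↔ ∀ M, coeff (B * C) M = coeff (C * B) M :=
  coeff_injective.eq_iff.symm.trans funext_iff

theorem prod_hGate (s y : Fin 4 → ZMod 2) : ∏ k, hGate (s k) (y k) = -1 / 4 * sgn (s ⬝ᵥ y) := by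
  have h : ∀ a b : ZMod 2, hGate a b = (1 + Complex.I) / 2 * sgn (a * b) := by
    have h2 : ∀ a b : ZMod 2, a * b = 0 ↔ ¬ (a = 1 ∧ b = 1) := by decide
    intro a b
    simp only [hGate, Matrix.of_apply, sgn, h2, ite_not]
  have h4 : ((1 + Complex.I) / 2) ^ 4 = -1 / 4 := by
    linear_combination (Complex.I ^ 2 + 4 * Complex.I + 5) / 16 * Complex.I_sq
  simp only [h, prod_mul_distrib, prod_const, card_univ, Fintype.card_fin, h4, dotProduct, sgn_sum]

/-- The eigenvalue of `S^{⊗4}` on a basis vector. -/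
def phase (y : Fin 4 → ZMod 2) : ℂ := ∏ k, if y k = 0 then 1 else -Complex.I

theorem prod_sGate (s y : Fin 4 → ZMod 2) :
    ∏ k, sGate (s k) (y k) = if s = y then phase y else 0 := by
  simp only [sGate, Matrix.of_apply, prod_ite_zero, mem_univ, true_imp_iff, funext_iff]
  split_ifs with h
  · simp only [phase, h]
  · rfl

theorem phase_eq_iff (x y : Fin 4 → ZMod 2) : phase x = phase y ↔ weight x = weight y := by
  have h : ∀ z, phase z = (-Complex.I) ^ ∑ k, (z k).val := fun z => by
    rw [← prod_pow_eq_pow_sum]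
    refine prod_congr rfl fun k _ => ?_
    split_ifs with hk
    · simp [hk]
    · simp [zmod_two_eq_one hk, ZMod.val_one]
  have hfin : IsOfFinOrder (-Complex.I) := isOfFinOrder_iff_pow_eq_one.mpr
    ⟨4, by norm_num, Complex.isPrimitiveRoot_neg_I.pow_eq_one⟩
  rw [h, h, hfin.pow_eq_pow_iff_modEq, ← Complex.isPrimitiveRoot_neg_I.eq_orderOf,
    ← ZMod.natCast_eq_natCast_iff]
  simp [weight]

theorem commute_tpow_sGate_iff (B : Op n) (i : Fin n) :
    Commute B (tpow (embedGate n sGate i) 4)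
      ↔ ∀ M, coeff B M ≠ 0 → qform (M i) = 0 := by
  rw [commute_iff_coeff]
  refine forall_congr' fun M => ?_
  simp only [coeff_mul_tpow_embedGate, coeff_tpow_embedGate_mul, prod_sGate, mul_ite, mul_zero,
    ite_mul, zero_mul, sum_ite_eq, sum_ite_eq', mem_univ, if_true, Prod.mk.eta, update_eq_self,
    qform, sub_eq_zero, ← phase_eq_iff]
  rw [mul_comm, mul_eq_mul_right_iff, eq_comm, or_comm, or_iff_not_imp_left]

theorem sum_sgn_dotProduct (x y : Fin 4 → ZMod 2) :
    ∑ t : Fin 4 → ZMod 2, sgn (x ⬝ᵥ t + t ⬝ᵥ y) = if x = y then 16 else 0 := by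
  have h : ∀ a b : ZMod 2, ∑ c : ZMod 2, sgn (a * c + c * b) = if a = b then 2 else 0 := by
    intro a b
    rw [show (univ : Finset (ZMod 2)) = {0, 1} by decide, sum_pair (by decide)]
    have h2 : ∀ a b : ZMod 2, a + b = 0 ↔ a = b := by decide
    by_cases hab : a = b
    · simp [hab, zmod_two_add_self]; norm_num
    · simp [sgn, h2, hab]
  simp only [dotProduct, ← sum_add_distrib, sgn_sum]
  rw [← Fintype.piFinset_univ,
    ← prod_univ_sum (fun _ => univ) fun k c => sgn (x k * c + c * y k)]
  simp only [h, prod_ite_zero, prod_const, mem_univ, true_imp_iff, funext_iff]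
  norm_num

theorem commute_tpow_hGate_iff (B : Op n) (i : Fin n) :
    Commute B (tpow (embedGate n hGate i) 4) ↔ ∀ M r,
      ∑ s, sgn (bform r s) * coeff B (update M i s) = 16 * coeff B (update M i r) := by
  have hE : Commute B (tpow (embedGate n hGate i) 4) ↔ ∀ M x y,
      ∑ s, coeff B (update M i (x, s)) * sgn (s ⬝ᵥ y)
        = ∑ s, sgn (x ⬝ᵥ s) * coeff B (update M i (s, y)) := by
    have h4 : (-1 / 4 : ℂ) ≠ 0 := by norm_num
    rw [commute_iff_coeff]
    simp only [coeff_mul_tpow_embedGate, coeff_tpow_embedGate_mul, prod_hGate, mul_assoc,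
      mul_left_comm _ (-1 / 4 : ℂ), ← mul_sum, mul_right_inj' h4]
    refine ⟨fun h M x y => ?_, fun h M => h M _ _⟩
    simpa using h (update M i (x, y))
  rw [hE]
  refine forall_congr' fun M => ?_
  generalize hf : (fun v => coeff B (update M i v)) = f
  have hf' : ∀ v, coeff B (update M i v) = f v := fun v => congrFun hf v
  simp only [hf']
  constructor
  · rintro h ⟨a, b⟩
    calc ∑ s, sgn (bform (a, b) s) * f s
        = ∑ t, sgn (b ⬝ᵥ t) * ∑ s, sgn (a ⬝ᵥ s) * f (s, t) := by
          simp only [Fintype.sum_prod_type_right, mul_sum, bform, sgn_add]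
          exact sum_congr rfl fun t _ => sum_congr rfl fun s _ => by ring
      _ = ∑ t, sgn (b ⬝ᵥ t) * ∑ u, f (a, u) * sgn (u ⬝ᵥ t) := by simp only [h]
      _ = ∑ u, f (a, u) * ∑ t, sgn (b ⬝ᵥ t + t ⬝ᵥ u) := by
          simp only [mul_sum, sgn_add]
          rw [sum_comm]
          refine sum_congr rfl fun u _ => sum_congr rfl fun t _ => ?_
          rw [dotProduct_comm t u]
          ring
      _ = 16 * f (a, b) := by
          simp only [sum_sgn_dotProduct, mul_ite, mul_zero, sum_ite_eq, mem_univ, if_true]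
          ring
  · intro h x y
    refine mul_left_cancel₀ (show (16 : ℂ) ≠ 0 by norm_num) ?_
    calc 16 * ∑ s, f (x, s) * sgn (s ⬝ᵥ y)
        = ∑ s, (∑ v, sgn (bform (x, s) v) * f v) * sgn (s ⬝ᵥ y) := by
          simp only [h, mul_sum, mul_assoc]
      _ = ∑ v : RowVec, sgn (x ⬝ᵥ v.1) * f v * ∑ s, sgn (v.2 ⬝ᵥ s + s ⬝ᵥ y) := by
          simp only [mul_sum, sum_mul, bform, sgn_add]
          rw [sum_comm]
          refine sum_congr rfl fun v _ => sum_congr rfl fun s _ => ?_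
          rw [dotProduct_comm s v.2]
          ring
      _ = 16 * ∑ s, sgn (x ⬝ᵥ s) * f (s, y) := by
          simp only [sum_sgn_dotProduct, Fintype.sum_prod_type, mul_ite, mul_zero, sum_ite_eq',
            mem_univ, if_true, mul_sum]
          exact sum_congr rfl fun s _ => by ring

theorem coeff_tpow_cnotGate {i j : Fin n} (hij : i ≠ j) (M : Fin n → RowVec) :
    coeff (tpow (cnotGate n i j) 4) M
      = if (fun l => (M l).1) = cnotRow i j (fun l => (M l).2) then 1 else 0 := by
  simp only [coeff_apply, tpow, Matrix.of_apply, cnotGate_apply hij, prod_ite_zero, prod_const_one,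
    mem_univ, true_imp_iff]
  congr 1
  simp only [funext_iff, eq_iff_iff]
  rw [forall_comm]
  refine forall_congr' fun l => forall_congr' fun k => ?_
  by_cases hl : l = j
  · subst hl; simp [cnotRow]
  · simp [cnotRow, hl]

theorem cnotRow_pair (i j : Fin n) (M : Fin n → RowVec) :
    cnotRow i j M
      = fun l => (cnotRow i j (fun l => (M l).1) l, cnotRow i j (fun l => (M l).2) l) := by
  ext l : 1
  by_cases hl : l = j
  · subst hl; simp [cnotRow]; rfl
  · simp [cnotRow, hl]

theorem commute_tpow_cnotGate_iff (B : Op n) {i j : Fin n} (hij : i ≠ j) :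
    Commute B (tpow (cnotGate n i j) 4) ↔ ∀ M, coeff B (cnotRow i j M) = coeff B M := by
  have hinv : ∀ X : Fin n → Fin 4 → ZMod 2, cnotRow i j (cnotRow i j X) = X :=
    cnotRow_cnotRow (fun a => funext fun k => zmod_two_add_self (a k)) hij
  have hinv' : ∀ X Z : Fin n → Fin 4 → ZMod 2, X = cnotRow i j Z ↔ Z = cnotRow i j X :=
    fun X Z => ⟨fun h => by rw [h, hinv], fun h => by rw [h, hinv]⟩
  have h1 : ∀ M, coeff (B * tpow (cnotGate n i j) 4) M
      = coeff B fun l => ((M l).1, cnotRow i j (fun l => (M l).2) l) := fun M => by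
    simp only [coeff_mul, coeff_tpow_cnotGate hij, mul_ite, mul_one, mul_zero, sum_ite_eq',
      mem_univ, if_true]
  have h2 : ∀ M, coeff (tpow (cnotGate n i j) 4 * B) M
      = coeff B fun l => (cnotRow i j (fun l => (M l).1) l, (M l).2) := fun M => by
    simp only [coeff_mul, coeff_tpow_cnotGate hij, hinv' (fun l => (M l).1), ite_mul, one_mul,
      zero_mul, sum_ite_eq', mem_univ, if_true]
  simp only [commute_iff_coeff, h1, h2]
  constructor
  · intro h M
    rw [cnotRow_pair, h fun l => (cnotRow i j (fun l => (M l).1) l, (M l).2)]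
    simp only [hinv]
  · intro h M
    rw [← h, cnotRow_pair]
    simp only [hinv]

theorem commute_cliffordGens_iff (B : Op n) :
    (∀ G ∈ cliffordGens n, Commute B (tpow G 4)) ↔ IsInvariant (coeff B) := by
  constructor
  · intro h
    refine ⟨fun M i => (commute_tpow_sGate_iff B i).mp (h _ ?_) M,
      fun M i j hij => (commute_tpow_cnotGate_iff B hij).mp (h _ ?_) M,
      fun M i => (commute_tpow_hGate_iff B i).mp (h _ ?_) M⟩ <;>
    simp only [cliffordGens, Set.mem_union, Set.mem_iUnion, Set.mem_singleton_iff]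
    · exact Or.inl (Or.inr ⟨i, rfl⟩)
    · exact Or.inr ⟨i, j, hij, rfl⟩
    · exact Or.inl (Or.inl ⟨i, rfl⟩)
  · intro h G hG
    simp only [cliffordGens, Set.mem_union, Set.mem_iUnion, Set.mem_singleton_iff] at hG
    obtain (⟨i, rfl⟩ | ⟨i, rfl⟩) | ⟨i, j, hij, rfl⟩ := hG
    · exact (commute_tpow_hGate_iff B i).mpr fun M => h.fourier M i
    · exact (commute_tpow_sGate_iff B i).mpr fun M => h.qform_eq_zero M i
    · exact (commute_tpow_cnotGate_iff B hij).mpr fun M => h.add_row M i j hij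

open scoped Classical in
theorem isInvariant_indicator {K : Submodule (ZMod 2) RowVec} (hK : Isotropic K)
    (hdual : ∀ v, (∀ u ∈ K, bform u v = 0) → v ∈ K) (hcard : Nat.card K = 16) (c : ℂ) :
    IsInvariant fun M : Fin n → RowVec => if ∀ i, M i ∈ K then c else 0 := by
  refine ⟨fun M i hM => ?_, fun M i j hij => ?_, fun M i r => ?_⟩
  · by_contra h
    exact hM (if_neg fun h2 => h (hK _ (h2 i)))
  · congr 1
    refine propext ⟨fun h l => ?_, fun h l => ?_⟩
    · have hi : M i ∈ K := by simpa [hij] using h i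
      by_cases hl : l = j
      · subst hl
        have hj : M l + M i ∈ K := by simpa using h l
        simpa using K.sub_mem hj hi
      · simpa [hl] using h l
    · by_cases hl : l = j
      · subst hl
        simpa using K.add_mem (h l) (h i)
      · simpa [hl] using h l
  · have hiff : ∀ s, (∀ l, update M i s l ∈ K) ↔ s ∈ K ∧ ∀ l, l ≠ i → M l ∈ K := fun s =>
      forall_update_iff M fun _ v => v ∈ K
    simp only [hiff, ite_and]
    have hsum := sum_sgn_bform K r
    have hr : (∀ u ∈ K, bform u r = 0) ↔ r ∈ K :=
      ⟨hdual r, fun h u hu => hK.bform hu h⟩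
    rw [if_congr hr rfl rfl, hcard] at hsum
    rw [show ∑ s, sgn (bform r s) * (if s ∈ K then (if ∀ l, l ≠ i → M l ∈ K then c else 0) else 0)
        = (∑ u : K, sgn (bform u r)) * (if ∀ l, l ≠ i → M l ∈ K then c else 0) by
      rw [sum_mul]
      exact (Fintype.sum_of_injective Subtype.val Subtype.val_injective _ _
        (fun s hs => by rw [if_neg fun h => hs ⟨⟨s, h⟩, rfl⟩, mul_zero])
        fun u => by rw [if_pos u.2, bform_comm]).symm]
    rw [hsum]
    split_ifs <;> simp

theorem prod_pauli_sum (u v : Fin 4 → ZMod 2) :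
    ∑ a, ∏ k, pauli a (u k) (v k)
      = if ∑ k, u k = 0 ∧ ∃ c : ZMod 2, v = u + c • 1 then 2 else 0 := by
  have h2 : ∀ a b : ZMod 2, a = b + 1 ↔ b = a + 1 := by decide
  have hI : ∀ a : ZMod 2, (if a = 0 then -Complex.I else Complex.I) = -(Complex.I * sgn a) :=
    fun a => by by_cases h : a = 0 <;> simp [h, sgn]
  have hprod : ∏ k, -(Complex.I * sgn (u k)) = ∏ k, sgn (u k) := by
    simp only [← neg_mul, prod_mul_distrib, prod_const, card_univ, Fintype.card_fin,
      Complex.isPrimitiveRoot_neg_I.pow_eq_one, one_mul]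
  have hne : u ≠ u + 1 := fun h => by simpa using congrFun h 0
  have h00 : ∏ k, pauli (0, 0) (u k) (v k) = if v = u then 1 else 0 := by
    simp [pauli, prod_ite_zero, funext_iff, eq_comm]
  have h01 : ∏ k, pauli (0, 1) (u k) (v k) = if v = u + 1 then 1 else 0 := by
    simp [pauli, prod_ite_zero, funext_iff, h2]
  have h10 : ∏ k, pauli (1, 0) (u k) (v k) = if v = u then sgn (∑ k, u k) else 0 := by
    simp [pauli, prod_ite_zero, funext_iff, sgn_sum, ← sgn.eq_1, eq_comm]
  have h11 : ∏ k, pauli (1, 1) (u k) (v k) = if v = u + 1 then sgn (∑ k, u k) else 0 := by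
    simp [pauli, prod_ite_zero, funext_iff, sgn_sum, h2, hI, hprod]
  have hex : (∃ c : ZMod 2, v = u + c • 1) ↔ v = u ∨ v = u + 1 := by
    refine ⟨fun ⟨c, hc⟩ => ?_, ?_⟩
    · by_cases h0 : c = 0
      · exact Or.inl (by simpa [h0] using hc)
      · exact Or.inr (by simpa [zmod_two_eq_one h0] using hc)
    · rintro (h | h)
      exacts [⟨0, by simpa using h⟩, ⟨1, by simpa using h⟩]
  rw [Fintype.sum_prod_type, show (univ : Finset (ZMod 2)) = {0, 1} by decide,
    sum_pair (by decide), sum_pair (by decide), sum_pair (by decide), h00, h01, h10, h11]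
  simp only [hex]
  by_cases hs : ∑ k, u k = 0
  · by_cases h1 : v = u
    · simp [hs, h1]; norm_num
    · by_cases h3 : v = u + 1
      · simp [hs, h3, hne.symm]; norm_num
      · simp [h1, h3]
  · simp only [sgn_of_ne hs, hs, false_and, if_false]
    split_ifs <;> simp

open scoped Classical in
theorem coeff_stabProj (M : Fin n → RowVec) :
    coeff (stabProj n 4) M = if ∀ i, M i ∈ stabSpace then ((2 : ℂ) ^ n)⁻¹ else 0 := by
  have h : coeff (stabProj n 4) M
      = ((2 : ℂ) ^ (2 * n))⁻¹ * ∏ i, ∑ a, ∏ k, pauli a ((M i).1 k) ((M i).2 k) := by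
    simp only [coeff_apply, stabProj, Matrix.smul_apply, Matrix.sum_apply, smul_eq_mul, tpow,
      PauliW, Matrix.of_apply]
    rw [prod_univ_sum, Fintype.piFinset_univ]
    congr 1
    exact sum_congr rfl fun a _ => prod_comm
  rw [h]
  simp only [prod_pauli_sum, ← mem_stabSpace, prod_ite_zero, mem_univ, true_imp_iff, prod_const,
    card_univ, Fintype.card_fin, mul_ite, mul_zero]
  congr 1
  rw [pow_mul', sq, mul_inv, mul_assoc, inv_mul_cancel₀ (pow_ne_zero n two_ne_zero), mul_one]

theorem commute_stabProj {G : Matrix (Fin n → ZMod 2) (Fin n → ZMod 2) ℂ}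
    (hG : G ∈ cliffordGens n) : Commute (stabProj n 4) (tpow G 4) := by
  classical
  refine (commute_cliffordGens_iff _).mpr ?_ G hG
  rw [funext coeff_stabProj]
  exact isInvariant_indicator isotropic_stabSpace (fun v => mem_stabSpace_of_orthogonal)
    card_stabSpace _

theorem coeff_permOp (σ : Equiv.Perm (Fin 4)) (M : Fin n → RowVec) :
    coeff (permOp (Fin n → ZMod 2) σ) M = if ∀ i, (M i).1 ∘ σ = (M i).2 then 1 else 0 := by
  simp only [coeff_apply, permOp, Matrix.of_apply]
  congr 1
  simp only [funext_iff, eq_iff_iff, comp_apply]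
  exact forall_comm

theorem coeff_mul_permOp (B : Op n) (σ : Equiv.Perm (Fin 4)) (M : Fin n → RowVec) :
    coeff (B * permOp (Fin n → ZMod 2) σ) M = coeff B fun i => ((M i).1, (M i).2 ∘ σ.symm) := by
  have h : ∀ Z : Fin n → Fin 4 → ZMod 2,
      (∀ i, Z i ∘ σ = (M i).2) ↔ Z = fun i => (M i).2 ∘ σ.symm := fun Z => by
    simp only [funext_iff (f := Z), Equiv.eq_comp_symm]
  simp only [coeff_mul, coeff_permOp, h, mul_ite, mul_one, mul_zero, sum_ite_eq', mem_univ, if_true]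

/-- The algebra generated by the permutation operators and the stabilizer projector. -/
abbrev permStabAlgebra (n : ℕ) : Subalgebra ℂ (Op n) :=
  Algebra.adjoin ℂ
    ({M | ∃ σ : Equiv.Perm (Fin 4), M = permOp (Fin n → ZMod 2) σ} ∪ {stabProj n 4})

open scoped Classical in
theorem exists_mem_coeff_eq_indicator {K : Submodule (ZMod 2) RowVec} (h1 : 1 ∈ K)
    (hK : Isotropic K) (hcard : 16 ≤ Nat.card K) :
    ∃ E ∈ permStabAlgebra n, ∀ M, coeff E M = if ∀ i, M i ∈ K then 1 else 0 := by
  have hperm : ∀ σ, permOp (Fin n → ZMod 2) σ ∈ permStabAlgebra n := fun σ =>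
    Algebra.subset_adjoin (Or.inl ⟨σ, rfl⟩)
  have hstab : stabProj n 4 ∈ permStabAlgebra n := Algebra.subset_adjoin (Or.inr rfl)
  by_cases h : ((0, 1) : RowVec) ∈ K
  · obtain ⟨σ, hσ⟩ := exists_stab_le h1 hK hcard h
    refine ⟨(2 : ℂ) ^ n • (stabProj n 4 * permOp (Fin n → ZMod 2) σ),
      (permStabAlgebra n).smul_mem (mul_mem hstab (hperm σ)) _, fun M => ?_⟩
    rw [map_smul, Pi.smul_apply, coeff_mul_permOp, coeff_stabProj]
    simp only [mem_iff_of_stab_le hK hσ]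
    simp
  · obtain ⟨σ, hσ⟩ := exists_graph_le hK hcard h
    refine ⟨_, hperm σ, fun M => ?_⟩
    rw [coeff_permOp]
    simp only [mem_iff_of_graph_le hK hσ]

theorem exists_mem_orthogonal {ι : Type*} [Fintype ι] (W : Submodule ℂ (ι → ℂ)) (b : ι → ℂ) :
    ∃ s ∈ W, ∀ w ∈ W, ∑ i, star (w i) * (b - s) i = 0 := by
  let e := (WithLp.linearEquiv 2 ℂ (ι → ℂ)).symm
  obtain ⟨y, hy, z, hz, hyz⟩ := (W.map e.toLinearMap).exists_add_mem_mem_orthogonal (e b)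
  obtain ⟨s, hs, rfl⟩ := hy
  refine ⟨s, hs, fun w hw => ?_⟩
  have h := hz (e w) ⟨w, hw, rfl⟩
  have hzb : z = e (b - s) := by rw [map_sub, hyz]; exact (add_sub_cancel_left _ _).symm
  rw [hzb, PiLp.inner_apply] at h
  simpa [e, mul_comm] using h

theorem mem_permStabAlgebra_iff (hn : 1 ≤ n) (B : Op n) :
    B ∈ permStabAlgebra n ↔ ∀ G ∈ cliffordGens n, Commute B (tpow G 4) := by
  classical
  have hle : ∀ B ∈ permStabAlgebra n, ∀ G ∈ cliffordGens n, Commute B (tpow G 4) := by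
    intro B hB G hG
    induction hB using Algebra.adjoin_induction with
    | mem B hB =>
      obtain ⟨σ, rfl⟩ | rfl := hB
      exacts [commute_permOp σ G, commute_stabProj hG]
    | algebraMap c => exact Algebra.commutes c _
    | add B C _ _ hB hC => exact hB.add_left hC
    | mul B C _ _ hB hC => exact hB.mul_left hC
  refine ⟨hle B, fun hB => ?_⟩
  obtain ⟨_, ⟨S, hS, rfl⟩, horth⟩ :=
    exists_mem_orthogonal ((permStabAlgebra n).toSubmodule.map coeff) (coeff B)
  have hinv : IsInvariant (coeff (B - S)) :=
    (commute_cliffordGens_iff _).mp fun G hG => (hB G hG).sub_left (hle S hS G hG)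
  have hzero : coeff (B - S) = 0 := funext fun M => by
    refine hinv.eq_zero ⟨0, hn⟩ (fun K h1 hK hcard => ?_) M
    obtain ⟨E, hE, hcoeff⟩ := exists_mem_coeff_eq_indicator (n := n) h1 hK hcard
    have h := horth _ ⟨E, hE, rfl⟩
    rw [← map_sub] at h
    simp only [hcoeff] at h
    rw [← h]
    simp only [IsInvariant.shiftedSum, Pi.zero_apply, zero_smul, add_zero]
    refine Fintype.sum_of_injective (fun (N : Fin n → K) i => (N i : RowVec))
      (fun N N' hN => funext fun i => Subtype.ext (congrFun hN i)) _ _ (fun N hN => ?_) fun N => ?_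
    · rw [if_neg fun h => hN ⟨fun i => ⟨N i, h i⟩, rfl⟩, star_zero, zero_mul]
    · rw [if_pos fun i => (N i).2, star_one, one_mul]
  rw [← sub_eq_zero.mp (coeff_injective (hzero.trans (map_zero coeff).symm))] at hS
  exact hS

end CliffordCommutant

/-- **Main Theorem.** The commutant of the diagonal action of the `n`-qubit
Clifford group on `(ℂ^d)^{⊗4}`, `d = 2^n`, is generated as an algebra by the permutation
operators `U_σ`, `σ ∈ S_4`, together with the stabilizer projector `P_{n,4}`. -/
theorem stmt4 (n : ℕ) (hn : 1 ≤ n) :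
    {B : Matrix (Fin 4 → (Fin n → ZMod 2)) (Fin 4 → (Fin n → ZMod 2)) ℂ |
        ∀ U ∈ CliffordGroup n,
          B * tpow ((U : Matrix (Fin n → ZMod 2) (Fin n → ZMod 2) ℂ)) 4
            = tpow ((U : Matrix (Fin n → ZMod 2) (Fin n → ZMod 2) ℂ)) 4 * B}
      = ↑(Algebra.adjoin ℂ
          ({M | ∃ σ : Equiv.Perm (Fin 4), M = permOp (Fin n → ZMod 2) σ}
            ∪ {stabProj n 4})) := by
  ext B
  exact (CliffordCommutant.forall_mem_cliffordGroup_iff B).trans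
    (CliffordCommutant.mem_permStabAlgebra_iff hn B).symm

end
end

section
/- Let n ≥ 1, d = 2^n, and let ψ ∈ ℂ^d be a unit vector. Set D_+ := (d+1)(d+2)/6, D_− := (d−1)(d+1)(d+2)(d+4)/24, D_[4] := d(d+1)(d+2)(d+3)/24, P_+ := P_{n,4}·P_[4] and P_− := (1 − P_{n,4})·P_[4]. Then (1/|C_n|)·Σ_{U∈C_n} (U|ψ⟩⟨ψ|U^†)^{⊗4} = β_+·P_+ + β_−·P_−, where β_+ = (1/D_+)·tr(P_{n,4}·(|ψ⟩⟨ψ|)^{⊗4}) and β_− = (1 − D_+·β_+)/D_−. In particular, this average equals P_[4]/D_[4] (i.e. ψ is a fiducial vector of a complex projective 4-design) if and only if tr(P_{n,4}·(|ψ⟩⟨ψ|)^{⊗4}) = 4/(d(d+3)). -/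
open scoped BigOperators

noncomputable section

/-- The average of `(U|ψ⟩⟨ψ|U^†)^{⊗4}` over the `n`-qubit Clifford group. -/
def cliffordAvg4 (n : ℕ) [Fintype (CliffordGroup n)] (ψ : (Fin n → ZMod 2) → ℂ) :
    Matrix (Fin 4 → (Fin n → ZMod 2)) (Fin 4 → (Fin n → ZMod 2)) ℂ :=
  (Fintype.card (CliffordGroup n) : ℂ)⁻¹ •
    ∑ U : CliffordGroup n,
      tpow (rankOne (Matrix.mulVec
        ((U : Matrix.unitaryGroup (Fin n → ZMod 2) ℂ) :
          Matrix (Fin n → ZMod 2) (Fin n → ZMod 2) ℂ) ψ)) 4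

open Matrix

/-- Tensor product over `Q` of a family of matrices. -/
def piTensor {Q β : Type*} [Fintype Q] (g : Q → Matrix β β ℂ) : Matrix (Q → β) (Q → β) ℂ :=
  Matrix.of fun x y => ∏ i, g i (x i) (y i)

lemma piTensor_mul {Q β : Type*} [Fintype Q] [DecidableEq Q] [Fintype β]
    (g h : Q → Matrix β β ℂ) :
    piTensor g * piTensor h = piTensor fun i => g i * h i := by
  ext x y
  simp only [piTensor, Matrix.mul_apply, Matrix.of_apply, Fintype.prod_sum,
    Finset.prod_mul_distrib]

lemma piTensor_one {Q β : Type*} [Fintype Q] [DecidableEq β] :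
    piTensor (fun _ : Q => (1 : Matrix β β ℂ)) = 1 := by
  ext x y
  simp only [piTensor, Matrix.of_apply, Matrix.one_apply, Finset.prod_ite_zero, funext_iff]
  simp

lemma piTensor_conjTranspose {Q β : Type*} [Fintype Q] (g : Q → Matrix β β ℂ) :
    (piTensor g)ᴴ = piTensor fun i => (g i)ᴴ := by
  ext x y
  simp [piTensor, Matrix.conjTranspose_apply]

lemma trace_piTensor {Q β : Type*} [Fintype Q] [DecidableEq Q] [Fintype β]
    (g : Q → Matrix β β ℂ) : (piTensor g).trace = ∏ i, (g i).trace := by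
  simp [piTensor, Matrix.trace, Fintype.prod_sum]

lemma tpow_mul {α : Type*} [Fintype α] (M N : Matrix α α ℂ) (t : ℕ) :
    tpow (M * N) t = tpow M t * tpow N t :=
  (piTensor_mul (fun _ : Fin t => M) fun _ => N).symm

lemma tpow_one {α : Type*} [Fintype α] [DecidableEq α] (t : ℕ) :
    tpow (1 : Matrix α α ℂ) t = 1 :=
  piTensor_one

lemma tpow_smul {α : Type*} [Fintype α] (c : ℂ) (M : Matrix α α ℂ) (t : ℕ) :
    tpow (c • M) t = c ^ t • tpow M t := by
  ext x y
  simp [tpow, Finset.prod_mul_distrib]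

lemma trace_tpow {α : Type*} [Fintype α] (M : Matrix α α ℂ) (t : ℕ) :
    (tpow M t).trace = M.trace ^ t := by
  rw [show tpow M t = piTensor (fun _ : Fin t => M) from rfl, trace_piTensor]
  simp

lemma embedGate_eq (n : ℕ) (G : Matrix (ZMod 2) (ZMod 2) ℂ) (i : Fin n) :
    embedGate n G i = piTensor fun k => if k = i then G else 1 := by
  ext x y
  simp only [embedGate, piTensor, Matrix.of_apply]
  rw [← Finset.mul_prod_erase Finset.univ _ (Finset.mem_univ i)]
  congr 1
  · simp
  · refine Finset.prod_congr rfl fun k hk => ?_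
    simp [Finset.ne_of_mem_erase hk, Matrix.one_apply]

lemma embedGate_mul (n : ℕ) (G H : Matrix (ZMod 2) (ZMod 2) ℂ) (i : Fin n) :
    embedGate n (G * H) i = embedGate n G i * embedGate n H i := by
  simp only [embedGate_eq, piTensor_mul]
  congr 1
  ext1 k
  split_ifs <;> simp

lemma embedGate_smul (n : ℕ) (c : ℂ) (G : Matrix (ZMod 2) (ZMod 2) ℂ) (i : Fin n) :
    embedGate n (c • G) i = c • embedGate n G i := by
  ext x y
  simp [embedGate, mul_assoc]

lemma embedGate_mem_unitaryGroup (n : ℕ) {G : Matrix (ZMod 2) (ZMod 2) ℂ}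
    (hG : G * Gᴴ = 1) (i : Fin n) :
    embedGate n G i ∈ Matrix.unitaryGroup (Fin n → ZMod 2) ℂ := by
  rw [Matrix.mem_unitaryGroup_iff, Matrix.star_eq_conjTranspose, embedGate_eq,
    piTensor_conjTranspose, piTensor_mul, ← piTensor_one]
  congr 1
  ext1 k
  split_ifs <;> simp [hG]

lemma zmod_two_eq_zero_or_one (b : ZMod 2) : b = 0 ∨ b = 1 := by
  revert b; decide

lemma sum_zmod_two {M : Type*} [AddCommMonoid M] (f : ZMod 2 → M) : ∑ b, f b = f 0 + f 1 :=
  Fin.sum_univ_two f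

lemma hGate_mul_conjTranspose : hGate * hGateᴴ = 1 := by
  ext x y
  rcases zmod_two_eq_zero_or_one x with rfl | rfl <;>
    rcases zmod_two_eq_zero_or_one y with rfl | rfl <;>
    simp [hGate, Matrix.mul_apply, sum_zmod_two, Complex.ext_iff, map_ofNat (starRingEnd ℂ) 2] <;>
    norm_num

lemma sGate_mul_conjTranspose : sGate * sGateᴴ = 1 := by
  ext x y
  rcases zmod_two_eq_zero_or_one x with rfl | rfl <;>
    rcases zmod_two_eq_zero_or_one y with rfl | rfl <;>
    simp [sGate, Matrix.mul_apply]

/-- The map on labels induced by the CNOT gate. -/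
def cnotMap (n : ℕ) (i j : Fin n) : (Fin n → ZMod 2) → Fin n → ZMod 2 :=
  fun y => Function.update y j (y i + y j)

lemma cnotGate_eq {n : ℕ} {i j : Fin n} (hij : i ≠ j) (x y : Fin n → ZMod 2) :
    cnotGate n i j x y = if x = cnotMap n i j y then 1 else 0 := by
  simp only [cnotGate, Matrix.of_apply, cnotMap]
  congr 1
  simp only [eq_iff_iff, funext_iff]
  constructor
  · rintro ⟨h1, h2, h3⟩ k
    by_cases hk : k = j
    · subst hk; simpa using h2
    · by_cases hk' : k = i
      · subst hk'; simpa [hk] using h1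
      · simpa [hk] using h3 k hk' hk
  · intro h
    refine ⟨by simpa [hij] using h i, by simpa using h j, fun k _ hk => by simpa [hk] using h k⟩

lemma cnotMap_involutive {n : ℕ} {i j : Fin n} (hij : i ≠ j) :
    Function.Involutive (cnotMap n i j) := by
  intro x
  ext k
  by_cases hk : k = j
  · subst hk
    simp [cnotMap, hij, ← add_assoc, CharTwo.add_self_eq_zero]
  · simp [cnotMap, hk]

lemma cnotGate_mem_unitaryGroup {n : ℕ} {i j : Fin n} (hij : i ≠ j) :
    cnotGate n i j ∈ Matrix.unitaryGroup (Fin n → ZMod 2) ℂ := by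
  rw [Matrix.mem_unitaryGroup_iff, Matrix.star_eq_conjTranspose]
  ext x y
  simp only [Matrix.mul_apply, Matrix.conjTranspose_apply, cnotGate_eq hij, Matrix.one_apply]
  rw [Finset.sum_eq_single (cnotMap n i j x)]
  · simp [cnotMap_involutive hij x, eq_comm]
  · intro z _ hz
    rw [if_neg, zero_mul]
    rintro rfl
    exact hz (cnotMap_involutive hij z).symm
  · simp

lemma mem_unitaryGroup_of_mem_cliffordGens {n : ℕ}
    {G : Matrix (Fin n → ZMod 2) (Fin n → ZMod 2) ℂ} (hG : G ∈ cliffordGens n) :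
    G ∈ Matrix.unitaryGroup (Fin n → ZMod 2) ℂ := by
  simp only [cliffordGens, Set.mem_union, Set.mem_iUnion, Set.mem_singleton_iff] at hG
  rcases hG with (⟨i, rfl⟩ | ⟨i, rfl⟩) | ⟨i, j, hij, rfl⟩
  · exact embedGate_mem_unitaryGroup n hGate_mul_conjTranspose i
  · exact embedGate_mem_unitaryGroup n sGate_mul_conjTranspose i
  · exact cnotGate_mem_unitaryGroup hij

lemma permOp_mul_tpow {α : Type*} [Fintype α] [DecidableEq α] {t : ℕ} (σ : Equiv.Perm (Fin t))
    (M : Matrix α α ℂ) : permOp α σ * tpow M t = tpow M t * permOp α σ := by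
  ext x y
  simp only [Matrix.mul_apply, permOp, tpow, Matrix.of_apply]
  rw [Finset.sum_eq_single (fun k => x (σ k)), Finset.sum_eq_single (fun k => y (σ⁻¹ k))]
  · simp only [if_true, one_mul]
    rw [if_pos (by ext k; simp), mul_one, ← Equiv.prod_comp σ (fun k => M (x k) (y (σ⁻¹ k)))]
    simp
  · intro z _ hz
    rw [if_neg, mul_zero]
    rintro rfl
    exact hz (by ext k; simp)
  · simp
  · intro z _ hz
    rw [if_neg (Ne.symm hz), zero_mul]
  · simp

lemma symProj_mul_tpow {α : Type*} [Fintype α] [DecidableEq α] (t : ℕ) (M : Matrix α α ℂ) :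
    symProj α t * tpow M t = tpow M t * symProj α t := by
  simp only [symProj, Matrix.smul_mul, Matrix.mul_smul, Finset.sum_mul, Finset.mul_sum,
    permOp_mul_tpow]

lemma symProj_comp_perm {α : Type*} [DecidableEq α] {t : ℕ} (σ : Equiv.Perm (Fin t))
    (x y : Fin t → α) : symProj α t x (y ∘ σ) = symProj α t x y := by
  simp only [symProj, Matrix.smul_apply, Matrix.sum_apply, permOp, Matrix.of_apply]
  congr 1
  rw [← Equiv.sum_comp (Equiv.mulRight σ)]
  refine Finset.sum_congr rfl fun τ _ => ?_
  congr 1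
  simp only [eq_iff_iff, funext_iff, Function.comp_apply, Equiv.coe_mulRight,
    Equiv.Perm.mul_apply]
  exact ⟨fun h k => by simpa using h (σ⁻¹ k), fun h k => h _⟩

/-- Twice the entries of the single-qubit projector onto the stabilizer code `V_{1,4}`. -/
def codeCount (c e : Fin 4 → ZMod 2) : ℕ :=
  if ∑ k, c k = 0 then (if c = e then 1 else 0) + (if c = e + 1 then 1 else 0) else 0

/-- The sign `(-1)^b`. -/
def bitSign (b : ZMod 2) : ℤ := if b = 0 then 1 else -1

lemma bitSign_add (a b : ZMod 2) : bitSign (a + b) = bitSign a * bitSign b := by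
  revert a b; decide

lemma bitSign_sum {ι : Type*} (s : Finset ι) (f : ι → ZMod 2) :
    bitSign (∑ i ∈ s, f i) = ∏ i ∈ s, bitSign (f i) := by
  classical
  induction s using Finset.induction_on with
  | empty => simp [bitSign]
  | insert a s ha ih => rw [Finset.sum_insert ha, Finset.prod_insert ha, bitSign_add, ih]

lemma sum_prod_pauli (c e : Fin 4 → ZMod 2) :
    ∑ a, ∏ k, pauli a (c k) (e k) = 2 * (codeCount c e : ℂ) := by
  have hI : ∀ x y, pauli (0, 0) x y = if x = y then (1 : ℂ) else 0 := by
    intro x y; simp [pauli]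
  have hX : ∀ x y, pauli (0, 1) x y = if x = y + 1 then (1 : ℂ) else 0 := by
    intro x y; simp [pauli]
  have hZ : ∀ x y, pauli (1, 0) x y = if x = y then (bitSign x : ℂ) else 0 := by
    intro x y; simp [pauli, bitSign]
  have hY : ∀ x y, pauli (1, 1) x y =
      if x = y + 1 then -Complex.I * (bitSign x : ℂ) else 0 := by
    intro x y; simp [pauli, bitSign]
  have hI4 : (-Complex.I) ^ 4 = 1 := by
    rw [Even.neg_pow (by decide), Complex.I_pow_four]
  have hs : ∏ k, (bitSign (c k) : ℂ) = ((bitSign (∑ k, c k) : ℤ) : ℂ) := by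
    rw [bitSign_sum]; push_cast; rfl
  have h1 : (∀ i, c i = e i) ↔ c = e := funext_iff.symm
  have h2 : (∀ i, c i = e i + 1) ↔ c = e + 1 := by simp [funext_iff]
  rw [Fintype.sum_prod_type]
  simp only [sum_zmod_two, hI, hX, hZ, hY, Finset.prod_ite_zero, Finset.mem_univ, true_imp_iff,
    Finset.prod_mul_distrib, Finset.prod_const, Finset.card_univ, Fintype.card_fin, hI4, hs, h1,
    h2, codeCount]
  rcases zmod_two_eq_zero_or_one (∑ k, c k) with h | h
  · simp only [h, bitSign]
    split_ifs <;> norm_num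
  · simp only [h, bitSign]
    split_ifs <;> norm_num at *

lemma stabProj_apply (n : ℕ) (x y : Fin 4 → Fin n → ZMod 2) :
    stabProj n 4 x y =
      ((2 : ℂ) ^ n)⁻¹ * ∏ i, (codeCount (fun k => x k i) (fun k => y k i) : ℂ) := by
  have h : ∀ a : Fin n → ZMod 2 × ZMod 2, tpow (PauliW a) 4 x y =
      ∏ i, ∏ k, pauli (a i) (x k i) (y k i) := by
    intro a
    simp only [tpow, PauliW, Matrix.of_apply]
    exact Finset.prod_comm
  simp only [stabProj, Matrix.smul_apply, Matrix.sum_apply, h, smul_eq_mul]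
  rw [← Fintype.prod_sum (fun i (b : ZMod 2 × ZMod 2) => ∏ k, pauli b (x k i) (y k i))]
  simp only [sum_prod_pauli, Finset.prod_mul_distrib, Finset.prod_const, Finset.card_univ,
    Fintype.card_fin]
  rw [two_mul n, pow_add]
  field_simp

lemma tpow_perm_apply {α : Type*} [Fintype α] [DecidableEq α] (T : Equiv.Perm α)
    {G : Matrix α α ℂ} (hG : ∀ x y, G x y = if x = T y then 1 else 0) (t : ℕ)
    (x y : Fin t → α) : tpow G t x y = if x = T ∘ y then 1 else 0 := by
  simp [tpow, hG, Finset.prod_ite_zero, funext_iff]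

lemma commute_tpow_perm_iff {α : Type*} [Fintype α] [DecidableEq α] (T : Equiv.Perm α)
    {G : Matrix α α ℂ} (hG : ∀ x y, G x y = if x = T y then 1 else 0) {t : ℕ}
    (M : Matrix (Fin t → α) (Fin t → α) ℂ) :
    Commute (tpow G t) M ↔ ∀ x y, M (T ∘ x) (T ∘ y) = M x y := by
  have h1 : ∀ x y, (tpow G t * M) (T ∘ x) y = M x y := by
    intro x y
    simp only [Matrix.mul_apply, tpow_perm_apply T hG]
    rw [Finset.sum_eq_single x]
    · simp
    · intro z _ hz
      rw [if_neg, zero_mul]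
      exact fun h => hz (T.injective.comp_left h).symm
    · simp
  have h2 : ∀ x y, (M * tpow G t) x y = M x (T ∘ y) := by
    intro x y
    simp only [Matrix.mul_apply, tpow_perm_apply T hG]
    simp
  constructor
  · intro h x y
    rw [← h1 x y, h.eq, h2]
  · intro h
    ext x y
    have hx : x = T ∘ (T.symm ∘ x) := by ext; simp
    rw [h2, hx, h1, h]

/-- The CNOT label map as a permutation. -/
def cnotPerm {n : ℕ} {i j : Fin n} (hij : i ≠ j) : Equiv.Perm (Fin n → ZMod 2) :=
  (cnotMap_involutive hij).toPerm

lemma commute_cnotGate_iff {n : ℕ} {i j : Fin n} (hij : i ≠ j) {t : ℕ}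
    (M : Matrix (Fin t → Fin n → ZMod 2) (Fin t → Fin n → ZMod 2) ℂ) :
    Commute (tpow (cnotGate n i j) t) M ↔
      ∀ x y, M (cnotMap n i j ∘ x) (cnotMap n i j ∘ y) = M x y :=
  commute_tpow_perm_iff (cnotPerm hij) (fun x y => cnotGate_eq hij x y) M

lemma codeCount_mul_add (c e c' e' : Fin 4 → ZMod 2) :
    codeCount c e * codeCount (c + c') (e + e') = codeCount c e * codeCount c' e' := by
  by_cases hc : ∑ k, c k = 0
  swap
  · simp [codeCount, hc]
  by_cases h1 : c = e
  · subst h1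
    congr 1
    simp [codeCount, Finset.sum_add_distrib, hc, add_assoc]
  by_cases h2 : c = e + 1
  · subst h2
    congr 1
    have h3 : e + 1 + c' = e + e' ↔ c' = e' + 1 := by
      rw [add_assoc, add_right_inj, add_comm, eq_comm]
      constructor
      · rintro rfl; ext; simp [add_assoc, CharTwo.add_self_eq_zero]
      · rintro rfl; ext; simp [add_assoc, CharTwo.add_self_eq_zero]
    have h4 : e + 1 + c' = e + e' + 1 ↔ c' = e' := by
      rw [add_right_comm, add_left_inj, add_right_inj]
    have h5 : (∑ k, ((e + 1 + c') k)) = ∑ k, c' k := by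
      rw [← zero_add (∑ k, c' k), ← hc, ← Finset.sum_add_distrib]; rfl
    simp only [codeCount, h3, h4, h5]
    rw [add_comm (ite _ _ _)]
  · simp [codeCount, h1, h2]

lemma stabProj_cnotMap {n : ℕ} {i j : Fin n} (hij : i ≠ j) (x y : Fin 4 → Fin n → ZMod 2) :
    stabProj n 4 (cnotMap n i j ∘ x) (cnotMap n i j ∘ y) = stabProj n 4 x y := by
  rw [stabProj_apply, stabProj_apply]
  congr 1
  norm_cast
  have hi : i ∈ Finset.univ.erase j := by simp [hij]
  rw [← Finset.mul_prod_erase _ _ (Finset.mem_univ j), ← Finset.mul_prod_erase _ _ hi,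
    ← Finset.mul_prod_erase _ _ (Finset.mem_univ j), ← Finset.mul_prod_erase _ _ hi]
  rw [← mul_assoc, ← mul_assoc]
  congr 1
  · simp only [Function.comp_apply, cnotMap, Function.update_self, Function.update_of_ne hij]
    exact (mul_comm _ _).trans ((codeCount_mul_add _ _ _ _).trans (mul_comm _ _))
  · refine Finset.prod_congr rfl fun k hk => ?_
    have hkj : k ≠ j := by simp at hk; exact hk.2
    simp [cnotMap, hkj]

lemma commute_embedGate_stabProj {n : ℕ} {G : Matrix (ZMod 2) (ZMod 2) ℂ}
    (π : Equiv.Perm (ZMod 2 × ZMod 2)) (ε : ZMod 2 × ZMod 2 → ℂ) (hε : ∀ a, ε a ^ 4 = 1)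
    (hG : ∀ a, G * pauli a = ε a • (pauli (π a) * G)) (i : Fin n) :
    Commute (tpow (embedGate n G i) 4) (stabProj n 4) := by
  let τ : Equiv.Perm (Fin n → ZMod 2 × ZMod 2) :=
    Equiv.piCongrRight fun k => if k = i then π else 1
  have hW : ∀ a : Fin n → ZMod 2 × ZMod 2,
      embedGate n G i * PauliW a = ε (a i) • (PauliW (τ a) * embedGate n G i) := by
    intro a
    have hP : ∀ b : Fin n → ZMod 2 × ZMod 2, PauliW b = piTensor fun k => pauli (b k) :=
      fun _ => rfl
    rw [embedGate_eq, hP, hP, piTensor_mul, piTensor_mul]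
    ext x y
    simp only [piTensor, Matrix.smul_apply, Matrix.of_apply, smul_eq_mul]
    rw [← Finset.mul_prod_erase _ _ (Finset.mem_univ i),
      ← Finset.mul_prod_erase _ _ (Finset.mem_univ i), ← mul_assoc]
    congr 1
    · simp [hG, τ]
    · refine Finset.prod_congr rfl fun k hk => ?_
      simp [Finset.ne_of_mem_erase hk, τ]
  have hW4 : ∀ a : Fin n → ZMod 2 × ZMod 2, tpow (embedGate n G i) 4 * tpow (PauliW a) 4 =
      tpow (PauliW (τ a)) 4 * tpow (embedGate n G i) 4 := by
    intro a
    rw [← tpow_mul, hW, tpow_smul, hε, one_smul, tpow_mul]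
  simp only [Commute, SemiconjBy, stabProj, Matrix.smul_mul, Matrix.mul_smul, Finset.sum_mul,
    Finset.mul_sum, hW4]
  rw [Equiv.sum_comp τ (fun a => tpow (PauliW a) 4 * tpow (embedGate n G i) 4)]

lemma commute_hGate_stabProj {n : ℕ} (i : Fin n) :
    Commute (tpow (embedGate n hGate i) 4) (stabProj n 4) := by
  refine commute_embedGate_stabProj (Equiv.prodComm _ _) (fun a => if a = (1, 1) then -1 else 1)
    (fun a => by split_ifs <;> norm_num) ?_ i
  rintro ⟨a, b⟩
  ext x y
  rcases zmod_two_eq_zero_or_one a with rfl | rfl <;>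
    rcases zmod_two_eq_zero_or_one b with rfl | rfl <;>
    rcases zmod_two_eq_zero_or_one x with rfl | rfl <;>
    rcases zmod_two_eq_zero_or_one y with rfl | rfl <;>
    simp [hGate, pauli, Matrix.mul_apply, sum_zmod_two, CharTwo.add_self_eq_zero] <;> ring

lemma commute_sGate_stabProj {n : ℕ} (i : Fin n) :
    Commute (tpow (embedGate n sGate i) 4) (stabProj n 4) := by
  have hinv : Function.Involutive fun a : ZMod 2 × ZMod 2 => (a.1 + a.2, a.2) := by
    unfold Function.Involutive; decide
  refine commute_embedGate_stabProj hinv.toPerm (fun a => if a = (0, 1) then -1 else 1)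
    (fun a => by split_ifs <;> norm_num) ?_ i
  rintro ⟨a, b⟩
  ext x y
  rcases zmod_two_eq_zero_or_one a with rfl | rfl <;>
    rcases zmod_two_eq_zero_or_one b with rfl | rfl <;>
    rcases zmod_two_eq_zero_or_one x with rfl | rfl <;>
    rcases zmod_two_eq_zero_or_one y with rfl | rfl <;>
    simp [sGate, pauli, Matrix.mul_apply, CharTwo.add_self_eq_zero]

lemma commute_cliffordGens_stabProj {n : ℕ} {G : Matrix (Fin n → ZMod 2) (Fin n → ZMod 2) ℂ}
    (hG : G ∈ cliffordGens n) : Commute (tpow G 4) (stabProj n 4) := by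
  simp only [cliffordGens, Set.mem_union, Set.mem_iUnion, Set.mem_singleton_iff] at hG
  rcases hG with (⟨i, rfl⟩ | ⟨i, rfl⟩) | ⟨i, j, hij, rfl⟩
  · exact commute_hGate_stabProj i
  · exact commute_sGate_stabProj i
  · exact (commute_cnotGate_iff hij _).2 (stabProj_cnotMap hij)

lemma codeCount_mul_sum (c e : Fin 4 → ZMod 2) :
    ∑ d, codeCount c d * codeCount d e = 2 * codeCount c e := by
  revert c e; decide +kernel

lemma sum_prod_columns {n : ℕ} (f : Fin n → (Fin 4 → ZMod 2) → ℂ) :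
    ∑ x : Fin 4 → Fin n → ZMod 2, ∏ i, f i (fun k => x k i) = ∏ i, ∑ c, f i c := by
  rw [Fintype.prod_sum]
  exact Equiv.sum_comp (Equiv.piComm fun (_ : Fin 4) (_ : Fin n) => ZMod 2)
    (fun x => ∏ i, f i (x i))

lemma stabProj_mul_self (n : ℕ) : stabProj n 4 * stabProj n 4 = stabProj n 4 := by
  ext x y
  simp only [Matrix.mul_apply, stabProj_apply]
  have h : ∀ z : Fin 4 → Fin n → ZMod 2,
      ((2 : ℂ) ^ n)⁻¹ * (∏ i, (codeCount (fun k => x k i) (fun k => z k i) : ℂ)) *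
        (((2 : ℂ) ^ n)⁻¹ * ∏ i, (codeCount (fun k => z k i) (fun k => y k i) : ℂ)) =
      ((2 : ℂ) ^ n)⁻¹ * ((2 : ℂ) ^ n)⁻¹ * ∏ i, ((codeCount (fun k => x k i) (fun k => z k i) *
        codeCount (fun k => z k i) (fun k => y k i) : ℕ) : ℂ) := by
    intro z
    push_cast
    rw [Finset.prod_mul_distrib]
    ring
  simp only [h, ← Finset.mul_sum]
  rw [sum_prod_columns fun i c => ((codeCount (fun k => x k i) c *
    codeCount c (fun k => y k i) : ℕ) : ℂ)]
  simp only [← Nat.cast_sum, codeCount_mul_sum]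
  push_cast
  rw [Finset.prod_mul_distrib]
  simp
  field_simp

lemma trace_mul_permOp {α : Type*} [Fintype α] [DecidableEq α] {t : ℕ}
    (σ : Equiv.Perm (Fin t)) (M : Matrix (Fin t → α) (Fin t → α) ℂ) :
    (M * permOp α σ).trace = ∑ y, M (y ∘ σ) y := by
  simp only [Matrix.trace, Matrix.diag, Matrix.mul_apply, permOp, Matrix.of_apply]
  rw [Finset.sum_comm]
  refine Finset.sum_congr rfl fun y _ => ?_
  rw [Finset.sum_eq_single (y ∘ σ)]
  · rw [if_pos (by rfl), mul_one]
  · intro z _ hz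
    rw [if_neg, mul_zero]
    intro h; exact hz h.symm
  · simp

/-- The trace of `U_σ` on the single-qubit code, times two. -/
def permCount (σ : Equiv.Perm (Fin 4)) : ℕ := ∑ c : Fin 4 → ZMod 2, codeCount (c ∘ σ) c

/-- The trace of `U_σ` on four bits. -/
def fixCount (σ : Equiv.Perm (Fin 4)) : ℕ :=
  ∑ c : Fin 4 → ZMod 2, if c ∘ σ = c then 1 else 0

lemma sum_permCount {f : ℕ → ℂ} :
    ∑ σ, f (permCount σ) = 4 * f 8 + 12 * f 4 + 8 * f 2 := by
  rw [Finset.sum_comp f permCount]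
  rw [show Finset.univ.image permCount = {8, 4, 2} by decide +kernel]
  rw [Finset.sum_insert (by decide), Finset.sum_insert (by decide), Finset.sum_singleton]
  rw [show (Finset.univ.filter fun σ => permCount σ = 8).card = 4 by decide +kernel,
    show (Finset.univ.filter fun σ => permCount σ = 4).card = 12 by decide +kernel,
    show (Finset.univ.filter fun σ => permCount σ = 2).card = 8 by decide +kernel]
  simp; ring

lemma sum_fixCount {f : ℕ → ℂ} :
    ∑ σ, f (fixCount σ) = f 16 + 6 * f 8 + 11 * f 4 + 6 * f 2 := by
  rw [Finset.sum_comp f fixCount]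
  rw [show Finset.univ.image fixCount = {16, 8, 4, 2} by decide +kernel]
  rw [Finset.sum_insert (by decide), Finset.sum_insert (by decide),
    Finset.sum_insert (by decide), Finset.sum_singleton]
  rw [show (Finset.univ.filter fun σ => fixCount σ = 16).card = 1 by decide +kernel,
    show (Finset.univ.filter fun σ => fixCount σ = 8).card = 6 by decide +kernel,
    show (Finset.univ.filter fun σ => fixCount σ = 4).card = 11 by decide +kernel,
    show (Finset.univ.filter fun σ => fixCount σ = 2).card = 6 by decide +kernel]
  simp; ring

lemma trace_stabProj_mul_symProj (n : ℕ) :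
    (stabProj n 4 * symProj (Fin n → ZMod 2) 4).trace =
      ((2 : ℂ) ^ n + 1) * ((2 : ℂ) ^ n + 2) / 6 := by
  have h : ∀ σ : Equiv.Perm (Fin 4), (stabProj n 4 * permOp (Fin n → ZMod 2) σ).trace =
      ((2 : ℂ) ^ n)⁻¹ * (permCount σ : ℂ) ^ n := by
    intro σ
    rw [trace_mul_permOp]
    simp only [stabProj_apply, ← Finset.mul_sum]
    congr 1
    refine (sum_prod_columns fun i c => (codeCount (c ∘ σ) c : ℂ)).trans ?_
    rw [Finset.prod_const, Finset.card_univ, Fintype.card_fin, permCount, Nat.cast_sum]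
  simp only [symProj, Matrix.mul_smul, Finset.mul_sum, Matrix.trace_smul, Matrix.trace_sum, h]
  rw [← Finset.mul_sum, sum_permCount (f := fun m => (m : ℂ) ^ n)]
  have h8 : ((8 : ℕ) : ℂ) ^ n = ((2 : ℂ) ^ n) ^ 3 := by rw [← pow_mul, mul_comm, pow_mul]; norm_num
  have h4 : ((4 : ℕ) : ℂ) ^ n = ((2 : ℂ) ^ n) ^ 2 := by rw [← pow_mul, mul_comm, pow_mul]; norm_num
  have h0 : (2 : ℂ) ^ n ≠ 0 := pow_ne_zero _ two_ne_zero
  rw [h8, h4]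
  simp [Nat.factorial]
  field_simp
  ring

lemma trace_symProj_s5 (n : ℕ) :
    (symProj (Fin n → ZMod 2) 4).trace =
      (2 : ℂ) ^ n * ((2 : ℂ) ^ n + 1) * ((2 : ℂ) ^ n + 2) * ((2 : ℂ) ^ n + 3) / 24 := by
  have h : ∀ σ : Equiv.Perm (Fin 4), (permOp (Fin n → ZMod 2) σ).trace =
      (fixCount σ : ℂ) ^ n := by
    intro σ
    rw [← one_mul (permOp _ σ), trace_mul_permOp]
    have h1 : ∀ y : Fin 4 → Fin n → ZMod 2,
        (1 : Matrix (Fin 4 → Fin n → ZMod 2) (Fin 4 → Fin n → ZMod 2) ℂ) (y ∘ σ) y =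
        ∏ i, if (fun k => y k i) ∘ σ = (fun k => y k i) then (1 : ℂ) else 0 := by
      intro y
      simp only [Matrix.one_apply, Finset.prod_ite_zero, funext_iff, Function.comp_apply,
        Finset.mem_univ, true_imp_iff, Finset.prod_const_one]
      congr 1
      exact propext forall_comm
    simp only [h1]
    rw [sum_prod_columns fun i c => if c ∘ σ = c then (1 : ℂ) else 0]
    simp [fixCount]
  simp only [symProj, Matrix.trace_smul, Matrix.trace_sum, h]
  rw [sum_fixCount (f := fun m => (m : ℂ) ^ n)]
  have h16 : ((16 : ℕ) : ℂ) ^ n = ((2 : ℂ) ^ n) ^ 4 := by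
    rw [← pow_mul, mul_comm, pow_mul]; norm_num
  have h8 : ((8 : ℕ) : ℂ) ^ n = ((2 : ℂ) ^ n) ^ 3 := by rw [← pow_mul, mul_comm, pow_mul]; norm_num
  have h4 : ((4 : ℕ) : ℂ) ^ n = ((2 : ℂ) ^ n) ^ 2 := by rw [← pow_mul, mul_comm, pow_mul]; norm_num
  rw [h16, h8, h4]
  simp [Nat.factorial]
  ring

lemma cnotMap_eq_transvection_mulVec {n : ℕ} (i j : Fin n) (y : Fin n → ZMod 2) :
    Matrix.transvection i j (1 : ZMod 2) *ᵥ y = cnotMap n j i y := by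
  ext k
  simp only [Matrix.transvection, Matrix.add_mulVec, Matrix.one_mulVec, Pi.add_apply,
    Matrix.single_mulVec, cnotMap, Function.update_apply]
  split_ifs with h
  · subst h; simp [add_comm]
  · simp

lemma apply_mulVec_mulVec_of_commute {n : ℕ}
    {B : Matrix (Fin 4 → Fin n → ZMod 2) (Fin 4 → Fin n → ZMod 2) ℂ}
    (hB : ∀ G ∈ cliffordGens n, Commute (tpow G 4) B)
    (L : Matrix (Fin n) (Fin n) (ZMod 2)) (hL : L.det ≠ 0) :
    ∀ x y, B (fun k => L *ᵥ x k) (fun k => L *ᵥ y k) = B x y := by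
  refine Matrix.diagonal_transvection_induction_of_det_ne_zero
    (fun L => ∀ x y, B (fun k => L *ᵥ x k) (fun k => L *ᵥ y k) = B x y) L hL ?_ ?_ ?_
  · intro D hD
    have h1 : D = 1 := by
      ext i
      rw [Matrix.det_diagonal, Finset.prod_ne_zero_iff] at hD
      exact (zmod_two_eq_zero_or_one (D i)).resolve_left (hD i (Finset.mem_univ i))
    subst h1
    simp
  · rintro ⟨i, j, hij, c⟩ x y
    rcases zmod_two_eq_zero_or_one c with rfl | rfl
    · simp
    · simp only [Matrix.TransvectionStruct.toMatrix_mk, cnotMap_eq_transvection_mulVec]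
      refine (commute_cnotGate_iff hij.symm B).1 (hB _ ?_) x y
      simp only [cliffordGens, Set.mem_union, Set.mem_iUnion, Set.mem_singleton_iff]
      exact Or.inr ⟨j, i, hij.symm, rfl⟩
  · intro L₁ L₂ _ _ h₁ h₂ x y
    simp only [← Matrix.mulVec_mulVec]
    rw [h₁, h₂]

lemma hGate_mul_sGate_sq_mul_hGate :
    hGate * sGate * sGate * hGate = Complex.I • pauli (0, 1) := by
  ext x y
  rcases zmod_two_eq_zero_or_one x with rfl | rfl <;>
    rcases zmod_two_eq_zero_or_one y with rfl | rfl <;>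
    simp [hGate, sGate, pauli, Matrix.mul_apply, sum_zmod_two, CharTwo.add_self_eq_zero,
      Complex.ext_iff] <;> norm_num

lemma embedGate_pauli_X (n : ℕ) (i : Fin n) (x y : Fin n → ZMod 2) :
    embedGate n (pauli (0, 1)) i x y =
      if x = Equiv.addRight (Pi.single i 1) y then 1 else 0 := by
  have h : ∀ k, (if k = i then pauli (0, 1) else 1) (x k) (y k) =
      if x k = y k + (Pi.single i 1 : Fin n → ZMod 2) k then (1 : ℂ) else 0 := by
    intro k
    by_cases hk : k = i
    · subst hk; simp [pauli]
    · simp [hk, Matrix.one_apply]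
  simp [embedGate_eq, piTensor, h, Finset.prod_ite_zero, funext_iff]

lemma apply_add_add_of_commute {n : ℕ}
    {B : Matrix (Fin 4 → Fin n → ZMod 2) (Fin 4 → Fin n → ZMod 2) ℂ}
    (hB : ∀ G ∈ cliffordGens n, Commute (tpow G 4) B) (u : Fin n → ZMod 2)
    (x y : Fin 4 → Fin n → ZMod 2) :
    B (fun k => x k + u) (fun k => y k + u) = B x y := by
  have h1 : ∀ i, Commute (tpow (embedGate n (pauli (0, 1)) i) 4) B := by
    intro i
    have hh : Commute (tpow (embedGate n hGate i) 4) B := hB _ (by simp [cliffordGens])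
    have hs : Commute (tpow (embedGate n sGate i) 4) B := hB _ (by simp [cliffordGens])
    have h := ((hh.mul_left hs).mul_left hs).mul_left hh
    rwa [← tpow_mul, ← tpow_mul, ← tpow_mul, ← embedGate_mul, ← embedGate_mul, ← embedGate_mul,
      hGate_mul_sGate_sq_mul_hGate, embedGate_smul, tpow_smul, Complex.I_pow_four,
      one_smul] at h
  have h2 : ∀ i x y, B (fun k => x k + Pi.single i 1) (fun k => y k + Pi.single i 1) = B x y :=
    fun i x y => (commute_tpow_perm_iff _ (embedGate_pauli_X n i) B).1 (h1 i) x y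
  rw [← Finset.univ_sum_single u]
  generalize (Finset.univ : Finset (Fin n)) = s
  induction s using Finset.induction_on with
  | empty => simp
  | insert a s ha ih =>
    rw [Finset.sum_insert ha, ← ih, add_comm]
    rcases zmod_two_eq_zero_or_one (u a) with h | h
    · simp [h]
    · simp only [h, ← add_assoc]
      exact h2 a _ _

/-- The Hamming weight of the bits `l ⬝ᵥ x k`. -/
def dotWeight {n : ℕ} (l : Fin n → ZMod 2) (x : Fin 4 → Fin n → ZMod 2) : ℕ :=
  ∑ k, (l ⬝ᵥ x k).val

lemma embedGate_sGate (n : ℕ) (i : Fin n) :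
    embedGate n sGate i = Matrix.diagonal fun x => (-Complex.I) ^ (x i).val := by
  ext x y
  rw [embedGate, Matrix.of_apply, Matrix.diagonal_apply]
  split_ifs with h
  · subst h
    have h1 : (1 : ZMod 2).val = 1 := rfl
    rcases zmod_two_eq_zero_or_one (x i) with h | h <;> simp [sGate, h, h1]
  · obtain ⟨j, hj⟩ := Function.ne_iff.1 h
    by_cases hji : j = i
    · subst hji; simp [sGate, hj]
    · rw [Finset.prod_eq_zero (i := j) (by simp [hji]) (by simp [hj]), mul_zero]

lemma sum_val_modEq_of_apply_ne_zero {n : ℕ}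
    {B : Matrix (Fin 4 → Fin n → ZMod 2) (Fin 4 → Fin n → ZMod 2) ℂ}
    (hB : ∀ G ∈ cliffordGens n, Commute (tpow G 4) B) {x y : Fin 4 → Fin n → ZMod 2}
    (hxy : B x y ≠ 0) (i : Fin n) :
    ∑ k, (x k i).val ≡ ∑ k, (y k i).val [MOD 4] := by
  have hd : tpow (embedGate n sGate i) 4 =
      Matrix.diagonal fun x => (-Complex.I) ^ ∑ k, (x k i).val := by
    ext x y
    simp only [embedGate_sGate, tpow, Matrix.of_apply, Matrix.diagonal_apply,
      Finset.prod_ite_zero, Finset.prod_pow_eq_pow_sum, funext_iff (f := x), Finset.mem_univ,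
      true_imp_iff]
  have h : Commute (tpow (embedGate n sGate i) 4) B := hB _ (by simp [cliffordGens])
  have h' := congrFun (congrFun h.eq x) y
  rw [hd, Matrix.diagonal_mul, Matrix.mul_diagonal, mul_comm] at h'
  have ho : orderOf (-Complex.I) = 2 ^ (1 + 1) := by
    apply orderOf_eq_prime_pow
    · simp only [pow_one, neg_sq, Complex.I_sq]
      norm_num
    · rw [Even.neg_pow (by decide)]
      exact Complex.I_pow_four
  have hfin : IsOfFinOrder (-Complex.I) := orderOf_pos_iff.1 (by rw [ho]; norm_num)
  have := hfin.pow_eq_pow_iff_modEq.1 (mul_left_cancel₀ hxy h')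
  rwa [ho] at this

lemma exists_det_ne_zero_mulVec_eq {n : ℕ} {v w : Fin n → ZMod 2} (hv : v ≠ 0) (hw : w ≠ 0) :
    ∃ L : Matrix (Fin n) (Fin n) (ZMod 2), L.det ≠ 0 ∧ L *ᵥ v = w := by
  obtain ⟨i, hi⟩ := Function.ne_iff.1 hv
  obtain ⟨j, hj⟩ := Function.ne_iff.1 hw
  have hi' := (zmod_two_eq_zero_or_one (v i)).resolve_left hi
  have hj' := (zmod_two_eq_zero_or_one (w j)).resolve_left hj
  obtain ⟨p, hpv, hpw⟩ : ∃ p : Fin n → ZMod 2, p ⬝ᵥ v = 1 ∧ p ⬝ᵥ w = 1 := by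
    rcases zmod_two_eq_zero_or_one (w i) with h1 | h1
    · rcases zmod_two_eq_zero_or_one (v j) with h2 | h2
      · exact ⟨Pi.single i 1 + Pi.single j 1, by simp [add_dotProduct, hi', h2],
          by simp [add_dotProduct, h1, hj']⟩
      · exact ⟨Pi.single j 1, by simp [h2], by simp [hj']⟩
    · exact ⟨Pi.single i 1, by simp [hi'], by simp [h1]⟩
  have hself : ∀ z : Fin n → ZMod 2, z + z = 0 := fun z => by
    ext; simp [CharTwo.add_self_eq_zero]
  have hmul : ∀ z, (1 + Matrix.vecMulVec (v + w) p) *ᵥ z = z + (p ⬝ᵥ z) • (v + w) := by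
    intro z
    rw [Matrix.add_mulVec, Matrix.one_mulVec, Matrix.vecMulVec_mulVec]
    simp
  refine ⟨1 + Matrix.vecMulVec (v + w) p, ?_, ?_⟩
  · have hsq : (1 + Matrix.vecMulVec (v + w) p) * (1 + Matrix.vecMulVec (v + w) p) = 1 := by
      refine Matrix.ext_of_mulVec_single fun i => ?_
      rw [← Matrix.mulVec_mulVec, hmul, hmul, Matrix.one_mulVec]
      rw [dotProduct_add, dotProduct_smul, dotProduct_add, hpv, hpw, CharTwo.add_self_eq_zero]
      rw [smul_zero, add_zero, add_assoc, hself, add_zero]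
    intro h0
    have := congrArg Matrix.det hsq
    rw [Matrix.det_mul, h0, zero_mul, Matrix.det_one] at this
    exact zero_ne_one this
  · rw [hmul, hpv, one_smul, ← add_assoc, hself, zero_add]

lemma dotWeight_modEq_of_apply_ne_zero {n : ℕ}
    {B : Matrix (Fin 4 → Fin n → ZMod 2) (Fin 4 → Fin n → ZMod 2) ℂ}
    (hB : ∀ G ∈ cliffordGens n, Commute (tpow G 4) B) {x y : Fin 4 → Fin n → ZMod 2}
    (hxy : B x y ≠ 0) (l : Fin n → ZMod 2) : dotWeight l x ≡ dotWeight l y [MOD 4] := by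
  by_cases hl : l = 0
  · subst hl; simp [dotWeight]; rfl
  obtain ⟨i, hi⟩ := Function.ne_iff.1 hl
  have hs : (Pi.single i 1 : Fin n → ZMod 2) ≠ 0 := by simp
  obtain ⟨L, hL, hLl⟩ := exists_det_ne_zero_mulVec_eq hs hl
  have hrow : ∀ z, (Lᵀ *ᵥ z) i = l ⬝ᵥ z := by
    intro z
    rw [← hLl]
    simp [Matrix.mulVec]
    rfl
  have h := apply_mulVec_mulVec_of_commute hB Lᵀ (by rwa [Matrix.det_transpose]) x y
  have := sum_val_modEq_of_apply_ne_zero hB (h.symm ▸ hxy) i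
  simpa only [hrow, dotWeight] using this

lemma sum_bitSign_dotProduct {n : ℕ} (w : Fin n → ZMod 2) :
    ∑ l : Fin n → ZMod 2, bitSign (l ⬝ᵥ w) = if w = 0 then 2 ^ n else 0 := by
  simp only [dotProduct, bitSign_sum]
  rw [← Fintype.prod_sum (fun i (b : ZMod 2) => bitSign (b * w i))]
  have h : ∀ c : ZMod 2, ∑ b, bitSign (b * c) = if c = 0 then 2 else 0 := by decide
  simp only [h, Finset.prod_ite_zero, funext_iff]
  simp

lemma exists_perm_of_dotWeight_eq {n : ℕ} {x y : Fin 4 → Fin n → ZMod 2}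
    (h : ∀ l, dotWeight l x = dotWeight l y) : ∃ σ : Equiv.Perm (Fin 4), y = x ∘ σ := by
  have hval : ∀ b : ZMod 2, bitSign b = 1 - 2 * (b.val : ℤ) := by decide
  have hsum : ∀ (z : Fin 4 → Fin n → ZMod 2) l,
      ∑ k, bitSign (l ⬝ᵥ z k) = 4 - 2 * (dotWeight l z : ℤ) := by
    intro z l
    simp [hval, dotWeight, Finset.sum_sub_distrib, Finset.mul_sum]
  have hcount : ∀ (z : Fin 4 → Fin n → ZMod 2) u,
      ∑ l, bitSign (l ⬝ᵥ u) * ∑ k, bitSign (l ⬝ᵥ z k) =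
        2 ^ n * (Fintype.card {k // z k = u} : ℤ) := by
    intro z u
    have hu : ∀ k, u + z k = 0 ↔ z k = u := fun k => by
      constructor
      · intro h
        have := congrArg (u + ·) h
        simpa [← add_assoc, funext_iff, CharTwo.add_self_eq_zero] using this
      · rintro rfl; ext; simp [CharTwo.add_self_eq_zero]
    simp only [Finset.mul_sum, ← bitSign_add, ← dotProduct_add]
    rw [Finset.sum_comm]
    simp only [sum_bitSign_dotProduct, hu, Fintype.card_subtype, Finset.sum_ite,
      Finset.sum_const]
    simp [mul_comm]
  have hcard : ∀ u, Fintype.card {k // y k = u} = Fintype.card {k // x k = u} := by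
    intro u
    have h1 := hcount x u
    have h2 := hcount y u
    simp only [hsum, h] at h1 h2
    have h3 := h2.symm.trans h1
    exact_mod_cast mul_left_cancel₀ (pow_ne_zero n two_ne_zero) h3
  let e : ∀ u, {k // y k = u} ≃ {k // x k = u} := fun u => Fintype.equivOfCardEq (hcard u)
  refine ⟨(Equiv.sigmaFiberEquiv y).symm.trans
    ((Equiv.sigmaCongrRight e).trans (Equiv.sigmaFiberEquiv x)), ?_⟩
  ext1 k
  exact (e (y k) ⟨k, rfl⟩).2.symm

/-- The entries of `z^{⊗4}`. -/
def tensorFour {α : Type*} (z : α → ℂ) : (Fin 4 → α) → ℂ := fun x => ∏ k, z (x k)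

lemma piTensor_mulVec {Q β : Type*} [Fintype Q] [DecidableEq Q] [Fintype β]
    (g : Q → Matrix β β ℂ) (v : Q → β → ℂ) :
    piTensor g *ᵥ (fun y => ∏ i, v i (y i)) = fun x => ∏ i, (g i *ᵥ v i) (x i) := by
  ext x
  simp only [Matrix.mulVec, dotProduct, piTensor, Matrix.of_apply, Fintype.prod_sum,
    Finset.prod_mul_distrib]

lemma tpow_mulVec_tensorFour {α : Type*} [Fintype α] (G : Matrix α α ℂ) (z : α → ℂ) :
    tpow G 4 *ᵥ tensorFour z = tensorFour (G *ᵥ z) :=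
  piTensor_mulVec (fun _ : Fin 4 => G) fun _ => z

lemma tensorFour_smul {α : Type*} (c : ℂ) (z : α → ℂ) :
    tensorFour (c • z) = c ^ 4 • tensorFour z := by
  ext x
  simp [tensorFour, Finset.prod_mul_distrib]

/-- The unnormalized product state with `|+⟩` at the qubits in `S` and `|0⟩` elsewhere; its
values count the preimages under the diagonal matrix with support `S`. -/
def plusState {n : ℕ} (S : Finset (Fin n)) : (Fin n → ZMod 2) → ℂ :=
  fun x => ∏ i, if i ∈ S then 1 else if x i = 0 then 2 else 0

lemma hGate_mulVec_plusState {n : ℕ} {S : Finset (Fin n)} {i : Fin n} (hi : i ∉ S) :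
    embedGate n hGate i *ᵥ plusState S = (1 + Complex.I) • plusState (insert i S) := by
  rw [embedGate_eq]
  refine (piTensor_mulVec _ fun j (b : ZMod 2) =>
    if j ∈ S then (1 : ℂ) else if b = 0 then 2 else 0).trans ?_
  ext x
  simp only [Pi.smul_apply, plusState, smul_eq_mul]
  rw [← Finset.mul_prod_erase _ _ (Finset.mem_univ i),
    ← Finset.mul_prod_erase _ _ (Finset.mem_univ i), ← mul_assoc]
  congr 1
  · simp [Matrix.mulVec, dotProduct, hi, hGate]
  · refine Finset.prod_congr rfl fun k hk => ?_
    have hk' := Finset.ne_of_mem_erase hk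
    simp [hk', Finset.mem_insert]

lemma mulVec_tensorFour_plusState {n : ℕ}
    {B : Matrix (Fin 4 → Fin n → ZMod 2) (Fin 4 → Fin n → ZMod 2) ℂ}
    (hB : ∀ G ∈ cliffordGens n, Commute (tpow G 4) B) (h0 : ∀ y, B y 0 = 0)
    (S : Finset (Fin n)) : B *ᵥ tensorFour (plusState S) = 0 := by
  induction S using Finset.induction_on with
  | empty =>
    ext y
    simp only [Matrix.mulVec, dotProduct, Pi.zero_apply]
    refine Finset.sum_eq_zero fun x _ => ?_
    by_cases hx : x = 0
    · rw [hx, h0, zero_mul]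
    · obtain ⟨k, hk⟩ := Function.ne_iff.1 hx
      obtain ⟨i, hi⟩ := Function.ne_iff.1 hk
      have h1 : plusState ∅ (x k) = 0 := Finset.prod_eq_zero (Finset.mem_univ i) (by simpa using hi)
      rw [tensorFour, Finset.prod_eq_zero (Finset.mem_univ k) h1, mul_zero]
  | insert i S hi ih =>
    have hh : Commute (tpow (embedGate n hGate i) 4) B := hB _ (by simp [cliffordGens])
    have h1 := congrArg (fun M => M *ᵥ tensorFour (plusState S)) hh.eq
    simp only [← Matrix.mulVec_mulVec, ih, Matrix.mulVec_zero, tpow_mulVec_tensorFour,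
      hGate_mulVec_plusState hi, tensorFour_smul, Matrix.mulVec_smul] at h1
    refine (smul_eq_zero.1 h1.symm).resolve_left (pow_ne_zero 4 ?_)
    simp [Complex.ext_iff]

lemma sum_ite_diagonal_mulVec_eq {n : ℕ} (D x : Fin n → ZMod 2) :
    (∑ u : Fin n → ZMod 2, if Matrix.diagonal D *ᵥ u = x then (1 : ℂ) else 0) =
      plusState (Finset.univ.filter fun i => D i ≠ 0) x := by
  have h : ∀ u : Fin n → ZMod 2, (if Matrix.diagonal D *ᵥ u = x then (1 : ℂ) else 0) =
      ∏ i, if D i * u i = x i then (1 : ℂ) else 0 := by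
    intro u
    simp [Finset.prod_ite_zero, funext_iff, Matrix.mulVec_diagonal]
  simp only [h]
  rw [← Fintype.prod_sum fun i (b : ZMod 2) => if D i * b = x i then (1 : ℂ) else 0]
  refine Finset.prod_congr rfl fun i _ => ?_
  rcases zmod_two_eq_zero_or_one (D i) with h | h <;>
    rcases zmod_two_eq_zero_or_one (x i) with h' | h' <;> simp [h, h']

lemma sum_apply_mulVec_eq_zero {n : ℕ}
    {B : Matrix (Fin 4 → Fin n → ZMod 2) (Fin 4 → Fin n → ZMod 2) ℂ}
    (hB : ∀ G ∈ cliffordGens n, Commute (tpow G 4) B) (h0 : ∀ y, B y 0 = 0)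
    (M : Matrix (Fin n) (Fin n) (ZMod 2)) (y : Fin 4 → Fin n → ZMod 2) :
    ∑ u : Fin 4 → Fin n → ZMod 2, B y (fun k => M *ᵥ u k) = 0 := by
  have hdiag : ∀ (D : Fin n → ZMod 2) y,
      ∑ u : Fin 4 → Fin n → ZMod 2, B y (fun k => Matrix.diagonal D *ᵥ u k) = 0 := by
    intro D y
    have h1 := congrFun (mulVec_tensorFour_plusState hB h0
      (Finset.univ.filter fun i => D i ≠ 0)) y
    simp only [Matrix.mulVec, dotProduct, tensorFour, Pi.zero_apply] at h1
    simp only [← sum_ite_diagonal_mulVec_eq, Fintype.prod_sum, Finset.mul_sum] at h1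
    rw [Finset.sum_comm] at h1
    rw [← h1]
    refine Finset.sum_congr rfl fun u _ => ?_
    rw [Finset.sum_eq_single (fun k => Matrix.diagonal D *ᵥ u k)]
    · simp
    · intro x _ hx
      obtain ⟨k, hk⟩ := Function.ne_iff.1 hx
      rw [Finset.prod_eq_zero (Finset.mem_univ k) (if_neg (Ne.symm hk)), mul_zero]
    · simp
  obtain ⟨L, L', D, rfl⟩ := Matrix.Pivot.exists_list_transvec_mul_diagonal_mul_list_transvec M
  set A := (L.map Matrix.TransvectionStruct.toMatrix).prod with hA
  set A' := (L'.map Matrix.TransvectionStruct.toMatrix).prod with hA'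
  have hdA : A.det = 1 := Matrix.TransvectionStruct.det_toMatrix_prod L
  have hdA' : A'.det = 1 := Matrix.TransvectionStruct.det_toMatrix_prod L'
  have hinv : A * A⁻¹ = 1 := Matrix.mul_nonsing_inv _ (by simp [hdA])
  have hu' : IsUnit A' := (Matrix.isUnit_iff_isUnit_det _).2 (by simp [hdA'])
  let e : (Fin 4 → Fin n → ZMod 2) ≃ (Fin 4 → Fin n → ZMod 2) :=
    Equiv.piCongrRight fun _ => Equiv.ofBijective (A' *ᵥ ·)
      ((Finite.injective_iff_bijective).1 (Matrix.mulVec_injective_of_isUnit hu'))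
  have hy : y = fun k => A *ᵥ (A⁻¹ *ᵥ y k) := by
    ext1 k
    rw [Matrix.mulVec_mulVec, hinv, Matrix.one_mulVec]
  rw [← hdiag D (fun k => A⁻¹ *ᵥ y k), 
    ← Equiv.sum_comp e fun u => B (fun k => A⁻¹ *ᵥ y k) fun k => Matrix.diagonal D *ᵥ u k]
  refine Finset.sum_congr rfl fun u _ => ?_
  rw [← apply_mulVec_mulVec_of_commute hB A (by rw [hdA]; exact one_ne_zero)
    (fun k => A⁻¹ *ᵥ y k), ← hy]
  simp only [← Matrix.mulVec_mulVec]
  rfl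

lemma dotWeight_le {n : ℕ} (l : Fin n → ZMod 2) (x : Fin 4 → Fin n → ZMod 2) :
    dotWeight l x ≤ 4 := by
  have : ∀ k ∈ (Finset.univ : Finset (Fin 4)), (l ⬝ᵥ x k).val ≤ 1 := fun k _ =>
    Nat.lt_succ_iff.1 (ZMod.val_lt _)
  simpa [dotWeight] using Finset.sum_le_card_nsmul _ _ _ this

lemma dotProduct_eq_of_dotWeight_eq {n : ℕ} {l : Fin n → ZMod 2}
    {x : Fin 4 → Fin n → ZMod 2} (h : dotWeight l x = 0 ∨ dotWeight l x = 4) (k j : Fin 4) :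
    l ⬝ᵥ x k = l ⬝ᵥ x j := by
  have key : ∀ c : Fin 4 → ZMod 2, (∑ k, (c k).val = 0 ∨ ∑ k, (c k).val = 4) →
      ∀ k j, c k = c j := by decide +kernel
  exact key (fun k => l ⬝ᵥ x k) h k j

/-- An operator commuting with the fourth tensor powers of the Clifford generators, symmetric
in its column index, is determined by its action on `|0⟩^{⊗4}`. -/
lemma eq_zero_of_apply_zero {n : ℕ}
    {B : Matrix (Fin 4 → Fin n → ZMod 2) (Fin 4 → Fin n → ZMod 2) ℂ}
    (hB : ∀ G ∈ cliffordGens n, Commute (tpow G 4) B)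
    (hsym : ∀ (σ : Equiv.Perm (Fin 4)) x y, B x (y ∘ σ) = B x y)
    (h0 : ∀ y, B y 0 = 0) : B = 0 := by
  ext y x
  by_contra hyx
  change ¬B y x = 0 at hyx
  let K : Submodule (ZMod 2) (Fin n → ZMod 2) :=
    Submodule.span (ZMod 2) (Set.range fun k => x k - x 0)
  obtain ⟨g, hg⟩ := LinearMap.exists_leftInverse_of_injective K.subtype K.ker_subtype
  let M := LinearMap.toMatrix' (K.subtype ∘ₗ g)
  have hM : ∀ u, M *ᵥ u = g u := fun u => by
    simp [M, LinearMap.toMatrix'_mulVec]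
  have hMx : ∀ k, M *ᵥ (x k - x 0) = x k - x 0 := by
    intro k
    have hk : x k - x 0 ∈ K := Submodule.subset_span ⟨k, rfl⟩
    have := congrArg Subtype.val (LinearMap.congr_fun hg ⟨_, hk⟩)
    rw [hM]
    exact this
  have hort : ∀ l : Fin n → ZMod 2, (∀ k, l ⬝ᵥ x k = l ⬝ᵥ x 0) → ∀ u, l ⬝ᵥ (M *ᵥ u) = 0 := by
    intro l hl u
    rw [hM]
    refine Submodule.span_induction (p := fun v _ => l ⬝ᵥ v = 0) ?_ (by simp) ?_ ?_ (g u).2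
    · rintro _ ⟨k, rfl⟩
      simp [dotProduct_sub, hl k]
    · intro a b _ _ ha hb
      rw [dotProduct_add, ha, hb, add_zero]
    · intro c a _ ha
      rw [dotProduct_smul, ha, smul_zero]
  have hsum : ∑ u : Fin 4 → Fin n → ZMod 2, B y (fun k => M *ᵥ u k + x 0) = 0 := by
    rw [← sum_apply_mulVec_eq_zero hB h0 M (fun k => y k - x 0)]
    refine Finset.sum_congr rfl fun u _ => ?_
    have h := apply_add_add_of_commute hB (x 0) (fun k => y k - x 0) fun k => M *ᵥ u k
    simp only [sub_add_cancel] at h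
    exact h
  have hval : ∀ u : Fin 4 → Fin n → ZMod 2, B y (fun k => M *ᵥ u k + x 0) =
      if B y (fun k => M *ᵥ u k + x 0) = 0 then 0 else B y x := by
    intro u
    split_ifs with hu
    · exact hu
    obtain ⟨σ, hσ⟩ := exists_perm_of_dotWeight_eq (x := x) (y := fun k => M *ᵥ u k + x 0) (by
      intro l
      have hmod := (dotWeight_modEq_of_apply_ne_zero hB hyx l).symm.trans
        (dotWeight_modEq_of_apply_ne_zero hB hu l)
      by_cases hl : ∀ k, l ⬝ᵥ x k = l ⬝ᵥ x 0
      · simp only [dotWeight, dotProduct_add, hort l hl, zero_add, hl]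
      · have h1 : ¬(dotWeight l x = 0 ∨ dotWeight l x = 4) := fun h =>
          hl fun k => dotProduct_eq_of_dotWeight_eq h k 0
        have h2 := dotWeight_le l x
        have h3 := dotWeight_le l (fun k => M *ᵥ u k + x 0)
        unfold Nat.ModEq at hmod
        omega)
    rw [hσ, hsym]
  rw [Finset.sum_congr rfl fun u _ => hval u, Finset.sum_ite, Finset.sum_const_zero, zero_add,
    Finset.sum_const, nsmul_eq_mul] at hsum
  refine (mul_ne_zero ?_ hyx) hsum
  rw [Nat.cast_ne_zero, Finset.card_ne_zero]
  refine ⟨fun k => x k - x 0, ?_⟩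
  simpa [hMx] using hyx

lemma mul_symProj_comp_perm {α : Type*} [Fintype α] [DecidableEq α]
    (M : Matrix (Fin 4 → α) (Fin 4 → α) ℂ) (σ : Equiv.Perm (Fin 4)) (x y : Fin 4 → α) :
    (M * symProj α 4) x (y ∘ σ) = (M * symProj α 4) x y := by
  simp only [Matrix.mul_apply, symProj_comp_perm]

lemma mul_symProj_apply_zero {α : Type*} [Fintype α] [DecidableEq α] [Zero α]
    (M : Matrix (Fin 4 → α) (Fin 4 → α) ℂ) (y : Fin 4 → α) :
    (M * symProj α 4) y 0 = M y 0 := by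
  have h : ∀ z, symProj α 4 z 0 = if z = 0 then 1 else 0 := by
    intro z
    have h1 : ∀ σ : Equiv.Perm (Fin 4), (fun k => z (σ k)) = 0 ↔ z = 0 := by
      intro σ
      constructor
      · intro h; ext1 k; simpa using congrFun h (σ⁻¹ k)
      · rintro rfl; rfl
    simp only [symProj, Matrix.smul_apply, Matrix.sum_apply, permOp, Matrix.of_apply, h1]
    have h4 : (Nat.factorial 4 : ℂ) ≠ 0 := Nat.cast_ne_zero.2 (Nat.factorial_ne_zero 4)
    simp [Fintype.card_perm, inv_mul_cancel₀ h4]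
  simp [Matrix.mul_apply, h]

lemma codeCount_const_zero (b : ZMod 2) : codeCount (fun _ => b) (fun _ => 0) = 1 := by
  revert b; decide

lemma stabProj_const_zero {n : ℕ} (v : Fin n → ZMod 2) :
    stabProj n 4 (fun _ => v) 0 = ((2 : ℂ) ^ n)⁻¹ := by
  rw [stabProj_apply]
  simp [codeCount_const_zero]

/-- Operators on the symmetric subspace commuting with the Clifford group are combinations of
`P_+` and `P_-`. -/
lemma exists_eq_smul_add_smul {n : ℕ} (hn : 1 ≤ n)
    {A : Matrix (Fin 4 → Fin n → ZMod 2) (Fin 4 → Fin n → ZMod 2) ℂ}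
    (hA : ∀ G ∈ cliffordGens n, Commute (tpow G 4) A)
    (hsym : ∀ (σ : Equiv.Perm (Fin 4)) x y, A x (y ∘ σ) = A x y) :
    ∃ α β : ℂ, A = α • (stabProj n 4 * symProj (Fin n → ZMod 2) 4) +
      β • ((1 - stabProj n 4) * symProj (Fin n → ZMod 2) 4) := by
  have hconst : ∀ (M : Matrix (Fin 4 → Fin n → ZMod 2) (Fin 4 → Fin n → ZMod 2) ℂ),
      (∀ G ∈ cliffordGens n, Commute (tpow G 4) M) → ∀ y, M y 0 ≠ 0 → y = fun _ => y 0 := by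
    intro M hM y hy
    ext k i
    have h1 := dotWeight_modEq_of_apply_ne_zero hM hy (Pi.single i 1)
    have h2 : dotWeight (Pi.single i 1) (0 : Fin 4 → Fin n → ZMod 2) = 0 := by simp [dotWeight]
    have h3 := dotWeight_le (Pi.single i 1) y
    rw [h2] at h1
    unfold Nat.ModEq at h1
    simpa using dotProduct_eq_of_dotWeight_eq (l := Pi.single i 1) (x := y)
      (by omega) k 0
  let w : Fin n → ZMod 2 := Pi.single ⟨0, hn⟩ 1
  have hw : w ≠ 0 := by simp [w]
  have hcv : ∀ v, v ≠ 0 → A (fun _ => v) 0 = A (fun _ => w) 0 := by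
    intro v hv
    obtain ⟨L, hL, rfl⟩ := exists_det_ne_zero_mulVec_eq hw hv
    rw [← apply_mulVec_mulVec_of_commute hA L hL (fun _ => w) 0]
    simp
    rfl
  have hP : ∀ G ∈ cliffordGens n, Commute (tpow G 4) (stabProj n 4) :=
    fun G hG => commute_cliffordGens_stabProj hG
  set β := A 0 0 - A (fun _ => w) 0 with hβ
  set α := (2 : ℂ) ^ n * A (fun _ => w) 0 + β with hα
  refine ⟨α, β, sub_eq_zero.1 (eq_zero_of_apply_zero ?_ ?_ ?_)⟩
  · intro G hG
    have hS : Commute (tpow G 4) (symProj (Fin n → ZMod 2) 4) :=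
      (symProj_mul_tpow 4 G).symm
    refine (hA G hG).sub_right (Commute.add_right ?_ ?_)
    · exact ((hP G hG).mul_right hS).smul_right α
    · exact ((((Commute.one_right _).sub_right (hP G hG))).mul_right hS).smul_right β
  · intro σ x y
    simp only [Matrix.sub_apply, Matrix.add_apply, Matrix.smul_apply, hsym,
      mul_symProj_comp_perm]
  · intro y
    simp only [Matrix.sub_apply, Matrix.add_apply, Matrix.smul_apply, mul_symProj_apply_zero,
      smul_eq_mul]
    have h2n : (2 : ℂ) ^ n ≠ 0 := pow_ne_zero _ two_ne_zero
    by_cases hy : y = fun _ => y 0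
    · rw [hy, stabProj_const_zero]
      by_cases hy0 : y 0 = 0
      · rw [hy0, show (fun _ : Fin 4 => (0 : Fin n → ZMod 2)) = 0 from rfl,
          Matrix.one_apply_eq, hα, hβ]
        field_simp
        ring
      · rw [hcv _ hy0, Matrix.one_apply_ne (fun h => hy0 (congrFun h 0)), hα, hβ]
        field_simp
        ring
    · have h1 : A y 0 = 0 := by_contra fun h => hy (hconst A hA y h)
      have h2 : stabProj n 4 y 0 = 0 := by_contra fun h => hy (hconst _ hP y h)
      have h3 : y ≠ 0 := by rintro rfl; exact hy rfl
      rw [h1, h2, Matrix.one_apply_ne h3]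
      ring

lemma rankOne_mulVec {α : Type*} [Fintype α] (G : Matrix α α ℂ) (φ : α → ℂ) :
    rankOne (G *ᵥ φ) = G * rankOne φ * Gᴴ := by
  have h : ∀ φ : α → ℂ, rankOne φ = Matrix.vecMulVec φ (star φ) := fun φ => rfl
  rw [h, h, Matrix.star_mulVec, Matrix.mul_vecMulVec, Matrix.vecMulVec_mul]

lemma rankOne_mulVec_mul {α : Type*} [Fintype α] [DecidableEq α] {G : Matrix α α ℂ}
    (hG : G ∈ Matrix.unitaryGroup α ℂ) (φ : α → ℂ) :
    rankOne (G *ᵥ φ) * G = G * rankOne φ := by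
  rw [rankOne_mulVec, mul_assoc, ← Matrix.star_eq_conjTranspose,
    Matrix.mem_unitaryGroup_iff'.1 hG, mul_one]

lemma tpow_rankOne_comp_perm {α : Type*} [Fintype α] {t : ℕ} (φ : α → ℂ)
    (σ : Equiv.Perm (Fin t)) (x y : Fin t → α) :
    tpow (rankOne φ) t x (y ∘ σ) = tpow (rankOne φ) t x y := by
  simp only [tpow, rankOne, Matrix.of_apply, Finset.prod_mul_distrib, Function.comp_apply]
  rw [Equiv.prod_comp σ fun k => (starRingEnd ℂ) (φ (y k))]

lemma cliffordAvg4_comp_perm {n : ℕ} [Fintype (CliffordGroup n)] (ψ : (Fin n → ZMod 2) → ℂ)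
    (σ : Equiv.Perm (Fin 4)) (x y : Fin 4 → Fin n → ZMod 2) :
    cliffordAvg4 n ψ x (y ∘ σ) = cliffordAvg4 n ψ x y := by
  simp only [cliffordAvg4, Matrix.smul_apply, Matrix.sum_apply, tpow_rankOne_comp_perm]

lemma commute_cliffordGens_cliffordAvg4 {n : ℕ} [Fintype (CliffordGroup n)]
    (ψ : (Fin n → ZMod 2) → ℂ) {G : Matrix (Fin n → ZMod 2) (Fin n → ZMod 2) ℂ}
    (hG : G ∈ cliffordGens n) : Commute (tpow G 4) (cliffordAvg4 n ψ) := by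
  have hu := mem_unitaryGroup_of_mem_cliffordGens hG
  let g : CliffordGroup n := ⟨⟨G, hu⟩, Subgroup.subset_closure hG⟩
  refine Commute.smul_right ?_ _
  rw [Commute, SemiconjBy, Finset.mul_sum, Finset.sum_mul]
  conv_rhs => rw [← Equiv.sum_comp (Equiv.mulLeft g)]
  refine Finset.sum_congr rfl fun U _ => ?_
  rw [← tpow_mul, ← rankOne_mulVec_mul hu, tpow_mul, Matrix.mulVec_mulVec]
  rfl

lemma commute_cliffordGroup_stabProj {n : ℕ} {U : Matrix.unitaryGroup (Fin n → ZMod 2) ℂ}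
    (hU : U ∈ CliffordGroup n) :
    Commute (tpow (U : Matrix (Fin n → ZMod 2) (Fin n → ZMod 2) ℂ) 4) (stabProj n 4) := by
  induction hU using Subgroup.closure_induction with
  | mem U hU => exact commute_cliffordGens_stabProj hU
  | one =>
    rw [Matrix.UnitaryGroup.one_val, tpow_one]
    exact Commute.one_left _
  | mul U V _ _ hU hV =>
    rw [Matrix.UnitaryGroup.mul_val, tpow_mul]
    exact hU.mul_left hV
  | inv U _ hU =>
    have h : ∀ V : Matrix.unitaryGroup (Fin n → ZMod 2) ℂ,
        tpow (V : Matrix (Fin n → ZMod 2) (Fin n → ZMod 2) ℂ) 4 * tpow (↑V⁻¹) 4 = 1 := fun V => by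
      rw [← tpow_mul, ← Matrix.UnitaryGroup.mul_val, mul_inv_cancel, Matrix.UnitaryGroup.one_val,
        tpow_one]
    have h' := h U⁻¹
    rw [inv_inv] at h'
    let u : (Matrix (Fin 4 → Fin n → ZMod 2) (Fin 4 → Fin n → ZMod 2) ℂ)ˣ := ⟨_, _, h U, h'⟩
    exact Commute.units_inv_left (u := u) hU

lemma trace_cliffordAvg4_mul {n : ℕ} [Fintype (CliffordGroup n)] (ψ : (Fin n → ZMod 2) → ℂ)
    {M : Matrix (Fin 4 → Fin n → ZMod 2) (Fin 4 → Fin n → ZMod 2) ℂ}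
    (hM : ∀ U ∈ CliffordGroup n,
      Commute (tpow (U : Matrix (Fin n → ZMod 2) (Fin n → ZMod 2) ℂ) 4) M) :
    (M * cliffordAvg4 n ψ).trace = (M * tpow (rankOne ψ) 4).trace := by
  have h : ∀ U : CliffordGroup n, (M * tpow (rankOne (Matrix.mulVec
      ((U : Matrix.unitaryGroup (Fin n → ZMod 2) ℂ) :
        Matrix (Fin n → ZMod 2) (Fin n → ZMod 2) ℂ) ψ)) 4).trace =
      (M * tpow (rankOne ψ) 4).trace := by
    intro U
    rw [rankOne_mulVec, tpow_mul, tpow_mul, ← mul_assoc, Matrix.trace_mul_comm, ← mul_assoc,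
      ← mul_assoc, mul_assoc (tpow _ 4) M, ← (hM U U.2).eq, ← mul_assoc, ← tpow_mul,
      ← Matrix.star_eq_conjTranspose, Matrix.mem_unitaryGroup_iff'.1 U.1.2, tpow_one, one_mul]
  have hc : (Fintype.card (CliffordGroup n) : ℂ) ≠ 0 := Nat.cast_ne_zero.2 Fintype.card_ne_zero
  simp [cliffordAvg4, Finset.mul_sum, Matrix.trace_sum, h, hc]

lemma trace_cliffordAvg4 {n : ℕ} [Fintype (CliffordGroup n)] {ψ : (Fin n → ZMod 2) → ℂ}
    (hψ : ∑ x, (starRingEnd ℂ) (ψ x) * ψ x = 1) : (cliffordAvg4 n ψ).trace = 1 := by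
  have h := trace_cliffordAvg4_mul ψ (M := 1) fun U _ => Commute.one_right _
  rw [one_mul, one_mul, trace_tpow] at h
  have h1 : (rankOne ψ).trace = 1 := by
    simpa [Matrix.trace, rankOne, mul_comm] using hψ
  rw [h, h1, one_pow]

/-- For a unit vector `ψ ∈ ℂ^d`, `d = 2^n`, the Clifford average of
`(|ψ⟩⟨ψ|)^{⊗4}` equals `β_+·P_+ + β_−·P_−` with `β_+ = tr(P_{n,4}(|ψ⟩⟨ψ|)^{⊗4})/D_+` and
`β_− = (1 − D_+ β_+)/D_−`; in particular it equals `P_[4]/D_[4]` (i.e. `ψ` is a fiducial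
vector of a projective 4-design) iff `tr(P_{n,4}(|ψ⟩⟨ψ|)^{⊗4}) = 4/(d(d+3))`. -/
theorem stmt5 (n : ℕ) (hn : 1 ≤ n) [Fintype (CliffordGroup n)]
    (ψ : (Fin n → ZMod 2) → ℂ)
    (hψ : ∑ x, (starRingEnd ℂ) (ψ x) * ψ x = 1) :
    let d : ℂ := (2 : ℂ) ^ n
    let Dplus : ℂ := (d + 1) * (d + 2) / 6
    let Dminus : ℂ := (d - 1) * (d + 1) * (d + 2) * (d + 4) / 24
    let D4 : ℂ := d * (d + 1) * (d + 2) * (d + 3) / 24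
    let Pplus := stabProj n 4 * symProj (Fin n → ZMod 2) 4
    let Pminus := (1 - stabProj n 4) * symProj (Fin n → ZMod 2) 4
    let βplus : ℂ := Dplus⁻¹ * Matrix.trace (stabProj n 4 * tpow (rankOne ψ) 4)
    let βminus : ℂ := (1 - Dplus * βplus) / Dminus
    cliffordAvg4 n ψ = βplus • Pplus + βminus • Pminus ∧
      (cliffordAvg4 n ψ = D4⁻¹ • symProj (Fin n → ZMod 2) 4 ↔
        Matrix.trace (stabProj n 4 * tpow (rankOne ψ) 4) = 4 / (d * (d + 3))) := by

  intro d Dplus Dminus D4 Pplus Pminus βplus βminus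
  have hd2 : ((2 ^ n : ℕ) : ℂ) = d := by simp [d]
  have hpos : 1 < 2 ^ n := Nat.one_lt_two_pow (by omega)
  have hd0 : d ≠ 0 := pow_ne_zero _ two_ne_zero
  have hd : ∀ k : ℕ, d + (k + 1 : ℕ) ≠ 0 := fun k => by
    rw [← hd2]
    exact_mod_cast Nat.succ_ne_zero (2 ^ n + k)
  have hd1 : d + 1 ≠ 0 := by simpa using hd 0
  have hd2' : d + 2 ≠ 0 := by simpa using hd 1
  have hd3 : d + 3 ≠ 0 := by simpa using hd 2
  have hd4 : d + 4 ≠ 0 := by simpa using hd 3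
  have hdm : d - 1 ≠ 0 := by
    rw [← hd2, sub_ne_zero]
    exact_mod_cast hpos.ne'
  have hDp : Dplus ≠ 0 := by simp [Dplus, hd1, hd2']
  have hDm : Dminus ≠ 0 := by simp [Dminus, hd1, hd2', hd4, hdm]
  have hD4 : D4 ≠ 0 := by simp [D4, hd0, hd1, hd2', hd3]
  have hsum : Pplus + Pminus = symProj (Fin n → ZMod 2) 4 := by
    simp only [Pplus, Pminus, sub_mul, one_mul, add_sub_cancel]
  have htp : Pplus.trace = Dplus := trace_stabProj_mul_symProj n
  have hts : (symProj (Fin n → ZMod 2) 4).trace = D4 := trace_symProj_s5 n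
  have hDD : D4 - Dplus = Dminus := by simp only [D4, Dplus, Dminus]; ring
  have htm : Pminus.trace = Dminus := by
    rw [← hDD, ← hts, ← htp, ← hsum, Matrix.trace_add, add_sub_cancel_left]
  have hPp : stabProj n 4 * Pplus = Pplus := by
    simp only [Pplus, ← mul_assoc, stabProj_mul_self]
  have hPm : stabProj n 4 * Pminus = 0 := by
    simp only [Pminus, ← mul_assoc, mul_sub, mul_one, stabProj_mul_self, sub_self, zero_mul]
  set τ := Matrix.trace (stabProj n 4 * tpow (rankOne ψ) 4)
  have hβp : βplus = Dplus⁻¹ * τ := rfl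
  have htA : (stabProj n 4 * cliffordAvg4 n ψ).trace = τ :=
    trace_cliffordAvg4_mul ψ fun U hU => commute_cliffordGroup_stabProj hU
  have hmain : cliffordAvg4 n ψ = βplus • Pplus + βminus • Pminus := by
    obtain ⟨α, β, h⟩ := exists_eq_smul_add_smul hn
      (fun G hG => commute_cliffordGens_cliffordAvg4 ψ hG) (cliffordAvg4_comp_perm ψ)
    change cliffordAvg4 n ψ = α • Pplus + β • Pminus at h
    have h1 := htA
    rw [h, mul_add, Matrix.mul_smul, Matrix.mul_smul, hPp, hPm, smul_zero, add_zero,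
      Matrix.trace_smul, htp, smul_eq_mul] at h1
    have h2 := trace_cliffordAvg4 hψ
    rw [h, Matrix.trace_add, Matrix.trace_smul, Matrix.trace_smul, htp, htm, smul_eq_mul,
      smul_eq_mul] at h2
    have hα : α = βplus := by
      rw [hβp, ← h1]
      field_simp
    have hβ : β = βminus := by
      simp only [βminus]
      rw [← hα, eq_div_iff hDm, ← h2]
      ring
    rw [h, hα, hβ]
  have hquot : Dplus / D4 = 4 / (d * (d + 3)) := by
    simp only [Dplus, D4]
    field_simp
    norm_num
  refine ⟨hmain, ?_, ?_⟩
  · intro h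
    rw [← htA, h, Matrix.mul_smul, Matrix.trace_smul, ← hquot, div_eq_inv_mul, ← htp, smul_eq_mul]
  · intro h
    have h1 : βplus = D4⁻¹ := by
      rw [hβp, h, ← hquot]
      field_simp
    have h2 : βminus = D4⁻¹ := by
      simp only [βminus]
      rw [h1, ← hDD, div_eq_iff (hDD ▸ hDm)]
      field_simp
    rw [hmain, h1, h2, ← smul_add, hsum]

end
end
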